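/- In dimension 17, every finite set S of points on the unit sphere of EuclideanSpace ℝ (Fin 17) (i.e., ‖x‖ = 1 for all x ∈ S) such that any two distinct points of S are at Euclidean distance at least 1 has cardinality at most 11072; that is, the kissing number in dimension 17 is at most 11072. -/

import Mathlib

set_option maxRecDepth 100000
namespace Kiss
noncomputable section

/-! ### kernel-friendly primitives -/
/-- differences of natural numbers -/
inductive Z | mk (p n : ℕ)
def ofZ (z : ℤ) : Z := Int.rec (fun n => Z.mk n 0) (fun n => Z.mk 0 (Nat.succ n)) z
def ps (n : ℕ) : Z := Z.mk n 0
def ng (n : ℕ) : Z := Z.mk 0 n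
def mulZ (a b : Z) : Z := Z.rec (fun p n => Z.rec (fun q m =>
  Z.mk (Nat.add (Nat.mul p q) (Nat.mul n m)) (Nat.add (Nat.mul p m) (Nat.mul n q))) b) a
def sm (c : ℕ) (a : Z) : Z := Z.rec (fun p n => Z.mk (Nat.mul c p) (Nat.mul c n)) a
def addZ (a b : Z) : Z := Z.rec (fun p n => Z.rec (fun q m => Z.mk (Nat.add p q) (Nat.add n m)) b) a
def subZ (a b : Z) : Z := Z.rec (fun p n => Z.rec (fun q m => Z.mk (Nat.add p m) (Nat.add n q)) b) a
def leZ (a b : Z) : Bool := Z.rec (fun p n => Z.rec (fun q m => Nat.ble (Nat.add p m) (Nat.add n q)) b) a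
def eqZ (a b : Z) : Bool := Z.rec (fun p n => Z.rec (fun q m => Nat.beq (Nat.add p m) (Nat.add n q)) b) a
def mp {α β : Type} (f : α → β) (l : List α) : List β := List.rec [] (fun h _ ih => f h :: ih) l
def allB {α : Type} (f : α → Bool) (l : List α) : Bool :=
  List.rec true (fun h _ ih => Bool.rec false ih (f h)) l
def nth {α : Type} (d : α) (l : List α) : ℕ → α :=
  List.rec (fun _ => d) (fun h _ ih n => Nat.rec h (fun k _ => ih k) n) l
def rg17 : List ℕ := [0, 1, 2, 3, 4, 5, 6, 7, 8, 9, 10, 11, 12, 13, 14, 15, 16]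
def dotZ (l : List Z) : List Z → Z :=
  List.rec (fun _ => ps 0) (fun a _ ih m => List.rec (ps 0) (fun b bs _ => addZ (mulZ a b) (ih bs)) m) l

/-! ### evaluation of the certificate at integer points -/
def geZ (X : Z) (l : List ℤ) : ℕ → Z → Z → Z :=
  List.rec (fun _ _ _ => ps 0) (fun c _ ih d p q =>
    addZ (mulZ (ofZ c) (sm (Nat.pow 8 d) p))
      (ih (Nat.pred d) q (subZ (sm 2 (mulZ X q)) (sm 64 p)))) l
/-- values of all the columns at `X`; the degree is the first argument -/
def colZ (X : Z) (C : List (List (List ℤ))) : ℕ → List (List Z) :=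
  List.rec (fun _ => []) (fun c _ ih d => mp (fun l => geZ X l d (ps 1) X) c :: ih (Nat.pred d)) C
/-- weighted dot products -/
def mkZ (a : List (List Z)) : List (List Z) → ℕ → List Z :=
  List.rec (fun _ _ => []) (fun x _ ih b e => List.rec [] (fun y ys _ =>
    sm (Nat.pow 2 e) (dotZ x y) :: ih ys (Nat.sub e 8)) b) a
/-- `∑ M_k G_k` -/
def agZ (m : ℕ) (s w : Z) (M : List Z) : ℕ → Z → Z → Z :=
  List.rec (fun _ _ _ => ps 0) (fun a _ ih k g h =>
    addZ (mulZ a g) (ih (Nat.succ k) h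
      (subZ (sm (Nat.add (Nat.mul 2 k) m) (mulZ s h))
        (sm (Nat.mul (Nat.succ k) (Nat.sub (Nat.add k m) 2)) (mulZ w g))))) M
def agS (m : ℕ) (s w : Z) (M : List Z) : Z := agZ m s w M 0 (ps 1) (sm (Nat.sub m 2) s)
def nz (p n : ℕ) : Z := Z.mk (Nat.sub p n) (Nat.sub n p)
def uN (i : ℕ) : Z := nz (Nat.mul 3 i) 32
def sZ (U V W : Z) : Z := subZ (sm 32 W) (mulZ U V)
def oZ (U : Z) : Z := subZ (ps 1024) (mulZ U U)
def nmZ (z : Z) : Z := Z.rec nz z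
def aZ (M : List Z) (U V W : Z) : Z := agS 16 (nmZ (sZ U V W)) (nmZ (mulZ (oZ U) (oZ V))) M
def nd (i : ℕ) : Z := nz i 8
def aTab (C : List (List (List ℤ))) : List (List (List Z)) :=
  (fun tb : List (List (List Z)) =>
    mp (fun i => mp (fun j => (fun M => mp (fun l => aZ M (uN i) (uN j) (uN l)) rg17)
      (mkZ (nth [] tb i) (nth [] tb j) 80)) rg17) rg17) (mp (fun i => colZ (nd i) C 16) rg17)
def lk {α : Type} (d : α) (t : List (List (List α))) (i j k : ℕ) : α := nth d (nth [] (nth [] t i) j) k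
def tTab (a : List (List (List Z))) : List (List (List Z)) :=
  mp (fun i => mp (fun j => mp (fun l =>
    addZ (lk (ps 0) a i j l) (addZ (lk (ps 0) a i l j) (lk (ps 0) a j l i))) rg17) rg17) rg17
def app (M : List (List Z)) (t : List (List (List Z))) : List (List (List Z)) :=
  mp (fun w => mp (mp (dotZ w)) t) M
def app3 (M : List (List Z)) (t : List (List (List Z))) : List (List (List Z)) := app M (app M (app M t))
/-- `y ≤ B` in all permutations, where `B = 2^(r+e) - c` -/
def cm1 (r e : ℕ) (y : List (List (List ℕ))) (i j k : ℕ) (c : Z) : Bool :=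
  allB (fun v => leZ (addZ c (ps (Nat.mul v (Nat.pow 2 r)))) (ps (Nat.pow 2 (Nat.add r e))))
    [lk 0 y i j k, lk 0 y i k j, lk 0 y j i k, lk 0 y j k i, lk 0 y k i j, lk 0 y k j i]
def cmp (r e : ℕ) (c : List (List (List Z))) (y : List (List (List ℕ))) : Bool :=
  allB (fun i => allB (fun j => Bool.rec true (allB (fun k =>
    Bool.rec true (cm1 r e y i j k (lk (ps 0) c i j k)) (Nat.ble j k)) rg17) (Nat.ble i j)) rg17) rg17
def ok0 (C : List (List (List ℤ))) (Ei : List (List ℤ)) (r e : ℕ) (y : List (List (List ℕ))) : Bool :=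
  cmp r e (app3 (mp (mp ofZ) Ei) (tTab (aTab C))) y

/-! ### Bernstein evaluation -/
def pwZ (a : Z) (n : ℕ) : Z := Nat.rec (ps 1) (fun _ ih => mulZ a ih) n
def hrow (rg bin : List ℕ) (d : ℕ) (a b : Z) : List Z :=
  mp (fun i => sm (nth 0 bin i) (mulZ (pwZ a (Nat.sub d i)) (pwZ b i))) rg
def bin16 : List ℕ := [1, 16, 120, 560, 1820, 4368, 8008, 11440, 12870, 11440, 8008, 4368, 1820, 560, 120, 16, 1]
def okE (Ei : List (List Z)) (dl : ℕ) : Bool :=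
  allB (fun i => (fun row => allB (fun j => eqZ (dotZ row (mp (fun a => nth (ps 0) (nth [] Ei a) j) rg17))
    (Bool.rec (ps 0) (ps dl) (Nat.beq i j))) rg17) (hrow rg17 bin16 16 (ps (Nat.sub 16 i)) (ps i))) rg17
/-! ### the univariate polynomial -/
def rg33 : List ℕ := [0, 1, 2, 3, 4, 5, 6, 7, 8, 9, 10, 11, 12, 13, 14, 15, 16, 17, 18, 19, 20, 21, 22, 23, 24, 25, 26, 27, 28, 29, 30, 31, 32]
def bin32 : List ℕ := [1, 32, 496, 4960, 35960, 201376, 906192, 3365856, 10518300, 28048800, 64512240, 129024480, 225792840, 347373600, 471435600, 565722720, 601080390, 565722720, 471435600, 347373600, 225792840, 129024480, 64512240, 28048800, 10518300, 3365856, 906192, 201376, 35960, 4960, 496, 32, 1]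
def pZ (C : List (List (List ℤ))) (l0 : List ℤ) (c0 : ℕ) (ak : List ℕ) (X : Z) : Z :=
  (fun U gx => addZ (agS 17 (sm 32 U) (ps (Nat.pow 2 20)) (mp ps ak))
    (addZ (sm (Nat.mul c0 (Nat.pow 2 129)) (geZ X l0 16 (ps 1) X)) (aZ (mkZ gx gx 80) U U (ps 32))))
  (nmZ (subZ (sm 3 X) (ps 8))) (colZ X C 16)
def okP (C : List (List (List ℤ))) (l0 : List ℤ) (c0 : ℕ) (ak : List ℕ) (D : ℕ) (y : List ℕ) : Bool :=
  allB (fun i => eqZ (addZ (dotZ (hrow rg33 bin32 32 (nz 24 i) (nz i 8)) (mp ps y))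
      (sm D (addZ (pZ C l0 c0 ak (nz i 16)) (ps (Nat.pow 2 256))))) (ps (Nat.pow 2 418))) rg33

/-! symmetric extension of sorted data -/
def zc {α : Type} (l : List α) : List (List α) → List (List α) :=
  List.rec (fun _ => []) (fun h _ ih a => List.rec [] (fun x xs _ => (h :: x) :: ih xs) a) l
def tl {α : Type} (l : List α) : List α := List.rec [] (fun _ t _ => t) l
def symM (l : List (List ℕ)) : List (List ℕ) := List.rec [] (fun r _ ih => r :: zc (tl r) ih) l
def zt (l : List (List ℕ)) : List (List (List ℕ)) → List (List (List ℕ)) :=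
  List.rec (fun _ => []) (fun h _ ih a => List.rec [] (fun x xs _ => (h :: zc (tl h) x) :: ih xs) a) l
def symT (l : List (List (List ℕ))) : List (List (List ℕ)) :=
  List.rec [] (fun m _ ih => (fun s => s :: zt (tl s) ih) (symM m)) l

/-! ### subdivision -/
def adj (l : List ℕ) : ℕ → List ℕ :=
  List.rec (fun _ => []) (fun x _ ih h => Nat.add h x :: ih x) l
def lft (n : ℕ) : List ℕ → List ℕ :=
  Nat.rec (fun _ => [])
    (fun n ih l => List.rec [] (fun h t _ => Nat.mul h (Nat.pow 2 n) :: ih (adj t h)) l) n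
def revA (l : List ℕ) : List ℕ → List ℕ :=
  List.rec (fun a => a) (fun h _ ih a => ih (h :: a)) l
def rgt (n : ℕ) (l : List ℕ) : List ℕ := revA (lft n (revA l [])) []
def pk (s : ℕ) (l : List ℕ) : ℕ := List.rec 0 (fun h _ ih => Nat.add h (Nat.shiftLeft ih s)) l
def chunk (s N j : ℕ) : ℕ := Nat.mod (Nat.shiftRight N (Nat.mul s j)) (Nat.pow 2 s)
def swp (s : ℕ) (l : List ℕ) : List ℕ := mp (fun j => pk s (mp (fun N => chunk s N j) l)) rg17
def swI (s : ℕ) (N : ℕ) : ℕ := pk (Nat.mul s 17) (swp s (mp (chunk (Nat.mul s 17) N) rg17))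
def chk (m : ℕ) (l : List ℕ) : Bool := allB (fun h => Nat.beq (Nat.land h m) m) l

/-- 8 corners test for negativity of the determinant on a box -/
def detB (n1 q1 n2 q2 n3 q3 : ℕ) : Bool :=
  (fun a1 b1 a2 b2 a3 b3 : Z => (fun (E f1 f2 f3 : ℕ) (P1 P2 P3 : Z) =>
    (fun (c k1 k2 k3 : Z) (D : ℕ) => (fun F : Z → Z → Z → Bool =>
        F a1 a2 a3 && F a1 a2 b3 && F a1 b2 a3 && F a1 b2 b3 && F b1 a2 a3 && F b1 a2 b3 && F b1 b2 a3 && F b1 b2 b3)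
      (fun x y z => leZ (addZ c (sm D (mulZ x (mulZ y z)))) (addZ (mulZ k1 x) (addZ (mulZ k2 y) (mulZ k3 z)))))
    (addZ (ps (4 * E * E + 1)) (addZ (sm f1 (mulZ P1 P1)) (addZ (sm f2 (mulZ P2 P2)) (sm f3 (mulZ P3 P3)))))
    (sm (4 * f1) P1) (sm (4 * f2) P2) (sm (4 * f3) P3) (8 * E))
    (8 * q1 * q2 * q3) (16 * (q2 * q3) ^ 2) (16 * (q1 * q3) ^ 2) (16 * (q1 * q2) ^ 2) (addZ a1 b1) (addZ a2 b2) (addZ a3 b3))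
  (nz (3 * n1) (2 * q1)) (nz (3 * n1 + 3) (2 * q1)) (nz (3 * n2) (2 * q2)) (nz (3 * n2 + 3) (2 * q2))
  (nz (3 * n3) (2 * q3)) (nz (3 * n3 + 3) (2 * q3))
/-- box 1 lies (weakly) above box 2 -/
def geB (n1 q1 n2 q2 : ℕ) : Bool := Nat.ble (Nat.mul (Nat.succ n2) q1) (Nat.mul n1 q2)
def outB (n1 q1 n2 q2 n3 q3 : ℕ) : Bool :=
  geB n1 q1 n2 q2 || (geB n2 q2 n3 q3 || (geB n1 q1 n3 q3 || detB n1 q1 n2 q2 n3 q3))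

inductive Tr | L | O | X (t : Tr) | S (l r : Tr)
/-- the verifier inside a slab.  `o`: is the outer axis the first variable? -/
def run (W rp n3 q3 : ℕ) (t : Tr) : Bool → ℕ → ℕ → ℕ → ℕ → ℕ → List ℕ → Bool :=
  Tr.rec (motive := fun _ => Bool → ℕ → ℕ → ℕ → ℕ → ℕ → List ℕ → Bool)
    (fun _ e _ _ _ _ l => chk (Nat.shiftLeft rp e) l)
    (fun o _ n1 q1 n2 q2 _ => Bool.rec (outB n2 q2 n1 q1 n3 q3) (outB n1 q1 n2 q2 n3 q3) o)
    (fun _ ih o e n1 q1 n2 q2 l => ih (Bool.rec true false o) e n2 q2 n1 q1 (swp (Nat.mul W 17) l))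
    (fun _ _ ihl ihr o e n1 q1 n2 q2 l =>
      Bool.rec false
       (Bool.rec false (ihr o (Nat.add e 16) (Nat.succ (Nat.mul 2 n1)) (Nat.mul 2 q1) n2 q2 (rgt 17 l))
        (ihl o (Nat.add e 16) (Nat.mul 2 n1) (Nat.mul 2 q1) n2 q2 (lft 17 l)))
       (Nat.ble (Nat.add e 17) W)) t
def run1 (t : Tr) : ℕ → List ℕ → Bool :=
  Tr.rec (motive := fun _ => ℕ → List ℕ → Bool)
    (fun e l => allB (fun h => Nat.ble (Nat.pow 2 e) h) l) (fun _ _ => false) (fun _ _ _ _ => false)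
    (fun _ _ ihl ihr e l => Bool.rec false (ihr (Nat.add e 32) (rgt 33 l)) (ihl (Nat.add e 32) (lft 33 l))) t
/-- descend to a slab, then transpose and run -/
def slab (W : ℕ) (t : Tr) (p : List Bool) : ℕ → ℕ → ℕ → List ℕ → Bool :=
  List.rec (fun e n q l => run W (pk (Nat.mul W 17) (mp (fun _ => pk W (mp (fun _ => 1) rg17)) rg17)) n q t true e 0 1 0 1
      (mp (swI W) (swp (Nat.mul W 17) l)))
    (fun b _ ih e n q l => Bool.rec false
      (Bool.rec (ih (Nat.add e 16) (Nat.mul 2 n) (Nat.mul 2 q) (lft 17 l))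
        (ih (Nat.add e 16) (Nat.succ (Nat.mul 2 n)) (Nat.mul 2 q) (rgt 17 l)) b)
       (Nat.ble (Nat.add e 17) W)) p
def root (W : ℕ) (y : List (List (List ℕ))) : List ℕ := mp (fun m => pk (Nat.mul W 17) (mp (pk W) m)) y
end
end Kiss

namespace Kiss
def cols : List (List (List ℤ)) := [[[-811865234596, 1486742778951, -1242370535043, 895044854967, -593056375707, 359413008538, -210014967575, 130884463088, -88787768845, 72591350002, -59833579723, 47576817770, -34528999405, 20214166384, -10148021574, 3581174094, -825716160],
 [2933762425335, -5524483468723, 4593516625595, -3358830040165, 2155578458173, -1219051091928, 650412180086, -386505806726, 311646654597, -307582544799, 290351530557, -245416528256, 175991371186, -105862226702, 54165779879, -19307362369, 5219480207],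
 [342519410483, -646171156044, 464967329644, -274514063933, 74586475402, 67404681567, -151487319898, 194329066139, -206269073045, 211169022995, -198097487631, 165052518696, -116871110674, 68659385441, -29764890071, 8951433713],
 [-239252200254, 375616991697, -101375996072, -209459746317, 419113030313, -494344380732, 434041304815, -362283605263, 268517496929, -192400556500, 126889057303, -71526099190, 38438121060, -14683462822, 5997778445],
 [-1428252506577, 2718048376400, -2375715131400, 1872737751454, -1350500023451, 890484296704, -565688202405, 374382898087, -255840459975, 175845768763, -113779789731, 60046503673, -22779267745, 6619968939],
 [2379585452336, -4509759718244, 3854716535177, -2992889747499, 2114079712413, -1433437452675, 907639429166, -559817347751, 332613084306, -185158595493, 91910095955, -34213870139, 8623742639],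
 [-1633114514337, 3086748649917, -2567312367067, 1901875343942, -1228772232528, 722590868749, -411865643528, 254825915469, -157190010599, 86238728411, -35696549307, 8281755471],
 [570600254969, -1034050640119, 725985138286, -400032092452, 130605151836, -26727652525, 3274031582, -40440842464, 52206067724, -33162679711, 16269182466],
 [428781020468, -863185876760, 805709277809, -708241399494, 501425318356, -283345257913, 109553477513, -22904742249, -7117637596, 6175238758],
 [1580976908031, -2965646338785, 2438774680288, -1734222871714, 1047368767339, -515192150642, 201861485155, -49417223990, 7106851308],
 [-1350145245830, 2526059688536, -2062816469570, 1441327755697, -861183488794, 402564664516, -152112723134, 24552095372],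
 [819390509551, -1510232971044, 1163043250001, -739211993968, 371537297899, -137592846972, 32659380817],
 [-411951962621, 747557940414, -590149659959, 377522204725, -175546575100, 67305489044],
 [185431532409, -331037029724, 238154666600, -119913501811, 50980489181],
 [-68406718532, 129965065854, -76864495076, 42903168408],
 [42506283203, -56374876566, 41675864873],
 [-6479502406, 19407421003],
 [42178812]],
 [[-3823305816559, 7304078155478, -6173173053751, 4887050375102, -3720078144339, 2979961477497, -2639073937817, 2479716921556, -2384502781446, 2107626022198, -1698872452769, 1182293989151, -699180610883, 342087626481, -122130461619, 29228535953],
 [-921770022824, 1521094545056, -439462033364, -724321664126, 1690136871785, -2119844538066, 2076707219897, -1799482451227, 1410258700490, -1078438979397, 742899241769, -467018228950, 248200159926, -101863247492, 28374889924],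
 [116894552790, -93300868266, -267125253071, 617346076345, -899129968468, 895702935975, -893777325653, 793686478404, -692291244838, 552575495463, -367680008636, 216033309024, -87443262927, 31312062155],
 [-1687194139335, 3072277277528, -2528987435465, 1796032025663, -1257994291552, 813534363568, -443944715046, 163698169052, 25024604021, -112613656415, 115315048316, -61320625777, 24822625369],
 [-7221945214570, 14157340258822, -13172589083036, 11597325419601, -9552009208069, 7283208752993, -5115805654692, 3254626521311, -1830920650802, 870864404850, -315816799746, 67816562622],
 [3952819946251, -7566613859942, 6688365495799, -5520232956177, 4235587262519, -3142261805283, 2146452301651, -1367895140810, 737377951931, -296164589712, 79772803239],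
 [-2662399405815, 4749878522044, -3888951763956, 2532185495600, -1548632028937, 810143792850, -444034210146, 263220811231, -110356766215, 60123062548],
 [555377923668, -1080583620891, 567392210394, -195551518682, -85255969027, 175727823344, -64100040818, 24174864999, 17212829177],
 [-3818340980096, 6902915215901, -5469074271682, 3509593122190, -1840468281705, 824105060294, -244249562156, 90975477078],
 [7636086919990, -14058513010350, 10942820385754, -7042003865067, 3729061797812, -1408329371780, 389253861032],
 [-1555693658961, 2826056077404, -2141276039784, 1295511457133, -575887123647, 163917431653],
 [1143053401999, -2083111517365, 1475733811928, -782528669534, 275111797006],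
 [-404120811977, 697422495041, -430741245816, 175036731013],
 [108513024352, -132251900159, 107244386335],
 [-15413040655, 43145254400],
 [7072161062]],
 [[6413702119263, -12854965121286, 13067600689549, -13095802128740, 12817811241168, -11950295911629, 10559460777867, -8814728013721, 6911449019087, -5000384296168, 3288304920059, -1880810272380, 920650090463, -335330471792, 87520347283],
 [-3370407773706, 7532927767439, -8666334999142, 10102615477857, -10600846884641, 10119660862584, -8866275984357, 7090623550856, -5319907879707, 3560036405676, -2119142184098, 1068271457577, -411231403637, 118724743807],
 [-6079020519707, 11060158682348, -8885719117910, 5859832961322, -3369797782885, 1343609226104, -160367471542, -547522410053, 845084179840, -745810223463, 507152238360, -225899583162, 69773888180],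
 [2743775610768, -4589725154908, 2885033597710, -881011666619, -606685239964, 1132816113000, -1318279790359, 1010212406383, -710114220234, 440618537882, -190219789777, 86983482039],
 [19863741501711, -38661836253335, 34998295058733, -29628762641417, 23153863314722, -16449110279706, 10663845189161, -5980303328462, 2863107669756, -1010420966594, 221377830874],
 [-7128438824108, 13233020447976, -11919725883505, 9417529328002, -7242846292702, 5044068091125, -3102977368266, 1761361052586, -713885920428, 223841816892],
 [11361715315978, -21159757671613, 15815264614288, -10182694748494, 5157599767904, -2324369214803, 977374152441, -379858798253, 174065941436],
 [-2941278815642, 5346395198657, -4147378272122, 2615026662757, -1339086544619, 606617641107, -153802812404, 47617449275],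
 [2195068764465, -4080148867787, 3315074006151, -2313259040575, 1324187223684, -533395427290, 120411179567],
 [-4981640316566, 9042312717699, -6793289185332, 4034814234368, -1797623469738, 501688926026],
 [655712206955, -1137461480107, 861444724871, -503404607460, 245132915582],
 [-1416667989446, 2518067196459, -1500010652649, 598045538016],
 [263158794575, -297465761038, 225145143453],
 [-48417664124, 123930279226],
 [51405231679]],
 [[-26292064899010, 52003069306524, -49002845699988, 44520901672169, -38029080850864, 30455927717120, -23039441803108, 16244465480630, -10850122545519, 6613231922707, -3643397256635, 1745124508546, -637615909492, 167299177397],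
 [23542403887008, -46195622097141, 43797728801503, -39484769874464, 33569567869215, -26958437715001, 20229928318851, -14257986793105, 9183673189346, -5232658356314, 2589271123578, -968865143675, 284750870557],
 [12366707384571, -23365895619707, 19136851460763, -14148914065077, 8750243187894, -4674306243436, 1453803018898, 394148602731, -1086159351718, 973197602376, -493998138524, 175627853738],
 [1766353732684, -4388425247793, 5608490764157, -6814234153875, 6650440823417, -5505048259778, 3889021775541, -2174620808740, 1186448682121, -377876438708, 147989107368],
 [-35737514971196, 68025702939847, -59927298573838, 47867894712116, -35155163515876, 23178171619657, -13574999405741, 6690304977262, -2494621448737, 628207218272],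
 [18171688847993, -34726395529670, 27537785582630, -19800600832813, 12257157925100, -6831923189526, 3492057799246, -1421840935084, 481275255520],
 [-5237854279544, 8750100997104, -7303479999414, 4238206842008, -2143316733726, 995446151027, -247307681991, 248756159771],
 [6049220696969, -11039984504568, 8422586518794, -5073371075637, 2486072371402, -680980135772, 271924838157],
 [-3976873193711, 7062878153288, -5100021380964, 2674588653456, -1033003679933, 135412507466],
 [3163976459764, -5683454213741, 4010428445087, -2071229753938, 728542832018],
 [-1923664158878, 3768234481694, -2010698260845, 1106308005607],
 [687555727837, -972346981794, 594702725742],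
 [-54764271087, 208215019158],
 [32717865881]],
 [[51078063258934, -98914508034861, 91114114524711, -78482359233057, 63578553493768, -47970137686968, 33611394925254, -21925821726331, 12889362848021, -6915898523577, 3053670271093, -1108016875785, 213879884770],
 [-4752535874986, 9677097966980, -9937806425231, 10474972415365, -11591477658345, 11524252599465, -11053624786723, 8591192683834, -5836473747845, 3092853514668, -1209957351293, 339858915476],
 [2778918789143, -6141630992106, 6563524534738, -7616201297626, 7743840126389, -7116373655474, 6042263409339, -4096808681742, 2538340033262, -1021730972323, 350877297675],
 [-15129569159770, 29950403847620, -27008627027685, 23587763230609, -18334050668731, 12863827393782, -7546581102703, 3672253003580, -1375422676196, 315890344943],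
 [41303877818298, -78892934940884, 65866349351957, -50165858632481, 33294682461441, -19837548536393, 9966454487177, -3830156020491, 1047941111884],
 [-5305647279340, 10033759775523, -9164555637410, 7217028273603, -4860490839577, 2710649240405, -1078567606004, 375360755693],
 [-2827556636156, 3729585042082, -2282193306575, -332194657234, 889812478969, -577689945424, 221651090294],
 [-940780432131, 1444479271257, -1507812322038, 701519761806, -447825981735, 61569079357],
 [2369852804898, -4171623802841, 2789632960058, -1326685146892, 283954436499],
 [-1023693553749, 2376393168528, -1092166145171, 791094678050],
 [286861113572, -309664734629, 360562386110],
 [-76180308085, 234701373843],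
 [92264275079]],
 [[-112930733152602, 217471419069330, -193525288395797, 159622644314756, -121727199483103, 85315983124346, -54637095639188, 31470332618703, -16134839443040, 6987941902402, -2434941586994, 518162876410],
 [6859787388782, -14199761992005, 14247240747720, -15687254878376, 15419923149780, -14973939381863, 11847984150707, -8166471682324, 4378868420571, -1697576846559, 464953330067],
 [-45381141918270, 85616122544389, -72843363149064, 55861037723533, -38519112154825, 23966062271799, -12476736172023, 5650069663046, -1716465291378, 411898698320],
 [27871916871957, -53973705321421, 45705117221125, -35574899613530, 24616230074146, -14512508424131, 7424124648948, -2735690449830, 853499440092],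
 [-18202737554776, 34025091934478, -28980715111368, 21417601113749, -13850204184257, 7349699079636, -2977965671278, 860058014641],
 [7537126583187, -14762975897919, 11955014427746, -8940000085241, 5333140628416, -2274684244044, 878541378794],
 [-2106047069578, 4595149922341, -2443211358010, 1786139967616, -314767911217, 109097800677],
 [729633709841, -1761569433947, 867247465789, -700268996151, 26619936765],
 [-415939635201, 1389724321022, -485128743639, 628507740142],
 [214850460669, -244646074629, 206633030609],
 [-51701313570, 132616529664],
 [67509223171]],
 [[54678309275220, -105541232158453, 95718037791472, -80859912345524, 63129360212306, -45181376769636, 28821003637043, -16274593061177, 7614146461330, -2783583977088, 674057763240],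
 [-9225433072452, 18353586715201, -17249667182763, 15466953743143, -12482682069462, 9202841976201, -5619454108906, 3006479976897, -1056585473018, 263151205279],
 [-5789367722159, 10191240405052, -8251044686693, 4906703869777, -2238137778322, 312053913593, 361600408550, -460464575610, 210673080882],
 [-9257620276465, 17228946111038, -14307638940872, 10038469301811, -6049522583677, 2839894249112, -1079240110813, 161898070936],
 [1377783130433, -2605833047034, 2059435967177, -1415649817323, 845078338626, -364867629091, 146986917580],
 [-813229879067, 1424843527456, -1274687621969, 849743772612, -428884005815, 163265918501],
 [17174759426, -32887595724, 29304606341, -21430619763, 6418994267],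
 [-26597976594, 58093398734, -24381055162, 9752633132],
 [45888724520, -73327847083, 37683795546],
 [-36549075795, 120475230235],
 [25588815315]],
 [[-83477133033843, 158898351241598, -137068674661107, 106638575382833, -74295056681704, 45568109785688, -24261776387278, 10679497400602, -3625370306384, 841302800897],
 [38546684633788, -74023414164465, 62501046938710, -47731323564311, 32072108988546, -18590505483438, 9209812239388, -3360743068427, 965799816553],
 [-3019892619721, 5600162176810, -4645414616082, 3368839410282, -2122789453477, 1154859391539, -450927904963, 161484354135],
 [590275692143, -1088409841774, 876458249527, -599728233812, 335664967398, -140071897857, 42684222367],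
 [-154039025579, 273857252037, -216246953029, 138757724738, -70627453570, 29234688704],
 [67627798114, -124232401503, 82886454458, -44140630064, 14422561367],
 [-6170580776, 12673563397, -6399120315, 3727334563],
 [7837983128, -10275086366, 5729474754],
 [-9761108222, 30317093765],
 [25620385669]],
 [[13854447979415, -26292684225418, 22618708945565, -17427980927590, 11852048718453, -7022304474787, 3402965343885, -1296779046790, 318448690319],
 [-497987412836, 923440265710, -825315976216, 636191821150, -433654723973, 262267071954, -107102701812, 43935499959],
 [601359675608, -1134665806591, 894569545880, -608014603604, 339011732231, -138605065865, 45975418881],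
 [-225911144393, 408371697344, -307182774881, 182164454606, -80541641392, 23630858822],
 [53257061451, -95259006596, 66486463127, -33530365602, 11538234607],
 [-9139339159, 18523117350, -9427669825, 5152831152],
 [3922527478, -4975134871, 3649521460],
 [-982898941, 3175984599],
 [5507804226]],
 [[14437136636549, -25677100941532, 20531916223811, -12261583872801, 6367120891118, -1738733758802, 293259749527, 114695552475],
 [4766100740674, -8533260815318, 6886251357373, -4255077508069, 2296265570652, -755179810197, 181779841406],
 [-905699126527, 1533690625578, -1305952564864, 738209165283, -397132571320, 92564026658],
 [97899440700, -158570455112, 131044603542, -61009773195, 31027875515],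
 [-34992266501, 68648548032, -35541879958, 18366346153],
 [5114764243, -6226678265, 4522641575],
 [-587589559, 1747473484],
 [640747498]],
 [[310020412936, -581578269424, 460237292993, -312169851541, 173696878692, -71294845034, 22190980015],
 [-92130588841, 166080749103, -126344366112, 76096389697, -34471869749, 11447947566],
 [39141563959, -69434941202, 47504764976, -23459199822, 7318050422],
 [-22509493218, 42814941255, -22702318134, 10983036163],
 [5715460702, -6850097348, 5057682858],
 [-657300403, 1971132378],
 [331748762]]]
def einv : List (List ℤ) := [[460188999270000, 0, 0, 0, 0, 0, 0, 0, 0, 0, 0, 0, 0, 0, 0, 0, 0],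
 [-1095585292927125, 7363023988320000, -27611339956200000, 85901946530400000, -209385994667850000, 402021109762272000, -614198917692360000, 752080307378400000, -740329052575612500, 584951350183200000, -368519350615416000, 182736868073760000, -69795331555950000, 19823526122400000, -3944477136600000, 490868265888000, -28761812454375],
 [2181229653092490, -22669930021939200, 114464333535552000, -386654174210304000, 979693726467456000, -1923894206525491200, 2982959183005401600, -3690803985732864000, 3661338184982478000, -2910241075053312000, 1842187150779655680, -917025219536025600, 351380693375712000, -100071524577024000, 19958426744256000, -2488701926430720, 146078039056950],
 [-3717999013082211, 46788394470554880, -277013599761412800, 1036950959069625600, -2772915148952348400, 5626240359580608768, -8915964327192162240, 11205154280524089600, -11246467089775331700, 9020966385158956800, -5751931501859070528, 2880324387616515840, -1109140798652686800, 317202249197433600, -63490470619118400, 7941515560932096, -467406354234105],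
 [5503975171009524, -76917486243299328, 501595032070471680, -2034144480955023360, 5768703805655831040, -12181838219747868672, 19857442783398764544, -25481149487026421760, 25986100771372547520, -21107547851571118080, 13595944262678249472, -6865507498970824704, 2662347899137006080, -765956554073948160, 154100597008343040, -19361358600781824, 1143999696332988],
 [-7138796090186145, 106356395887061760, -738604558198267200, 3176630455531948800, -9484511594992434000, 20888466361190588160, -35183257144244489280, 46316504161806278400, -48202591721005250100, 39800684275027104000, -25984902713959949760, 13270237850631041280, -5195359909140601200, 1506979098398188800, -305340212331000000, 38601563477157120, -2293322987920635],
 [8153511943272750, -126646833153669120, 918006730467724800, -4121348553845913600, 12827400409951545600, -29361060128490854400, 51167917636447772160, -69337924588941465600, 73936374349301521200, -62307905843786803200, 41387468135978764800, -21449503730468136960, 8504559204984460800, -2494098279980697600, 510226288382937600, -65052008567654400, 3893888776465170],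
 [-8217658118935503, 131317592120951040, -980927046587436480, 4544851689402958080, -14612756002019688240, 34560537378926517504, -62184966888703538880, 86837750479617096960, -95154516149377344660, 82153826625899508480, -55745785861624482624, 29437235166124880640, -11865701806476270480, 3530863116942094080, -731714517715890240, 94371528949141248, -5707458360290925],
 [7304584994609336, -119072530340642816, 908855527169802240, -4310265121014415360, 14210029422036797440, -34515516346306265088, 63861100826064109568, -91761319082336583680, 103438225628464446720, -91761319082336583680, 63861100826064109568, -34515516346306265088, 14210029422036797440, -4310265121014415360, 908855527169802240, -119072530340642816, 7304584994609336],
 [-5707458360290925, 94371528949141248, -731714517715890240, 3530863116942094080, -11865701806476270480, 29437235166124880640, -55745785861624482624, 82153826625899508480, -95154516149377344660, 86837750479617096960, -62184966888703538880, 34560537378926517504, -14612756002019688240, 4544851689402958080, -980927046587436480, 131317592120951040, -8217658118935503],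
 [3893888776465170, -65052008567654400, 510226288382937600, -2494098279980697600, 8504559204984460800, -21449503730468136960, 41387468135978764800, -62307905843786803200, 73936374349301521200, -69337924588941465600, 51167917636447772160, -29361060128490854400, 12827400409951545600, -4121348553845913600, 918006730467724800, -126646833153669120, 8153511943272750],
 [-2293322987920635, 38601563477157120, -305340212331000000, 1506979098398188800, -5195359909140601200, 13270237850631041280, -25984902713959949760, 39800684275027104000, -48202591721005250100, 46316504161806278400, -35183257144244489280, 20888466361190588160, -9484511594992434000, 3176630455531948800, -738604558198267200, 106356395887061760, -7138796090186145],
 [1143999696332988, -19361358600781824, 154100597008343040, -765956554073948160, 2662347899137006080, -6865507498970824704, 13595944262678249472, -21107547851571118080, 25986100771372547520, -25481149487026421760, 19857442783398764544, -12181838219747868672, 5768703805655831040, -2034144480955023360, 501595032070471680, -76917486243299328, 5503975171009524],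
 [-467406354234105, 7941515560932096, -63490470619118400, 317202249197433600, -1109140798652686800, 2880324387616515840, -5751931501859070528, 9020966385158956800, -11246467089775331700, 11205154280524089600, -8915964327192162240, 5626240359580608768, -2772915148952348400, 1036950959069625600, -277013599761412800, 46788394470554880, -3717999013082211],
 [146078039056950, -2488701926430720, 19958426744256000, -100071524577024000, 351380693375712000, -917025219536025600, 1842187150779655680, -2910241075053312000, 3661338184982478000, -3690803985732864000, 2982959183005401600, -1923894206525491200, 979693726467456000, -386654174210304000, 114464333535552000, -22669930021939200, 2181229653092490],
 [-28761812454375, 490868265888000, -3944477136600000, 19823526122400000, -69795331555950000, 182736868073760000, -368519350615416000, 584951350183200000, -740329052575612500, 752080307378400000, -614198917692360000, 402021109762272000, -209385994667850000, 85901946530400000, -27611339956200000, 7363023988320000, -1095585292927125],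
 [0, 0, 0, 0, 0, 0, 0, 0, 0, 0, 0, 0, 0, 0, 0, 0, 460188999270000]]
def ylit : List (List (List ℕ)) := [[[4115765629211998887, 2295602654830934377, 2697521704013594091, 2449977492589725030, 2421542021773388976, 2375738090089699830, 2348967809638253987, 2332218580128400921, 2321482066134189387, 2314983033740915364, 2311089433377917428, 2308796956018167309, 2307468474161999708, 2306723702836411013, 2306307544404141475, 2306084408665077531, 2305965786490162397],
 [2089186288449221047, 2214085971023311247, 2221566246685787680, 2251033026058136901, 2267763266929469654, 2280189855667501786, 2288835083871033011, 2294826965817024479, 2298853308177626996, 2301477518973553201, 2303187831929598166, 2304258036026156042, 2304915749622900561, 2305314492713271293, 2305547979717040023, 2305681976117318242],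
 [2403044525935747907, 2319473964294113563, 2336672606688532477, 2324032267325689261, 2320091641417888868, 2316287231850671929, 2313204258722810085, 2310950686640614590, 2309333661322207528, 2308155216877800182, 2307339041224851968, 2306796712305691297, 2306429707610146932, 2306197457095483311, 2306051280216862753],
 [2285210816197600373, 2297747433352965474, 2296607926305267648, 2298559528182804537, 2300017580846803986, 2301202603672339121, 2302344754420510832, 2303202681378666033, 2303930116859098781, 2304489668082895117, 2304903699160679678, 2305213593856966223, 2305430268375898165, 2305580308868171229],
 [2314165904253445656, 2307986418713095703, 2309566694935689290, 2308810488207635986, 2308509932403224172, 2308073346140419766, 2307701383502773123, 2307327504540498021, 2306998052738161258, 2306720645443714435, 2306487782209058916, 2306304290484765123, 2306162985840868060],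
 [2303650361812547523, 2304643856083825163, 2304508534140043499, 2304431638878703477, 2304565773759731997, 2304641039877325065, 2304780386503953264, 2304924557101274615, 2305074601087795706, 2305219714400171051, 2305353446356776768, 2305470281367372540],
 [2306839617055695561, 2306195105283781995, 2306491714155118586, 2306501752795697342, 2306532719163272639, 2306537265181156397, 2306510627996086144, 2306466493975523828, 2306404089034759501, 2306331411630871632, 2306253956657492769],
 [2305584942904707828, 2305624301588848607, 2305560401897599536, 2305492330907386196, 2305440398819306253, 2305405637401057869, 2305381382657031464, 2305378757468511584, 2305390588893336336, 2305419196396040127],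
 [2305978997086983800, 2305932184149345582, 2305990261349528952, 2306049141311630756, 2306095293480615809, 2306149964237094029, 2306191214799890732, 2306226230100019353, 2306246111900788292],
 [2305790287983043258, 2305795183052191911, 2305756799894612877, 2305714179578881212, 2305665032900811470, 2305609483115078051, 2305551570575260765, 2305495621486842259],
 [2305872200033930750, 2305867381068926274, 2305900735851517635, 2305930774800433860, 2305979645755347041, 2306037811106923379, 2306107878774943023],
 [2305832594963617651, 2305820465569835980, 2305808673134074892, 2305774929966752552, 2305732723934266035, 2305670731946155009],
 [2305857683817636030, 2305851509904966856, 2305870060938265574, 2305892647523699570, 2305932061255591035],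
 [2305839707493519307, 2305835273935037795, 2305828759382857524, 2305813025769501734],
 [2305844469336809514, 2305843081585880910, 2305844163537264657],
 [2305847906394929449, 2305850983773907640],
 [2305839205565235189]],
 [[2510917524602319348, 2304954040660468256, 2361744975682371813, 2329394882243432978, 2327608655187739990, 2320848093182862449, 2316301005113953342, 2313208761743869387, 2310860628323432448, 2309176438060410721, 2308034820078550913, 2307244414821764431, 2306715759981687054, 2306377204392954916, 2306160528246049546, 2306027354648319786],
 [2275234602535752187, 2291303723029895691, 2291515618819877806, 2295205316232984820, 2297541217858460549, 2299513268678755036, 2301141214514732737, 2302370470203252353, 2303357002879670387, 2304090956683156668, 2304634755076948592, 2305033685039794712, 2305311448492681565, 2305503813103541477, 2305631912082030551],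
 [2322584982282724361, 2308081864466848034, 2312184666353149818, 2309936827224171816, 2309422925025358657, 2308712405387386275, 2308145364196387884, 2307606036039276012, 2307194505411129125, 2306848364806654877, 2306569685063104250, 2306359257527709390, 2306198444700194017, 2306081701446119874],
 [2301768631913641656, 2303993538793144246, 2303744050899748729, 2303913645447461224, 2304243351453233544, 2304402002814485443, 2304652708837026377, 2304853956398889070, 2305042751901228782, 2305214509677571829, 2305358988725103246, 2305480990736865140, 2305579471548784941],
 [2307823968883674559, 2306303924813305474, 2306863818473479022, 2306656968967287302, 2306674001701227169, 2306591609734633008, 2306526370662900178, 2306445351073644392, 2306360996844612196, 2306277770645198690, 2306197983421736731, 2306124498525207510],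
 [2305353732588720261, 2305487414892787112, 2305466284305249938, 2305408231382338181, 2305408202683474611, 2305406927716930379, 2305417248541811111, 2305441422905258308, 2305472283727319746, 2305511354475536896, 2305554607591786183],
 [2306138758108489137, 2305946115023002442, 2306052302845180634, 2306071548207786824, 2306097191857975530, 2306122035611949372, 2306132628943301789, 2306139609773235154, 2306135275490762585, 2306123663797121410],
 [2305745587869114656, 2305776773162339302, 2305730497551255246, 2305709860370253204, 2305676104748920324, 2305650122186168887, 2305623443288528098, 2305603051920848092, 2305587110534260447],
 [2305898463742589170, 2305879855093198626, 2305909617620438802, 2305931878657852271, 2305960411998141948, 2305991468573930415, 2306023623219190195, 2306057365315958331],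
 [2305811383257534126, 2305818319493851501, 2305801028603590458, 2305777494376116202, 2305753744196627207, 2305720770459576899, 2305682602235236175],
 [2305867650501189129, 2305854418572532690, 2305876588550802810, 2305890077893563277, 2305914467933804468, 2305946037121494014],
 [2305833206635858204, 2305830271901813387, 2305822867479286739, 2305808387812736316, 2305789763217029566],
 [2305851518881145124, 2305848685607235777, 2305854431804289382, 2305861932500049107],
 [2305842354900512198, 2305840756401070170, 2305840283906025380],
 [2305841039127680949, 2305840964281103414],
 [2305841863913345009]],
 [[2336585745925751649, 2305307753728052055, 2316527066702207933, 2310525195529210794, 2310723230494306118, 2309591419712600142, 2308804341261255754, 2308115078338661483, 2307603630372799589, 2307148288434390408, 2306799548735775995, 2306531826737632524, 2306323399685659912, 2306171900784935994, 2306062351544198128],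
 [2300367829152582015, 2302883043552682483, 2302743852286162824, 2303295517537217319, 2303720712770616109, 2304032154967995539, 2304378065239956437, 2304644445088067501, 2304889207350367014, 2305096980263784885, 2305268458216604036, 2305411258341023709, 2305524928355966564, 2305613865112242324],
 [2309673777608917586, 2306307420610773766, 2307508233657761910, 2306885144772082722, 2306940079219284815, 2306726685540080403, 2306647186619816574, 2306515798450865928, 2306409865498551208, 2306313001894958471, 2306223076131591880, 2306145295125010834, 2306078529635773726],
 [2304878915939363634, 2305293362444286325, 2305275390118479515, 2305250644385850136, 2305315819066994292, 2305339029060066449, 2305381299838936648, 2305426666453414269, 2305471154759324295, 2305518567809436931, 2305564488534797133, 2305608799938459668],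
 [2306469762796517203, 2305945092039846483, 2306202651689100050, 2306114424764706057, 2306153296274161042, 2306142086093687502, 2306135947694876958, 2306125641558820175, 2306108497400057136, 2306089253188131249, 2306066235783956757],
 [2305661901642664890, 2305729617413086674, 2305676785835771562, 2305678477321790776, 2305653777870482650, 2305648708981198886, 2305638766883944655, 2305636184085029620, 2305635535087791368, 2305639962117637706],
 [2305973481410956959, 2305891960565026334, 2305942629662731999, 2305949038535358469, 2305966258694928965, 2305982285940125895, 2305995169598431995, 2306008652085443585, 2306018533493972108],
 [2305772342200853118, 2305813655549927901, 2305778565580820161, 2305771394440877080, 2305754658048158044, 2305737143419577012, 2305719169857206834, 2305700359159133537],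
 [2305884952849456919, 2305862320735115288, 2305887538347267292, 2305893714057983636, 2305910951459894974, 2305928856325360326, 2305949418143519997],
 [2305819261310365659, 2305825599628225418, 2305815419570908455, 2305803016170158464, 2305790501559884070, 2305773116620672765],
 [2305861962186055776, 2305851973355919063, 2305862863196726603, 2305870769019648416, 2305881043521454831],
 [2305835409669201556, 2305835971008195713, 2305833155433743672, 2305827882579644178],
 [2305845221081095148, 2305845415851412629, 2305846381704085709],
 [2305844370187784739, 2305843545571262824],
 [2305844107181498478]],
 [[2312391417947781589, 2305581287426499725, 2308462808466413173, 2306972867886967460, 2307253032576864376, 2306888551723081856, 2306827937215017596, 2306632875248152777, 2306522452440325022, 2306404675574842638, 2306299723751881825, 2306212018592403622, 2306135050604441717, 2306070462494766738],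
 [2304497996030383615, 2305043316959622791, 2305006424200134044, 2305082121429110701, 2305177928014984175, 2305231901223072238, 2305302509071402289, 2305363468346840314, 2305421043190295988, 2305476673123635738, 2305527554460350715, 2305575048680200359, 2305618223053755553],
 [2306990323559638076, 2305910433929540359, 2306450377118128843, 2306149596900740030, 2306267317132170804, 2306185689486202391, 2306183848345247160, 2306156877190623895, 2306131171187519780, 2306107672409037711, 2306082013018817080, 2306056977481756086],
 [2305528718810861552, 2305647947953243493, 2305599051208703296, 2305619355761405282, 2305603907572289422, 2305615740365038306, 2305615135443744290, 2305623047314987229, 2305629916107865044, 2305639664314728948, 2305650368895469080],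
 [2306127367524508735, 2305888610602489194, 2306017268223638246, 2305975291366501306, 2305998180427502727, 2305999877318210212, 2306002940926285664, 2306006727123438451, 2306006636562755974, 2306006441691399858],
 [2305713260965549877, 2305799573746630352, 2305738548175216666, 2305755644811622820, 2305737390600999463, 2305732236770209016, 2305724403415491724, 2305717793396754564, 2305711538663851018],
 [2305923002757969494, 2305873704382595620, 2305906514097024484, 2305904150603335292, 2305916641917853496, 2305925110860212512, 2305933901763077809, 2305944088392298836],
 [2305792571760516734, 2305823084687836892, 2305802902837867374, 2305798035676757096, 2305790055037624722, 2305779571229941212, 2305769118589763813],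
 [2305874780035523747, 2305854653026937836, 2305871488566064249, 2305874950200527166, 2305883031017423444, 2305892588280312127],
 [2305826664892766293, 2305832384022772913, 2305826358487087927, 2305820168503344898, 2305814375224432223],
 [2305852699252262710, 2305848843806938187, 2305851892043159745, 2305855578180350720],
 [2305840821150098377, 2305840413914305533, 2305839763251882037],
 [2305842178489605295, 2305842637534428061],
 [2305842871202247823]],
 [[2307643874983678545, 2305721286817243916, 2306728913379026481, 2306125117381126829, 2306393249794807768, 2306204675299684375, 2306245197291131503, 2306190308998262566, 2306165990554905578, 2306140003127797899, 2306111358627146156, 2306085587885344664, 2306059988270041815],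
 [2305427656803894748, 2305556026186430322, 2305529561484184729, 2305554491605922725, 2305557077890317145, 2305574403100118354, 2305581565050272549, 2305594688102082427, 2305605357430069494, 2305617440805200307, 2305629468866299484, 2305642191716227335],
 [2306338688133673869, 2305847831397166763, 2306134317125245182, 2305984722587199981, 2306050417644002464, 2306025500568273366, 2306028428672323082, 2306026977563272887, 2306022387357367811, 2306020103983828826, 2306015796226741885],
 [2305658827424881517, 2305767911435971419, 2305692970117552073, 2305732017862999334, 2305708197023676768, 2305714294759577297, 2305709986153188127, 2305708774025706230, 2305707170719115490, 2305706125365693726],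
 [2305991284995616609, 2305879856956981088, 2305937382598645836, 2305919730724906805, 2305931015498865969, 2305932791057024199, 2305936001433679530, 2305940547611830562, 2305943604253638136],
 [2305756491090832215, 2305821335058613699, 2305783537738713801, 2305792784094360380, 2305785393401133068, 2305781208312466364, 2305777413881952092, 2305772899314046248],
 [2305889234121756223, 2305859026733841008, 2305879284270659754, 2305875836291661608, 2305881915463228224, 2305886462791792891, 2305890510624679554],
 [2305816125099852471, 2305831294933059076, 2305822003938668662, 2305819368677674130, 2305816408963573739, 2305812067638086063],
 [2305860024446482603, 2305849679527836058, 2305856045291846321, 2305858587579818675, 2305861128664539976],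
 [2305835601079320135, 2305838269662282873, 2305836880498886251, 2305834815271080850],
 [2305844987237483595, 2305844854184616397, 2305845057872489264],
 [2305843782297441773, 2305843385088813208],
 [2305842951305213137]],
 [[2306538052034264234, 2305756358197305833, 2306256692967227841, 2305948104189125328, 2306105785429979432, 2306027591907007428, 2306049741327441965, 2306040556322937461, 2306035272386004363, 2306033101724137587, 2306027534555761552, 2306023028715180973],
 [2305650276319379327, 2305715288255722460, 2305675345070091589, 2305703498282860301, 2305687754083996228, 2305696503866241000, 2305693632294476390, 2305694780625818009, 2305694857365144515, 2305695201274298057, 2305695530658144214],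
 [2306085564914369486, 2305862954999821732, 2305980699901295108, 2305929782608747848, 2305949257585981122, 2305945320241855657, 2305946707916638355, 2305949055726338607, 2305949225520256905, 2305951346360404216],
 [2305730183876917974, 2305814690953826119, 2305763186204704365, 2305786713637578415, 2305775893996310632, 2305776905846054092, 2305775396737721539, 2305773522954237492, 2305771735095159777],
 [2305905893828938715, 2305864956611855876, 2305885007763972799, 2305877910638944240, 2305882810018356490, 2305883337809326169, 2305884028461807782, 2305885811328591055],
 [2305805078312759923, 2305832885768272837, 2305819247796216778, 2305821907526081211, 2305820430242499249, 2305818895399960163, 2305818340482435391],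
 [2305862520374132629, 2305848820115157717, 2305856974401521218, 2305855701120545958, 2305856368171371474, 2305857281702997202],
 [2305832809922215124, 2305838483157335289, 2305836041504489566, 2305835136783438562, 2305835053100693011],
 [2305848165138179281, 2305845487612850882, 2305845887321961214, 2305846451298873687],
 [2305842120451127303, 2305842104997743403, 2305842414388711505],
 [2305842253363285112, 2305842595326423809],
 [2305843010649204163]],
 [[2306181517893751384, 2305809031210206953, 2306033597545336380, 2305915388931839674, 2305966066203001312, 2305948846476970293, 2305952929941402086, 2305953928106210510, 2305953231959438625, 2305955469263028654, 2305955981326751575],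
 [2305742996783865147, 2305790951571362838, 2305759502878061116, 2305778174380494531, 2305768921252195363, 2305771990229512370, 2305770684224330108, 2305769951148778048, 2305769111478207555, 2305767945094527017],
 [2305929803473650409, 2305865375029278959, 2305888687628467550, 2305882227004931309, 2305884335344332437, 2305883651858938913, 2305883814321344388, 2305885080401600228, 2305885204415031549],
 [2305798809295536401, 2305835494504926549, 2305817835479332699, 2305824746291705258, 2305822923480830610, 2305823044173087593, 2305823511614066787, 2305823463877231437],
 [2305857609759497543, 2305849278962245658, 2305853563550619632, 2305850925240039925, 2305851454139011417, 2305851352659048159, 2305850424245972230],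
 [2305834548393047783, 2305840756234322172, 2305838383663818681, 2305839138459451458, 2305839999707989816, 2305840487264643597],
 [2305847467975451891, 2305844098889287954, 2305844992815666873, 2305844835105566116, 2305843977418271123],
 [2305841336261179481, 2305842200914508402, 2305842719966339946, 2305842789238657769],
 [2305842930093173675, 2305843170470122773, 2305842712763666645],
 [2305843669223069061, 2305843379477284996],
 [2305843027079754087]],
 [[2305972610039212322, 2305844913154679684, 2305898700093816636, 2305882781639809073, 2305884374353016579, 2305884777508624131, 2305884693540774336, 2305885322668212742, 2305884671311858911, 2305885499919121717],
 [2305808542605136521, 2305831915684742242, 2305819671853947199, 2305825837240589307, 2305824014313090121, 2305824792171943935, 2305825126577279219, 2305825273066279326, 2305825619019262891],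
 [2305850129122666301, 2305852495742449051, 2305845912678304220, 2305848487036697876, 2305847576153887002, 2305847084192314951, 2305846029496047729, 2305845710492645402],
 [2305838808511109347, 2305844151664375152, 2305843093984540476, 2305844034696652283, 2305844737915385384, 2305845139118713030, 2305846034747323313],
 [2305840669714438554, 2305842308897513307, 2305841377514898379, 2305840965324193836, 2305839956548747947, 2305839490402906454],
 [2305843960243853658, 2305843687619478343, 2305844417571432104, 2305844506463816040, 2305845226514212057],
 [2305842407882560741, 2305842726636869444, 2305842003046213757, 2305841929926844156],
 [2305843653825722045, 2305843199559999445, 2305843528239555799],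
 [2305842537630278535, 2305842763256124565],
 [2305843003615283659]],
 [[2305857586819621446, 2305852250106335504, 2305839724344624049, 2305850882713078937, 2305844889311462134, 2305845822444550044, 2305845020252093235, 2305844957334374152, 2305843973950684843],
 [2305843054820058410, 2305847121173127845, 2305846651013616478, 2305847166767649163, 2305847736275742661, 2305848153186113473, 2305848836024705466, 2305849417728796413],
 [2305830204424856032, 2305843000858763567, 2305835671416187995, 2305837581363939513, 2305836408251916869, 2305836381180873985, 2305835731432748723],
 [2305848585736505620, 2305845736908075845, 2305847579986856423, 2305847421041929429, 2305848044301559358, 2305848207214757351],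
 [2305839181863041345, 2305841630951370626, 2305840325625561749, 2305840565492238926, 2305840235320487864],
 [2305844627227173687, 2305843669372266755, 2305844229964701469, 2305844163257420255],
 [2305842286531826028, 2305842765463200843, 2305842616439941706],
 [2305843276084940295, 2305843129629967159],
 [2305843007744499678]],
 [[2305824644512206724, 2305847071127608288, 2305830071554216717, 2305838025477859659, 2305834753456923101, 2305835202976540199, 2305834379922929919, 2305834179122540614],
 [2305850217292701597, 2305848026282726960, 2305849866748949745, 2305849504448727808, 2305849989898364343, 2305850092071723917, 2305850290780521862],
 [2305834211596038118, 2305841298420047992, 2305837966727980054, 2305838885299017812, 2305838376377456890, 2305838494434485431],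
 [2305846544933760637, 2305844490679059858, 2305845398985286124, 2305845159369030485, 2305845197696858426],
 [2305841355463613934, 2305842439603675384, 2305842068285233026, 2305842196355870873],
 [2305843531075177930, 2305843187138220617, 2305843226688781496],
 [2305842893128685523, 2305842965698920764],
 [2305843009509044243]],
 [[2305829555457557539, 2305843475751215451, 2305835769992219125, 2305838676634928794, 2305837528146526632, 2305837847582170792, 2305837705879466987],
 [2305847091142135988, 2305845365953628881, 2305846256978935607, 2305846026979831818, 2305846125465424499, 2305846073884575195],
 [2305839917930655943, 2305842213117548909, 2305841352770051182, 2305841620086291617, 2305841600059776530],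
 [2305844019553132854, 2305843407041735285, 2305843562907301840, 2305843497705439124],
 [2305842713682604537, 2305842908781763192, 2305842900015868306],
 [2305843048779872305, 2305843021566930409],
 [2305843010858915606]],
 [[2305838135335285820, 2305842815917914723, 2305840764544811896, 2305841464297305506, 2305841249630850804, 2305841288621922437],
 [2305844189911350337, 2305843626362425840, 2305843808231405082, 2305843763861042389, 2305843798351619365],
 [2305842432166904384, 2305842832287484443, 2305842733836821565, 2305842734533306363],
 [2305843126776441627, 2305843058458402496, 2305843068159611698],
 [2305842998154829955, 2305843005227396340],
 [2305843007526600199]],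
 [[2305842012414865181, 2305842917120263976, 2305842641556307113, 2305842694137879083, 2305842632078313185],
 [2305843170926538131, 2305843089782607633, 2305843115460771809, 2305843149837708364],
 [2305842972526426929, 2305842991075235758, 2305842976280786033],
 [2305843011761149526, 2305843011435741956],
 [2305843010089430585]],
 [[2305842933612505116, 2305842994867915491, 2305842977951128919, 2305842951170703744],
 [2305843012166894812, 2305843013849759072, 2305843024609134988],
 [2305843008899026021, 2305843007979919116],
 [2305843008948089288]],
 [[2305843012907872893, 2305843008840769692, 2305843004643368670],
 [2305843008544579261, 2305843009548139634],
 [2305843009245856730]],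
 [[2305843010677977579, 2305843009305983453],
 [2305843009221833426]],
 [[2305843009213697326]]]
noncomputable def ytab : List (List (List ℕ)) := symT ylit
def dl : ℕ := 8488988695070201674807451320320000
def c0 : ℕ := 115243311507179
def ak : List ℕ := [0, 2026546285166505581500801147929952932035747081695909984764240000000000000, 2247567781180091119220186159948495316865737708054954110453990000000000, 97409970710103186215204550206832411210451147390664599634479600000, 9944392607582374701139205876698107530156079764972814763495110, 3619243259167595206626959402195678770688272299386430529584, 23392015209330384551522404076573514249414177294258040, 2269498790038610330963356325947479274120966225011, 2373870447004253722583676885880083631118425, 2081509598732853715628603201647072069, 31481234470512264546290517681608]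
def dP : ℕ := 44376545575917796996582752078432455727513600
def yP : List ℕ := [1989323921137251130708531873188847250249055736823914428896534776501676454661282026265024,
 1989220075772762240652460059085369608258058844187134627005598604615648115300224083739499,
 1989976897671382607152733345268701864182932762101194593552513237218063341970141554118374,
 1984481328878317437981485479869889379449841985855961958948806109782738044977012994332209,
 2011342113891020325068353018248642813509494619222046797163523351498120536249796980388684,
 1917449274564870440200111788156068408829121012636451406275466146139287776373980533817399,
 2167982057755536348156700644404729616748341395061184955010813497923775252639310368364274,
 1634163689520032454588842953109639178562586220433031498188122599240680652583718374740349,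
 2570698218602611009137491636071480707982354187371070621038409521113989434125295625816536,
 1189363703014294748622003123211771142945631511936996678566902599450223335949092333869571,
 2925342327832738571410277073815417105929401754745929337677256291274863611910519463238654,
 1053229374824613415622012203739920622045183323362498767007674812513559671163810604460489,
 2786468358943382659311883697293587252347744377503227376412191254190260885253658311646564,
 1420909575666206540686223114653019593142105855542262752236856658960634407745417488158927,
 2312345083199057565182273609815445253026803300732727943835300988630104744948621887806986,
 1865831440088385440688646775128539222836909224964187680570550616257265675195710991867669,
 1988368468420629458678341415865894006897108686100034428611612350581276296251903922204144,
 2043166867791811421855745851294595350340482481757662209138054650678009516777692969657499,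
 1930632859769926846585854853361382850821421838176841699902030633417679262728633456270614,
 2031291541496292828215131299156627421868218350773417382600964891656372658717089393668449,
 1965952275677964235474351090062841897337829703676514208802918514861111861346707880508284,
 2000731753967288090537043344606588306877380641219090814783839370039898721241360894858599,
 1982714873149850870804832588688716613272685801763800637961128980750583312586844013779234,
 1994640754731425232917670621056259710755029490109051912571380622984749924358015071068333,
 1984580073161189986538618885040010921236609610164624380688917871940410374984973772523016,
 1992867376879730473135909115654924152352691503901830049808619879915852129924749054075699,
 1987093780468266578683850548927824805920594604025032676437070637060095930392291841724974,
 1990386977914822203335638879321708797203309165202459588439157994012711643081736760601849,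
 1988853160801178827576501054466217817920051564596784967927599098082292381547559960120724,
 1989430406848205713512298263365979220132355649758325519841793715757475848697434282380799,
 1989264498609753375988527478746934043284844928414368713867992923336227306983136860604474,
 1989296628714736070835098251159018380414500496404898371631379179921751859278223333332549,
 1989292945774537770885010224970826372890207170126442541278149047815447566394382134088224]
def l00 : List ℤ := (cols.headD []).headD []
end Kiss

namespace Kiss
open Tr
set_option linter.all false in
theorem s00 : slab 142 (S (X (S (S L O) O)) O) [false, false] 61 0 1 (root 142 ytab) = true := by decide +kernel
set_option linter.all false in
theorem s010 : slab 190 (S (X (S (S (X (S O O)) (X (S (S O L) (S L O)))) O)) O) [false, true, false] 61 0 1 (root 190 ytab) = true := by decide +kernel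
set_option linter.all false in
theorem s01100 : slab 270 (S (X (S (S (X (S O O)) (X (S (S L L) (S L (X (S O (S (X (S L O)) O))))))) O)) O) [false, true, true, false, false] 61 0 1 (root 270 ytab) = true := by decide +kernel
set_option linter.all false in
theorem s01101 : slab 302 (S (X (S (S (X (S O O)) (X (S (S L L) (S (X (S L (S L O))) (X (S O (S (X (S (S L (X (S O L))) O)) O))))))) O)) O) [false, true, true, false, true] 61 0 1 (root 302 ytab) = true := by decide +kernel
set_option linter.all false in
theorem s01110 : slab 302 (X (S (X (S (S (X (S O L)) (X (S O (S (X (S L O)) (X (S (S L (X (S L (S L O)))) (S (X (S (S (X (S L O)) (X (S L L))) (S (X (S L L)) O))) (X (S O L))))))))) O)) O)) [false, true, true, true, false] 61 0 1 (root 302 ytab) = true := by decide +kernel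
set_option linter.all false in
theorem s01111 : slab 302 (X (S (X (S (S (X (S L L)) (X (S O (S (X (S L O)) (X (S (S (X (S L L)) (X (S L (S (X (S L L)) L)))) (S (X (S (S (X (S L O)) L) L)) L))))))) O)) O)) [false, true, true, true, true] 61 0 1 (root 302 ytab) = true := by decide +kernel
set_option linter.all false in
theorem s1000 : slab 302 (S (X (S (S (X (S L O)) (X (S (S L (S L (X (S L L)))) (S (X (S (S (X (S L O)) L) (X (S (X (S L L)) (X (S (S L (X (S (X (S L L)) L))) (S (X (S L L)) L))))))) (X (S O (S (X (S L O)) (X (S L L))))))))) (S (X (S (S (S L (X (S L O))) (X (S (S L O) O))) (S (X (S (X (S (X (S L O)) (X (S L O)))) O)) (X (S (S L O) O))))) O))) (X (S O (S (X (S (S (X (S L O)) O) O)) O)))) [true, false, false, false] 61 0 1 (root 302 ytab) = true := by decide +kernel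
set_option linter.all false in
theorem s10010 : slab 286 (S (X (S (S (X (S L O)) (X (S (S L (S L (X (S L (X (S L (X (S L L)))))))) (S (X (S (S (X (S (S L L) O)) L) (X (S (S (X (S L L)) (X (S L L))) (X (S L L)))))) (X (S O (S (X (S L O)) (X (S L L))))))))) (S (X (S (S (X (S L O)) (X (S (S L L) O))) (S (X (S (X (S (S L (X (S L L))) (X (S L L)))) O)) (X (S L O))))) O))) (X (S O (S (X (S (S (X (S L O)) O) O)) O)))) [true, false, false, true, false] 61 0 1 (root 286 ytab) = true := by decide +kernel
set_option linter.all false in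
theorem s10011 : slab 286 (S (X (S (S (X (S L O)) (X (S (S L (X (S L (X (S L (S L (X (S L L)))))))) (S (X (S (S L (X (S L L))) (X (S (X (S (S L L) L)) L)))) (X (S O (S (X (S L O)) (X (S L L))))))))) (S (X (S (X (S (X (S (S L (X (S L L))) (X (S L L)))) O)) (S (S (X (S (S L L) O)) (X (S L O))) (X (S L O))))) O))) (X (S O (S (X (S (S (X (S L O)) O) O)) O)))) [true, false, false, true, true] 61 0 1 (root 286 ytab) = true := by decide +kernel
set_option linter.all false in
theorem s10100 : slab 366 (S (X (S (S (X (S L O)) (X (S (S L (X (S L (X (S L (S L (X (S L L)))))))) (S (X (S (S L (X (S L L))) (X (S (X (S (S L L) L)) (X (S L L)))))) (X (S O (S (X (S L O)) L))))))) (S (X (S (X (S (X (S (S L L) (S L (X (S L (X (S L (X (S L L))))))))) (X (S (S (S (X (S (X (S L (X (S L O)))) O)) (X (S (S (S (X (S L L)) (X (S (S (X (S L L)) (X (S L L))) L))) O) O))) (X (S L O))) L)))) (S (S (X (S (S L (S L L)) L)) (X (S L L))) (X (S L L))))) O))) (X (S O (S (X (S (S (X (S L L)) (X (S O L))) O)) O))))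 [true, false, true, false, false] 61 0 1 (root 366 ytab) = true := by decide +kernel
set_option linter.all false in
theorem s10101 : slab 318 (S (X (S (S (X (S L O)) (X (S (S L (X (S L L))) (S (X (S L (X (S (S L (X (S L L))) (X (S L L)))))) (X (S O L)))))) (S (X (S (X (S (S L (X (S (S L L) L))) (X (S (S (X (S (X (S (S L (X (S L L))) (X (S L L)))) O)) L) L)))) (S (X (S (S L (X (S (S (X (S L L)) L) L))) L)) (X (S L L))))) O))) (X (S O (S (X (S (S (X (S L L)) L) O)) O)))) [true, false, true, false, true] 61 0 1 (root 318 ytab) = true := by decide +kernel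
set_option linter.all false in
theorem s1011 : slab 318 (X (S (X (S (S (X (S L (S L L))) (X (S O (S (X (S L O)) (X (S (S (S L (X (S L L))) (X (S L L))) L)))))) O)) (X (S (X (S (X (S (X (S (X (S (S (X (S L (X (S (X (S L (X (S (X (S L L)) (X (S L L)))))) L)))) L) (S L (S L (X (S L L)))))) (X (S (S (X (S L L)) L) L)))) (S (X (S (S L L) L)) (X (S L L))))) O)) (S (X (S (S (X (S L O)) L) O)) O))))) [true, false, true, true] 61 0 1 (root 318 ytab) = true := by decide +kernel
set_option linter.all false in
theorem s11000 : slab 270 (X (S (X (S (S (X (S L (S L (X (S (S L (X (S L L))) (X (S (S L L) L))))))) (X (S O (S (X (S L O)) (X (S (S L L) L)))))) O)) (X (S (X (S (X (S (X (S (X (S (S (X (S L L)) (X (S L L))) (X (S L L)))) L)) (S (S (X (S L L)) (X (S (S L L) L))) (X (S L L))))) (X (S (X (S (X (S L (X (S L O)))) O)) (X (S (X (S (X (S (X (S L L)) O)) (X (S L O)))) O)))))) (S (X (S (S (X (S L O)) L) (S (S (X (S L L)) O) O))) (X (S O (S (X (S (S (X (S L O)) O) O)) O)))))))) [true, true, false,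 false, false] 61 0 1 (root 270 ytab) = true := by decide +kernel
set_option linter.all false in
theorem s1100100 : slab 350 (X (S (X (S (S (X (S L (S (X (S L (S L (X (S L L))))) (X (S (S L (X (S (X (S L (X (S L L)))) L))) (X (S (S L L) L))))))) (X (S O (S (X (S (S (X (S L L)) L) O)) (X (S (S L L) L)))))) O)) (X (S (X (S (X (S (X (S (X (S (S (X (S L (X (S L (X (S (S L L) L)))))) (X (S L (S L L)))) (X (S L (S L L))))) L)) (S (S (X (S L L)) (X (S L L))) (X (S L L))))) (X (S (X (S (X (S L (X (S (X (S L (X (S L L)))) O)))) O)) (X (S (X (S (X (S (X (S L L)) O)) (X (S L O)))) O)))))) (S (X (S (S (X (S L O)) L) (S (S L O) O))) (X (S O (S (X (S (S (X (S L O)) O) O)) O)))))))) [true, true, false, false, true, false, false] 61 0 1 (root 350 ytab) = true := by decide +kernel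
set_option linter.all false in
theorem s1100101 : slab 350 (X (S (X (S (S (X (S L (S (X (S L (S (X (S L L)) (X (S L L))))) (X (S (S (X (S L L)) (X (S (S L L) L))) (X (S (S L L) L))))))) (X (S O (S (X (S (S (X (S L L)) L) O)) (X (S (S (X (S L L)) L) L)))))) O)) (S (X (S (S (X (S (X (S (X (S (X (S L L)) (X (S (S L (X (S (S L L) L))) (X (S L L)))))) (X (S L (S L L))))) L)) (S (S (X (S (S L L) L)) (X (S L L))) (X (S L L)))) (S (S (X (S L L)) L) O))) (X (S (S (S L (X (S (S (X (S L (X (S L (X (S L (X (S L O)))))))) O) O))) (X (S (X (S (X (S (S (X (S L L)) (X (S L L))) O)) (X (S L O)))) O))) (S (X (S (S L O) O)) (S (X (S (S (X (S L O)) O) O)) O))))))) [true, true, false, false, true, false, true] 61 0 1 (root 350 ytab) = true := by decide +kernel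
set_option linter.all false in
theorem s1100110 : slab 350 (X (S (X (S (S (X (S L (S (X (S L (S (X (S L L)) (X (S (S L (X (S L L))) L))))) (X (S (S (X (S L L)) (X (S (S L L) L))) (S L (X (S L L)))))))) (X (S O (S (X (S (S (X (S (S (X (S L O)) L) L)) (X (S O L))) O)) (X (S (S (X (S (X (S L L)) L)) L) L)))))) O)) (S (X (S (S (X (S (X (S (X (S (X (S L L)) (X (S L L)))) (X (S L L)))) (S (X (S L L)) L))) (S (S (X (S (S L L) L)) (X (S L L))) (X (S L L)))) (S (S L (X (S O L))) O))) (X (S (S (S L (X (S (S (X (S L (X (S L (X (S L (X (S L L)))))))) O) O))) (X (S (X (S (X (S (S (X (S L L)) (X (S (X (S L L)) L))) O)) (X (S L O)))) O))) (S (X (S (S (X (S L L)) O) O)) (S (X (S (S (X (S L O)) O) O)) O))))))) [true, true, false, false, true, true, false] 61 0 1 (root 350 ytab) = true := by decide +kernel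
set_option linter.all false in
theorem s1100111 : slab 334 (X (S (X (S (S (X (S L (S (X (S L (S (X (S L L)) (X (S (S L (X (S L L))) L))))) (X (S (X (S (X (S L L)) (X (S L L)))) (X (S L (S (X (S L L)) (X (S L L)))))))))) (X (S O (S (X (S (S (X (S (S (X (S L O)) L) L)) (X (S O L))) O)) (X (S (S (S (X (S L L)) (X (S L L))) L) L)))))) O)) (S (X (S (S (X (S (X (S (X (S (X (S (S L L) L)) (X (S L L)))) L)) (X (S L (X (S L L)))))) (S (S (X (S L L)) (X (S L L))) (X (S L L)))) (S (S L (X (S O L))) O))) (X (S (S (S L (X (S (S (X (S L (S L (X (S L L))))) O) O))) (X (S (X (S (X (S (X (S (X (S L L)) L)) O)) (X (S L O)))) O))) (S (X (S (S (X (S L L)) O) O)) (S (X (S (S (X (S L O)) O) O)) O))))))) [true, true, false, false, true, true, true] 61 0 1 (root 334 ytab) = true := by decide +kernel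
set_option linter.all false in
theorem s110100 : slab 350 (X (S (X (S (S (X (S L (S (X (S L (S (X (S L L)) (X (S (S L L) L))))) (X (S (X (S L (X (S (S (X (S L (X (S L (X (S L L)))))) (X (S L (S (X (S L L)) L)))) L)))) (X (S L (S L L)))))))) (X (S O (S (X (S (S (X (S L L)) (X (S O L))) O)) (X (S (S L L) L)))))) O)) (S (X (S (S (X (S (X (S (X (S (X (S (S L L) L)) L)) L)) (X (S L (S (X (S L L)) (X (S L L))))))) (S (S (X (S L L)) (X (S L L))) (X (S L L)))) (S (S (X (S L L)) (X (S O L))) O))) (X (S (S (S L (X (S L O))) (X (S (X (S (X (S (X (S L L)) (X (S L L)))) (X (S L L)))) O))) (S (X (S (S (X (S L L)) L) O)) (S (X (S (S (X (S L O)) (X (S L L))) O)) O))))))) [true, true, false, true, false, false] 61 0 1 (root 350 ytab) = true := by decide +kernel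
set_option linter.all false in
theorem s110101 : slab 286 (X (S (X (S (S (X (S L (S L (S L (X (S L L)))))) (X (S O (S (X (S (S L (X (S O L))) O)) (X (S L L)))))) O)) (S (X (S (S (S (X (S L L)) (X (S L L))) (S (S (X (S L L)) (X (S L L))) L)) (S (S (X (S L L)) L) O))) (X (S (S (S L (S L (X (S L O)))) (X (S (X (S (S (X (S L L)) (X (S L L))) (X (S L L)))) O))) (S (X (S (S (X (S L L)) L) O)) (S (X (S (S (X (S L O)) L) O)) O))))))) [true, true, false, true, false, true] 61 0 1 (root 286 ytab) = true := by decide +kernel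
set_option linter.all false in
theorem s11011 : slab 270 (S (X (S (S (X (S L O)) (X (S L (S (X (S L L)) (X (S O L)))))) (S (X (S L (S (S (X (S L L)) (X (S L L))) (X (S L L))))) (X (S (S L (X (S L O))) (X (S (X (S (S L (X (S L L))) L)) O))))))) (X (S O (S (X (S (S (X (S L L)) L) O)) (X (S (X (S (S L L) O)) (S (X (S (S (X (S L O)) L) O)) O))))))) [true, true, false, true, true] 61 0 1 (root 270 ytab) = true := by decide +kernel
set_option linter.all false in
theorem s1110 : slab 270 (S (X (S (S (X (S L O)) (X (S L (S (X (S L L)) L)))) (S (X (S L (S (S (X (S L L)) (X (S L L))) (X (S L L))))) (X (S (S (X (S L (X (S O O)))) (X (S L (S L O)))) (X (S (X (S (S L (X (S L L))) (X (S L L)))) L))))))) (X (S O (S (X (S (S (X (S L L)) (X (S O L))) O)) (X (S (X (S (S L L) (S L O))) (S (X (S (S (X (S (S L L) O)) L) (S L O))) (X (S O L))))))))) [true, true, true, false] 61 0 1 (root 270 ytab) = true := by decide +kernel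
set_option linter.all false in
theorem s11110 : slab 286 (S (X (S (S (X (S (S L L) O)) (X (S L L))) (S (X (S L (S L (X (S L L))))) (X (S (X (S L (X (S O (X (S L (S L O))))))) (X (S (X (S (S L (X (S L L))) (X (S L L)))) L))))))) (X (S O (S (X (S (S (X (S L L)) L) O)) (X (S (X (S (S L L) (X (S L L)))) (S (X (S (S (X (S (S L L) O)) L) L)) (X (S O L))))))))) [true, true, true, true, false] 61 0 1 (root 286 ytab) = true := by decide +kernel
set_option linter.all false in
theorem s111110 : slab 318 (X (S (X (S (S (X (S (S L (X (S L L))) L)) (X (S O L))) O)) (X (S (X (S (X (S L (S (S L (X (S L L))) L))) (X (S (X (S L (X (S O (X (S L (S (X (S O (S O L))) O))))))) (X (S (X (S L (X (S L L)))) L)))))) (S (X (S L (S (S L L) (X (S L L))))) (X (S O (S (X (S (S L L) O)) (X (S L L)))))))))) [true, true, true, true, true, false] 61 0 1 (root 318 ytab) = true := by decide +kernel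
set_option linter.all false in
theorem s111111 : slab 398 (S (X (S (S (X (S (S (X (S L (X (S L L)))) (X (S O L))) O)) (X (S (S (X (S (X (S (X (S (X (S L (X (S L L)))) (X (S L L)))) (X (S L L)))) (X (S (X (S (X (S L (S L (X (S L L))))) L)) (X (S (S L L) L)))))) (X (S (S L L) (S L L)))) (S (S (X (S (S L L) (S L L))) (X (S L (S L L)))) (X (S O L)))))) (S (X (S (S (S L (X (S (S (X (S L (X (S L L)))) L) L))) (X (S (S (X (S (X (S L L)) L)) (X (S L (S (X (S L L)) (X (S L (S (X (S L L)) L))))))) L))) (S (X (S (X (S (X (S (X (S L L)) (S L (X (S (X (S L L)) L))))) (X (S L L)))) (X (S (X (S (X (S L (X (S L L)))) L)) (X (S L L)))))) (X (S (S L L) (S L L)))))) (S (X (S (S L (S L (X (S L (X (S (S L L) (X (S (X (S L (X (S L L)))) L)))))))) (S (X (S (X (S (S L (X (S L (S L L)))) (X (S L (S (X (S (X (S L L)) L)) L))))) (S (X (S (S (X (S L L)) L) L)) L))) (X (S (X (S (X (S L (S L (X (S L L))))) (X (S L (S L L))))) (X (S L (S L L)))))))) (X (S (S O (X (S (S (X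 (S O (S (X (S (X (S O (S (X (S (X (S O L)) O)) L))) O)) L))) (X (S O (S O L)))) O))) L)))))) (X (S O (S (X (S (S (X (S L L)) (X (S O L))) O)) (X (S (S (X (S (S (X (S L (X (S L L)))) L) (X (S L L)))) (X (S (S L L) L))) (S (X (S (S L (X (S L L))) (S (X (S L L)) (S L (X (S (S L (X (S L (S L (X (S L L)))))) L)))))) (X (S O L))))))))) [true, true, true, true, true, true] 61 0 1 (root 398 ytab) = true := by decide +kernel
end Kiss

namespace Kiss
theorem tP : okP cols l00 c0 ak dP yP = true := by decide +kernel
theorem tP1 : run1 (Tr.S (Tr.S (Tr.S (Tr.S Tr.L Tr.L) Tr.L) (Tr.S (Tr.S Tr.L Tr.L) Tr.L)) (Tr.S (Tr.S (Tr.S Tr.L Tr.L) Tr.L) (Tr.S (Tr.S Tr.L Tr.L) (Tr.S Tr.L Tr.L)))) 290 yP = true := by decide +kernel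
theorem t0 : ok0 cols einv 371 61 ytab = true := by decide +kernel
end Kiss

namespace Kiss
open Finset Polynomial

/-! ### semantics of the primitives -/
theorem mp_eq {α β : Type} (f : α → β) (l : List α) : mp f l = l.map f := by
  induction l with
  | nil => rfl
  | cons a l ih => exact congrArg (List.cons (f a)) ih
theorem allB_iff {α : Type} (f : α → Bool) (l : List α) : allB f l = true ↔ ∀ a ∈ l, f a = true := by
  induction l with
  | nil => simp [allB]
  | cons a l ih =>
    have : allB f (a :: l) = Bool.rec false (allB f l) (f a) := rfl
    rw [this]
    cases h : f a <;> simp [ih, h]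
theorem nth_eq {α : Type} (d : α) (l : List α) (n : ℕ) : nth d l n = l.getD n d := by
  induction l generalizing n with
  | nil => rfl
  | cons a l ih =>
    cases n with
    | zero => rfl
    | succ n => exact (ih n).trans (by simp)
theorem nth_map {α : Type} (d : α) (n : ℕ) (f : ℕ → α) (i : ℕ) (h : i < n) :
    nth d ((List.range n).map f) i = f i := by
  rw [nth_eq]; simp [List.getD, h]
theorem rg17_eq : rg17 = List.range 17 := by decide
theorem rg33_eq : rg33 = List.range 33 := by decide
theorem bin16_eq : bin16 = (List.range 17).map (Nat.choose 16) := by decide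
theorem bin32_eq : bin32 = (List.range 33).map (Nat.choose 32) := by
  simp [bin32, List.range_succ, Nat.choose]
theorem list_eq_map {α : Type} (d : α) (l : List α) (n : ℕ) (h : l.length = n) :
    l = (List.range n).map (nth d l) := by
  apply List.ext_getElem
  · simp [h]
  · intro i h1 h2
    simp [nth_eq, List.getD, List.getElem?_eq_getElem h1]

/-- the value of a difference -/
noncomputable def v (z : Z) : ℝ := Z.rec (fun p n => (p : ℝ) - n) z
@[simp] theorem v_mk (p n : ℕ) : v (Z.mk p n) = (p : ℝ) - n := rfl
@[simp] theorem v_ofZ (z : ℤ) : v (ofZ z) = z := by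
  cases z with
  | ofNat n => simp [ofZ]
  | negSucc n =>
    change ((0 : ℕ) : ℝ) - ((Nat.succ n : ℕ) : ℝ) = _
    rw [Int.cast_negSucc]; simp
@[simp] theorem v_ps (n : ℕ) : v (ps n) = n := by simp [ps]
@[simp] theorem v_mulZ (a b : Z) : v (mulZ a b) = v a * v b := by
  cases a; cases b; simp [mulZ]; ring
@[simp] theorem v_sm (c : ℕ) (a : Z) : v (sm c a) = c * v a := by
  cases a; simp [sm]; ring
@[simp] theorem v_addZ (a b : Z) : v (addZ a b) = v a + v b := by
  cases a; cases b; simp [addZ]; ring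
@[simp] theorem v_subZ (a b : Z) : v (subZ a b) = v a - v b := by
  cases a; cases b; simp [subZ]; ring
theorem leZ_iff (a b : Z) : leZ a b = true → v a ≤ v b := by
  cases a with | mk p n => cases b with | mk q m =>
  intro h
  have h' : p + m ≤ n + q := Nat.le_of_ble_eq_true h
  have : (p : ℝ) + m ≤ n + q := by exact_mod_cast h'
  simp; linarith
theorem eqZ_iff (a b : Z) : eqZ a b = true → v a = v b := by
  cases a with | mk p n => cases b with | mk q m =>
  intro h
  have h' : p + m = n + q := Nat.eq_of_beq_eq_true h
  have : (p : ℝ) + m = n + q := by exact_mod_cast h'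
  simp; linarith
@[simp] theorem v_nz (p n : ℕ) : v (nz p n) = (p : ℝ) - n := by
  simp only [nz, v_mk, Nat.sub_eq]
  rcases le_total p n with h | h
  · rw [Nat.sub_eq_zero_of_le h, Nat.cast_sub h]; simp
  · rw [Nat.sub_eq_zero_of_le h, Nat.cast_sub h]; simp
@[simp] theorem v_nmZ (z : Z) : v (nmZ z) = v z := by
  cases z; exact v_nz _ _
@[simp] theorem v_uN (i : ℕ) : v (uN i) = 3 * ((i : ℝ) - 8) - 8 := by
  simp [uN]; ring
@[simp] theorem v_nd (i : ℕ) : v (nd i) = (i : ℝ) - 8 := by simp [nd]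
@[simp] theorem v_pwZ (a : Z) (n : ℕ) : v (pwZ a n) = v a ^ n := by
  induction n with
  | zero => simp [pwZ]
  | succ n ih =>
    have : pwZ a (n + 1) = mulZ a (pwZ a n) := rfl
    rw [this, v_mulZ, ih, pow_succ']
theorem v_dotZ (n : ℕ) (f g : ℕ → Z) :
    v (dotZ ((List.range n).map f) ((List.range n).map g)) = ∑ i ∈ range n, v (f i) * v (g i) := by
  induction n generalizing f g with
  | zero => simp [dotZ]
  | succ n ih =>
    rw [List.range_succ_eq_map, List.map_cons, List.map_cons, List.map_map, List.map_map, Finset.sum_range_succ']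
    have : ∀ a b l m, dotZ (a :: l) (b :: m) = addZ (mulZ a b) (dotZ l m) := fun _ _ _ _ => rfl
    rw [this, v_addZ, v_mulZ, ih]
    simp [add_comm]
theorem v_dotZ' (l m : List Z) : v (dotZ l m) = (List.zipWith (fun a b => v a * v b) l m).sum := by
  induction l generalizing m with
  | nil => simp [dotZ]
  | cons a l ih =>
    cases m with
    | nil => simp [dotZ]
    | cons b m =>
      have : dotZ (a :: l) (b :: m) = addZ (mulZ a b) (dotZ l m) := rfl
      rw [this]; simp [ih]

/-! ### the real functions -/
noncomputable def gR (l : List ℤ) (X : ℝ) : ℕ → ℝ → ℝ → ℝ :=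
  List.rec (fun _ _ _ => 0) (fun c _ ih d p q =>
    c * (8 ^ d * p) + ih (d - 1) q (2 * (X * q) - 64 * p)) l
theorem v_geZ (X : Z) (l : List ℤ) (d : ℕ) (p q : Z) :
    v (geZ X l d p q) = gR l (v X) d (v p) (v q) := by
  induction l generalizing d p q with
  | nil => simp [geZ, gR]
  | cons c l ih =>
    have h1 : geZ X (c :: l) d p q = addZ (mulZ (ofZ c) (sm (Nat.pow 8 d) p))
      (geZ X l (Nat.pred d) q (subZ (sm 2 (mulZ X q)) (sm 64 p))) := rfl
    have h2 : gR (c :: l) (v X) d (v p) (v q) = c * (8 ^ d * v p) +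
      gR l (v X) (d - 1) (v q) (2 * (v X * v q) - 64 * v p) := rfl
    rw [h1, h2, v_addZ, ih]
    simp [Nat.pred_eq_sub_one]
noncomputable def g (l : List ℤ) (d : ℕ) (X : ℝ) : ℝ := gR l X d 1 X

/-- the Gegenbauer-type polynomials -/
noncomputable def G (m : ℕ) (s w : ℝ) : ℕ → ℝ
  | 0 => 1
  | 1 => ((m : ℝ) - 2) * s
  | k + 2 => (2 * (k : ℝ) + m) * (s * G m s w (k + 1)) - (k + 1) * ((k : ℝ) + m - 2) * (w * G m s w k)

noncomputable def sumG (m : ℕ) (s w : ℝ) : List ℝ → ℕ → ℝ :=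
  List.rec (fun _ => 0) (fun a _ ih k => a * G m s w k + ih (k + 1))
theorem v_agZ (m : ℕ) (hm : 2 ≤ m) (s w : Z) (M : List Z) (k : ℕ) (a b : Z)
    (ha : v a = G m (v s) (v w) k) (hb : v b = G m (v s) (v w) (k + 1)) :
    v (agZ m s w M k a b) = sumG m (v s) (v w) (M.map v) k := by
  induction M generalizing k a b with
  | nil => simp [agZ, sumG]
  | cons c M ih =>
    have h1 : agZ m s w (c :: M) k a b = addZ (mulZ c a) (agZ m s w M (Nat.succ k) b
      (subZ (sm (Nat.add (Nat.mul 2 k) m) (mulZ s b))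
        (sm (Nat.mul (Nat.succ k) (Nat.sub (Nat.add k m) 2)) (mulZ w a)))) := rfl
    have h2 : sumG m (v s) (v w) ((c :: M).map v) k = v c * G m (v s) (v w) k +
      sumG m (v s) (v w) (M.map v) (k + 1) := rfl
    rw [h1, h2, v_addZ, v_mulZ, ha]
    congr 1
    apply ih
    · exact hb
    · rw [v_subZ, v_sm, v_sm, v_mulZ, v_mulZ, ha, hb, G]
      simp only [Nat.add_eq, Nat.mul_eq, Nat.sub_eq, Nat.succ_eq_add_one]
      push_cast [Nat.cast_sub (show 2 ≤ k + m by omega)]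
      ring
theorem v_agS (m : ℕ) (hm : 2 ≤ m) (s w : Z) (M : List Z) :
    v (agS m s w M) = sumG m (v s) (v w) (M.map v) 0 := by
  apply v_agZ m hm
  · simp [G]
  · simp [G, Nat.cast_sub hm]

/-- `∑ₖ 2^(80-8k) ∑ g g Gₖ` -/
noncomputable def AR (x y s w : ℝ) : List (List (List ℤ)) → ℕ → ℝ :=
  List.rec (fun _ => 0) (fun c _ ih k =>
    2 ^ (80 - 8 * k) * (c.map (fun l => g l (16 - k) x * g l (16 - k) y)).sum * G 16 s w k + ih (k + 1))
theorem AR_cons (x y s w : ℝ) (c : List (List ℤ)) (C : List (List (List ℤ))) (k : ℕ) :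
    AR x y s w (c :: C) k = 2 ^ (80 - 8 * k) * (c.map (fun l => g l (16 - k) x * g l (16 - k) y)).sum * G 16 s w k
      + AR x y s w C (k + 1) := rfl
theorem zip_map {α : Type} (f h : α → ℝ) (l : List α) (p q : α → Z) (hp : ∀ a, v (p a) = f a)
    (hq : ∀ a, v (q a) = h a) :
    v (dotZ (l.map p) (l.map q)) = (l.map (fun a => f a * h a)).sum := by
  rw [v_dotZ']
  simp [List.zipWith_map, hp, hq]
theorem sum_mk (X Y : Z) (s w : ℝ) (C : List (List (List ℤ))) (k : ℕ) :
    sumG 16 s w ((mkZ (colZ X C (16 - k)) (colZ Y C (16 - k)) (80 - 8 * k)).map v) k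
      = AR (v X) (v Y) s w C k := by
  induction C generalizing k with
  | nil => simp [mkZ, colZ, sumG, AR]
  | cons c C ih =>
    have h1 : ∀ X, colZ X (c :: C) (16 - k) = mp (fun l => geZ X l (16 - k) (ps 1) X) c :: colZ X C (16 - (k + 1)) :=
      fun X => rfl
    have h2 : ∀ x y a b e, mkZ (x :: a) (y :: b) e = sm (Nat.pow 2 e) (dotZ x y) :: mkZ a b (e - 8) :=
      fun _ _ _ _ _ => rfl
    rw [h1, h1, h2, AR_cons, ← ih, List.map_cons, mp_eq, mp_eq]
    have h3 : ∀ a M, sumG 16 s w (a :: M) k = a * G 16 s w k + sumG 16 s w M (k + 1) := fun _ _ => rfl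
    have h4 : 80 - 8 * k - 8 = 80 - 8 * (k + 1) := by omega
    rw [h3, v_sm, zip_map (fun l => g l (16 - k) (v X)) (fun l => g l (16 - k) (v Y)), h4]
    · simp
    · intro l; rw [v_geZ]; simp [g]
    · intro l; rw [v_geZ]; simp [g]
/-- The function `A`. -/
noncomputable def AA (C : List (List (List ℤ))) (x y w : ℝ) : ℝ :=
  AR x y (32 * w - (3 * x - 8) * (3 * y - 8)) ((1024 - (3 * x - 8) ^ 2) * (1024 - (3 * y - 8) ^ 2)) C 0
theorem v_aZ (C : List (List (List ℤ))) (X Y U V W : Z) (hU : v U = 3 * v X - 8) (hV : v V = 3 * v Y - 8) :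
    v (aZ (mkZ (colZ X C 16) (colZ Y C 16) 80) U V W) = AA C (v X) (v Y) (v W) := by
  have h := sum_mk X Y (v (nmZ (sZ U V W))) (v (nmZ (mulZ (oZ U) (oZ V)))) C 0
  unfold aZ AA
  rw [v_agS 16 (by norm_num)]
  simp only [Nat.sub_zero, Nat.mul_zero] at h
  rw [h]
  simp [sZ, oZ, hU, hV, sq]
end Kiss

namespace Kiss
open Finset Polynomial

/-! ### polynomial functions of bounded degree -/
noncomputable def PD (n : ℕ) (f : ℝ → ℝ) : Prop := ∃ p : ℝ[X], p.natDegree ≤ n ∧ ∀ x, f x = p.eval x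
theorem PD.mono {n m : ℕ} {f : ℝ → ℝ} (h : PD n f) (hnm : n ≤ m) : PD m f := by
  obtain ⟨p, h1, h2⟩ := h; exact ⟨p, h1.trans hnm, h2⟩
theorem PD.const (n : ℕ) (c : ℝ) : PD n (fun _ => c) := ⟨C c, by simp, by simp⟩
theorem PD.id {n : ℕ} (h : 1 ≤ n) : PD n (fun x => x) := ⟨X, natDegree_X_le.trans h, by simp⟩
theorem PD.add {n : ℕ} {f h : ℝ → ℝ} (hf : PD n f) (hh : PD n h) : PD n (fun x => f x + h x) := by
  obtain ⟨p, h1, h2⟩ := hf; obtain ⟨q, h3, h4⟩ := hh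
  exact ⟨p + q, natDegree_add_le_of_degree_le h1 h3, by simp [h2, h4]⟩
theorem PD.sub {n : ℕ} {f h : ℝ → ℝ} (hf : PD n f) (hh : PD n h) : PD n (fun x => f x - h x) := by
  obtain ⟨p, h1, h2⟩ := hf; obtain ⟨q, h3, h4⟩ := hh
  exact ⟨p - q, (natDegree_sub_le_iff_left (n := n) h3).2 h1, by simp [h2, h4]⟩
theorem PD.mul {n m k : ℕ} {f h : ℝ → ℝ} (hf : PD n f) (hh : PD m h) (hk : n + m ≤ k) :
    PD k (fun x => f x * h x) := by
  obtain ⟨p, h1, h2⟩ := hf; obtain ⟨q, h3, h4⟩ := hh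
  exact ⟨p * q, (natDegree_mul_le_of_le h1 h3).trans hk, by simp [h2, h4]⟩
theorem PD.cmul {n : ℕ} {h : ℝ → ℝ} (c : ℝ) (hh : PD n h) : PD n (fun x => c * h x) :=
  (PD.const 0 c).mul hh (by omega)
theorem PD.sum {n : ℕ} {ι : Type} (s : Finset ι) (f : ι → ℝ → ℝ) (h : ∀ i ∈ s, PD n (f i)) :
    PD n (fun x => ∑ i ∈ s, f i x) := by
  classical
  induction s using Finset.induction_on with
  | empty => simpa using PD.const n 0
  | insert a s ha ih =>
    simp only [Finset.sum_insert ha]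
    exact (h a (by simp)).add (ih (fun i hi => h i (by simp [hi])))
theorem PD.pow {n m k : ℕ} {f : ℝ → ℝ} (hf : PD n f) (hk : n * m ≤ k) : PD k (fun x => f x ^ m) := by
  obtain ⟨p, h1, h2⟩ := hf
  exact ⟨p ^ m, (natDegree_pow_le_of_le m h1).trans (by linarith [Nat.mul_comm n m]), by simp [h2]⟩
theorem PD.ext {n : ℕ} {f h : ℝ → ℝ} (hf : PD n f) (hh : PD n h) (a : ℝ)
    (he : ∀ i < n + 1, f ((i : ℝ) - a) = h ((i : ℝ) - a)) (x : ℝ) : f x = h x := by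
  obtain ⟨p, h1, h2⟩ := hf; obtain ⟨q, h3, h4⟩ := hh
  have : p = q := by
    apply Polynomial.eq_of_degrees_lt_of_eval_finset_eq ((range (n + 1)).image (fun i : ℕ => (i : ℝ) - a))
    · rw [Finset.card_image_of_injective _ (fun i j hij => by simpa using hij), card_range]
      exact lt_of_le_of_lt degree_le_natDegree (by exact_mod_cast Nat.lt_succ_of_le h1)
    · rw [Finset.card_image_of_injective _ (fun i j hij => by simpa using hij), card_range]
      exact lt_of_le_of_lt degree_le_natDegree (by exact_mod_cast Nat.lt_succ_of_le h3)
    · intro y hy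
      obtain ⟨i, hi, rfl⟩ := Finset.mem_image.1 hy
      rw [← h2, ← h4]; exact he i (Finset.mem_range.1 hi)
  rw [h2, h4, this]

theorem PD_gR (l : List ℤ) (d r α n : ℕ) (x p q : ℝ → ℝ) (hx : PD α x) (hp : PD (α * r) p)
    (hq : PD (α * (r + 1)) q) (hn : l = [] ∨ α * (r + l.length - 1) ≤ n) :
    PD n (fun t => gR l (x t) d (p t) (q t)) := by
  induction l generalizing d r p q with
  | nil => exact PD.const n 0
  | cons c l ih =>
    have hn : α * (r + l.length) ≤ n := by simpa using hn
    have e : (fun t => gR (c :: l) (x t) d (p t) (q t)) = fun t => (c : ℝ) * (8 ^ d * p t) +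
      gR l (x t) (d - 1) (q t) (2 * (x t * q t) - 64 * p t) := rfl
    rw [e]
    have h0 : α * r ≤ n := le_trans (Nat.mul_le_mul_left _ (by omega)) hn
    refine ((hp.mono h0).cmul _ |>.cmul _).add (ih (d - 1) (r + 1) q _ hq ?_ ?_)
    · refine (PD.cmul 2 (hx.mul hq ?_)).sub (PD.cmul 64 (hp.mono ?_))
      · ring_nf; omega
      · exact Nat.mul_le_mul_left _ (by omega)
    · right
      exact le_trans (Nat.mul_le_mul_left _ (by omega)) hn
theorem PD_g (l : List ℤ) (d α k : ℕ) (x : ℝ → ℝ) (hx : PD α x) (hk : l.length + k ≤ 17) :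
    PD ((16 - k) * α) (fun t => g l d (x t)) := by
  apply PD_gR l d 0 α _ x (fun _ => 1) x hx (PD.const _ 1) (by simpa using hx)
  right
  rw [mul_comm]
  exact Nat.mul_le_mul_right _ (by omega)
theorem PD_G (m σ : ℕ) (s w : ℝ → ℝ) (hs : PD σ s) (hw : PD (2 * σ) w) (k : ℕ) :
    PD (k * σ) (fun t => G m (s t) (w t) k) := by
  induction k using Nat.twoStepInduction with
  | zero => exact PD.const _ 1
  | one => simpa [G] using hs.cmul _
  | more k h1 h2 =>
    simp only [G]
    refine ((hs.mul h2 ?_).cmul _).sub ((hw.mul h1 ?_).cmul _)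
    · ring_nf; omega
    · ring_nf; omega
def okC : List (List (List ℤ)) → ℕ → Bool
  | [], _ => true
  | c :: C, k => (c.all fun l => decide (l.length + k ≤ 17)) && decide (k ≤ 16) && okC C (k + 1)
theorem PD_AR (α β σ n : ℕ) (x y s w : ℝ → ℝ) (hx : PD α x) (hy : PD β y) (hs : PD σ s) (hw : PD (2 * σ) w)
    (h1 : 16 * (α + β) ≤ n) (h2 : 16 * σ ≤ n) (C : List (List (List ℤ))) (k : ℕ) (hC : okC C k = true) :
    PD n (fun t => AR (x t) (y t) (s t) (w t) C k) := by
  induction C generalizing k with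
  | nil => exact PD.const n 0
  | cons c C ih =>
    simp only [okC, Bool.and_eq_true, List.all_eq_true, decide_eq_true_eq] at hC
    obtain ⟨⟨hc, hk⟩, hC⟩ := hC
    simp only [AR_cons]
    refine PD.add ?_ (ih (k + 1) hC)
    have key : PD ((16 - k) * (α + β)) (fun t => (c.map (fun l => g l (16 - k) (x t) * g l (16 - k) (y t))).sum) := by
      clear hC ih
      induction c with
      | nil => simpa using PD.const _ 0
      | cons l c ih2 =>
        simp only [List.map_cons, List.sum_cons]
        refine PD.add ?_ (ih2 (fun l hl => hc l (by simp [hl])))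
        have hl := hc l (by simp)
        exact (PD_g l _ α k x hx hl).mul (PD_g l _ β k y hy hl) (by rw [Nat.mul_add])
    refine (key.cmul _).mul (PD_G 16 σ s w hs hw k) ?_
    obtain ⟨j, hj⟩ : ∃ j, 16 = k + j := ⟨16 - k, by omega⟩
    have : 16 - k = j := by omega
    rw [this]
    have a1 := Nat.mul_le_mul_left j h1
    have a2 := Nat.mul_le_mul_left k h2
    have a3 : 16 * n = k * n + j * n := by rw [hj]; ring
    nlinarith
theorem okC_cols : okC cols 0 = true := by decide +kernel

/-! ### homogeneous Bernstein forms -/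
noncomputable def hb (d : ℕ) (f : ℕ → ℝ) (a b : ℝ) : ℝ := ∑ i ∈ range (d + 1), (d.choose i : ℝ) * (a ^ (d - i) * b ^ i) * f i
theorem PD_hb (d : ℕ) (f : ℕ → ℝ) (a b : ℝ → ℝ) (ha : PD 1 a) (hb' : PD 1 b) : PD d (fun t => hb d f (a t) (b t)) := by
  apply PD.sum
  intro i hi
  have : i ≤ d := Nat.lt_succ_iff.1 (Finset.mem_range.1 hi)
  have h1 : PD d (fun t => (a t) ^ (d - i) * (b t) ^ i) :=
    (ha.pow (k := d - i) (by omega)).mul (hb'.pow (k := i) (by omega)) (by omega)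
  exact (h1.cmul _).mul (PD.const 0 _) (by omega)
theorem hb_add (d : ℕ) (f h : ℕ → ℝ) (a b : ℝ) : hb d (fun i => f i + h i) a b = hb d f a b + hb d h a b := by
  simp [hb, mul_add, Finset.sum_add_distrib]
theorem hb_cmul (d : ℕ) (c : ℝ) (f : ℕ → ℝ) (a b : ℝ) : hb d (fun i => c * f i) a b = c * hb d f a b := by
  simp only [hb, Finset.mul_sum]
  exact Finset.sum_congr rfl fun i _ => by ring
theorem hb_const (d : ℕ) (c a b : ℝ) : hb d (fun _ => c) a b = (a + b) ^ d * c := by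
  rw [add_comm a b, add_pow, hb, Finset.sum_mul]
  exact Finset.sum_congr rfl fun i _ => by ring
theorem hb_smul (d : ℕ) (f : ℕ → ℝ) (c a b : ℝ) : hb d f (c * a) (c * b) = c ^ d * hb d f a b := by
  simp only [hb, Finset.mul_sum]
  refine Finset.sum_congr rfl fun i hi => ?_
  have : i ≤ d := Nat.lt_succ_iff.1 (Finset.mem_range.1 hi)
  have h : c ^ d = c ^ (d - i) * c ^ i := by rw [← pow_add]; congr 1; omega
  rw [mul_pow, mul_pow, h]; ring
theorem hb_mono (d : ℕ) (f h : ℕ → ℝ) (a b : ℝ) (ha : 0 ≤ a) (hb' : 0 ≤ b) (hfh : ∀ i ≤ d, f i ≤ h i) :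
    hb d f a b ≤ hb d h a b := by
  refine Finset.sum_le_sum fun i hi => ?_
  exact mul_le_mul_of_nonneg_left (hfh i (Nat.lt_succ_iff.1 (Finset.mem_range.1 hi))) (by positivity)
theorem hb_congr (d : ℕ) (f h : ℕ → ℝ) (a b : ℝ) (hfh : ∀ i ≤ d, f i = h i) : hb d f a b = hb d h a b := by
  refine Finset.sum_congr rfl fun i hi => ?_
  rw [hfh i (Nat.lt_succ_iff.1 (Finset.mem_range.1 hi))]
theorem hb_comm (d : ℕ) (f : ℕ → ℕ → ℝ) (a b a' b' : ℝ) :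
    hb d (fun i => hb d (fun j => f i j) a' b') a b = hb d (fun j => hb d (fun i => f i j) a b) a' b' := by
  simp only [hb, Finset.mul_sum]
  rw [Finset.sum_comm]
  exact Finset.sum_congr rfl fun i _ => Finset.sum_congr rfl fun j _ => by ring
theorem PD_hb2 (d e : ℕ) (f : ℕ → ℝ → ℝ) (a b : ℝ) (h : ∀ i, PD e (f i)) : PD e (fun t => hb d (fun i => f i t) a b) := by
  apply PD.sum
  intro i _
  exact (h i).cmul _

/-! ### the inverse matrix -/
noncomputable def Ei (i j : ℕ) : ℝ := v (nth (ps 0) (nth [] (mp (mp ofZ) einv) i) j)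
theorem einv_shape : mp (mp ofZ) einv = (List.range 17).map (fun i => (List.range 17).map
    (fun j => nth (ps 0) (nth [] (mp (mp ofZ) einv) i) j)) := by
  have h := list_eq_map [] (mp (mp ofZ) einv) 17 (by decide +kernel)
  conv_lhs => rw [h]
  apply List.map_congr_left
  intro i hi
  apply list_eq_map
  have h2 : ∀ i ∈ List.range 17, (nth [] (mp (mp ofZ) einv) i).length = 17 := by decide +kernel
  exact h2 i hi
theorem tE : okE (mp (mp ofZ) einv) dl = true := by decide +kernel
theorem v_hrow17 (f : ℕ → Z) (a b : Z) :
    v (dotZ (hrow rg17 bin16 16 a b) (rg17.map f)) = hb 16 (fun i => v (f i)) (v a) (v b) := by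
  rw [hrow, mp_eq, rg17_eq, v_dotZ, hb]
  refine Finset.sum_congr rfl fun i hi => ?_
  rw [bin16_eq, nth_map _ _ _ _ (Finset.mem_range.1 hi)]
  simp
theorem v_hrow33 (f : ℕ → Z) (a b : Z) :
    v (dotZ (hrow rg33 bin32 32 a b) ((List.range 33).map f)) = hb 32 (fun i => v (f i)) (v a) (v b) := by
  rw [hrow, mp_eq, rg33_eq, v_dotZ, hb]
  refine Finset.sum_congr rfl fun i hi => ?_
  rw [bin32_eq, nth_map _ _ _ _ (Finset.mem_range.1 hi)]
  simp
theorem Ei_inv0 (i j : ℕ) (hi : i < 17) (hj : j < 17) :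
    hb 16 (fun a => Ei a j) (16 - (i : ℝ)) i = if i = j then (dl : ℝ) else 0 := by
  have h := tE
  simp only [okE, allB_iff] at h
  have h := eqZ_iff _ _ (h i (by rw [rg17_eq]; simpa using hi) j (by rw [rg17_eq]; simpa using hj))
  have e : v (ps (Nat.sub 16 i)) = 16 - (i : ℝ) := by
    simp [Nat.cast_sub (show i ≤ 16 by omega)]
  rw [mp_eq, v_hrow17, e, v_ps] at h
  refine Eq.trans h ?_
  by_cases hij : i = j
  · subst hij; simp
  · have hf : Nat.beq i j = false := by
      cases hc : Nat.beq i j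
      · rfl
      · exact absurd (Nat.eq_of_beq_eq_true hc) hij
    simp [hij, hf]
theorem Ei_inv (f : ℕ → ℝ) (i : ℕ) (hi : i < 17) :
    hb 16 (fun a => ∑ j ∈ range 17, Ei a j * f j) (16 - (i : ℝ)) i = dl * f i := by
  have : hb 16 (fun a => ∑ j ∈ range 17, Ei a j * f j) (16 - (i : ℝ)) i =
      ∑ j ∈ range 17, f j * hb 16 (fun a => Ei a j) (16 - (i : ℝ)) i := by
    simp only [hb, Finset.mul_sum]
    rw [Finset.sum_comm]
    exact Finset.sum_congr rfl fun i _ => Finset.sum_congr rfl fun j _ => by ring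
  rw [this, Finset.sum_eq_single_of_mem i (by simpa using hi)]
  · rw [Ei_inv0 i i hi hi]; simp [mul_comm]
  · intro j hj hne
    rw [Ei_inv0 i j hi (Finset.mem_range.1 hj)]; simp [Ne.symm hne]
end Kiss

namespace Kiss
open Finset
set_option exponentiation.threshold 1000

/-! ### the trivariate polynomial and its Bernstein coefficients -/
noncomputable def TT (x y z : ℝ) : ℝ :=
  AA cols x y (3 * z - 8) + (AA cols x z (3 * y - 8) + AA cols y z (3 * x - 8))
theorem AR_comm (x y s w : ℝ) (C : List (List (List ℤ))) (k : ℕ) : AR x y s w C k = AR y x s w C k := by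
  induction C generalizing k with
  | nil => rfl
  | cons c C ih => rw [AR_cons, AR_cons, ih]; simp only [mul_comm]
theorem AA_comm (C : List (List (List ℤ))) (x y w : ℝ) : AA C x y w = AA C y x w := by
  unfold AA
  rw [AR_comm, mul_comm (3 * x - 8), mul_comm (1024 - (3 * x - 8) ^ 2)]
theorem TT_swap12 (x y z : ℝ) : TT x y z = TT y x z := by
  unfold TT; rw [AA_comm cols x y]; ring
theorem TT_swap23 (x y z : ℝ) : TT x y z = TT x z y := by
  unfold TT; rw [AA_comm cols y z]; ring
theorem PD_U : PD 1 (fun x : ℝ => 3 * x - 8) := ((PD.id le_rfl).cmul 3).sub (PD.const 1 8)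
theorem PD_TT (y z : ℝ) : PD 16 (fun x => TT x y z) := by
  have h1 : ∀ y w : ℝ, PD 16 (fun x => AA cols x y w) := by
    intro y w
    apply PD_AR 1 0 1 16 _ (fun _ => y) _ _ (PD.id le_rfl) (PD.const _ _) _ _ (by norm_num) (by norm_num) _ _ okC_cols
    · exact (PD.const 1 _).sub (PD_U.mul (PD.const 0 _) (by norm_num))
    · exact ((PD.const 2 1024).sub (PD_U.pow (by norm_num))).mul (PD.const 0 _) (by norm_num)
  have h2 : PD 16 (fun x => AA cols y z (3 * x - 8)) := by
    apply PD_AR 0 0 1 16 (fun _ => y) (fun _ => z) _ _ (PD.const _ _) (PD.const _ _) _ _ (by norm_num) (by norm_num) _ _ okC_cols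
    · exact (PD_U.cmul 32).sub (PD.const 1 _)
    · exact PD.const _ _
  exact (h1 y _).add ((h1 z _).add h2)

noncomputable def tg (i j k : ℕ) : ℝ := TT ((i : ℝ) - 8) ((j : ℝ) - 8) ((k : ℝ) - 8)
noncomputable def ce (i j k : ℕ) : ℝ :=
  ∑ p ∈ range 17, Ei i p * ∑ q ∈ range 17, Ei j q * ∑ r ∈ range 17, Ei k r * tg p q r
theorem ce_swap12 (i j k : ℕ) : ce i j k = ce j i k := by
  unfold ce
  simp only [Finset.mul_sum]
  rw [Finset.sum_comm]
  refine Finset.sum_congr rfl fun p _ => Finset.sum_congr rfl fun q _ => Finset.sum_congr rfl fun r _ => ?_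
  rw [tg, TT_swap12, ← tg]; ring
theorem ce_swap23 (i j k : ℕ) : ce i j k = ce i k j := by
  unfold ce
  refine Finset.sum_congr rfl fun p _ => ?_
  simp only [Finset.mul_sum]
  rw [Finset.sum_comm]
  refine Finset.sum_congr rfl fun q _ => Finset.sum_congr rfl fun r _ => ?_
  rw [tg, TT_swap23, ← tg]; ring

noncomputable def hb3 (f : ℕ → ℕ → ℕ → ℝ) (a1 b1 a2 b2 a3 b3 : ℝ) : ℝ :=
  hb 16 (fun k => hb 16 (fun j => hb 16 (fun i => f i j k) a1 b1) a2 b2) a3 b3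
theorem hb3_ce_grid (i j k : ℕ) (hi : i < 17) (hj : j < 17) (hk : k < 17) :
    hb3 ce (16 - (i : ℝ)) i (16 - (j : ℝ)) j (16 - (k : ℝ)) k = dl ^ 3 * tg i j k := by
  unfold hb3 ce
  simp only [Ei_inv _ i hi, hb_cmul, Ei_inv _ j hj, Ei_inv _ k hk]
  ring
theorem hb3_ce (x y z : ℝ) : hb3 ce (8 - x) (8 + x) (8 - y) (8 + y) (8 - z) (8 + z) = dl ^ 3 * TT x y z := by
  have hm : PD 1 (fun t : ℝ => 8 - t) := (PD.const 1 8).sub (PD.id le_rfl)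
  have hp : PD 1 (fun t : ℝ => 8 + t) := (PD.const 1 8).add (PD.id le_rfl)
  have e1 : ∀ i : ℕ, (8 : ℝ) - ((i : ℝ) - 8) = 16 - i := fun i => by ring
  have e2 : ∀ i : ℕ, (8 : ℝ) + ((i : ℝ) - 8) = i := fun i => by ring
  have s1 : ∀ j : ℕ, j < 17 → ∀ k : ℕ, k < 17 → ∀ x : ℝ, hb3 ce (8 - x) (8 + x) (16 - (j : ℝ)) j (16 - (k : ℝ)) k
      = dl ^ 3 * TT x ((j : ℝ) - 8) ((k : ℝ) - 8) := by
    intro j hj k hk x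
    refine PD.ext (n := 16) (f := fun x => hb3 ce (8 - x) (8 + x) (16 - (j : ℝ)) j (16 - (k : ℝ)) k)
      (h := fun x => dl ^ 3 * TT x ((j : ℝ) - 8) ((k : ℝ) - 8)) ?_ ((PD_TT _ _).cmul _) 8 ?_ x
    · exact PD_hb2 _ _ _ _ _ fun k => PD_hb2 _ _ _ _ _ fun j => PD_hb _ _ _ _ hm hp
    · intro i hi
      simp only [e1, e2]
      exact hb3_ce_grid i j k hi hj hk
  have s2 : ∀ k : ℕ, k < 17 → ∀ x y : ℝ, hb3 ce (8 - x) (8 + x) (8 - y) (8 + y) (16 - (k : ℝ)) k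
      = dl ^ 3 * TT x y ((k : ℝ) - 8) := by
    intro k hk x y
    refine PD.ext (n := 16) (f := fun y => hb3 ce (8 - x) (8 + x) (8 - y) (8 + y) (16 - (k : ℝ)) k)
      (h := fun y => dl ^ 3 * TT x y ((k : ℝ) - 8)) ?_ ?_ 8 ?_ y
    · exact PD_hb2 _ _ _ _ _ fun k => PD_hb _ _ _ _ hm hp
    · simp only [TT_swap12 x]; exact (PD_TT _ _).cmul _
    · intro j hj
      simp only [e1, e2]
      exact s1 j hj k hk x
  refine PD.ext (n := 16) (f := fun z => hb3 ce (8 - x) (8 + x) (8 - y) (8 + y) (8 - z) (8 + z))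
      (h := fun z => dl ^ 3 * TT x y z) ?_ ?_ 8 ?_ z
  · exact PD_hb _ _ _ _ hm hp
  · have e : (fun z => dl ^ 3 * TT x y z) = fun z => dl ^ 3 * TT z x y := by
      funext z; rw [TT_swap23, TT_swap12]
    rw [e]; exact (PD_TT _ _).cmul _
  · intro k hk
    simp only [e1, e2]
    exact s2 k hk x y

/-! ### the check of the coefficients -/
noncomputable def yf (i j k : ℕ) : ℕ := lk 0 ytab i j k
theorem lk_map {α : Type} (d : α) (f : ℕ → ℕ → ℕ → α) (i j k : ℕ) (hi : i < 17) (hj : j < 17) (hk : k < 17) :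
    lk d ((List.range 17).map fun i => (List.range 17).map fun j => (List.range 17).map fun k => f i j k) i j k
      = f i j k := by
  unfold lk
  rw [nth_map _ _ _ _ hi, nth_map _ _ _ _ hj, nth_map _ _ _ _ hk]
def MP (f : ℕ → ℕ → ℕ → Z) : List (List (List Z)) :=
  (List.range 17).map fun i => (List.range 17).map fun j => (List.range 17).map fun k => f i j k
theorem aTab_eq : ∃ f, aTab cols = MP f ∧ ∀ i j l, i < 17 → j < 17 → l < 17 →
    v (f i j l) = AA cols ((i : ℝ) - 8) ((j : ℝ) - 8) (3 * ((l : ℝ) - 8) - 8) := by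
  unfold aTab
  simp only [mp_eq, rg17_eq]
  refine ⟨_, rfl, ?_⟩
  intro i j l hi hj hl
  simp only [nth_map _ _ _ _ hi, nth_map _ _ _ _ hj]
  rw [v_aZ] <;> simp
theorem tTab_eq : ∃ f, tTab (aTab cols) = MP f ∧ ∀ i j l, i < 17 → j < 17 → l < 17 →
    v (f i j l) = tg i j l := by
  obtain ⟨f, hf, hv⟩ := aTab_eq
  rw [hf]
  unfold tTab
  simp only [mp_eq, rg17_eq]
  refine ⟨_, rfl, ?_⟩
  intro i j l hi hj hl
  unfold MP
  rw [lk_map _ _ _ _ _ hi hj hl, lk_map _ _ _ _ _ hi hl hj, lk_map _ _ _ _ _ hj hl hi, v_addZ, v_addZ,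
    hv i j l hi hj hl, hv i l j hi hl hj, hv j l i hj hl hi]
  rfl
theorem app_eq0 (r : ℕ → ℕ → Z) (f : ℕ → ℕ → ℕ → Z) :
    app ((List.range 17).map fun a => (List.range 17).map (r a)) (MP f) = MP fun a i j =>
      dotZ ((List.range 17).map (r a)) ((List.range 17).map (f i j)) := by
  unfold app MP
  simp only [mp_eq, List.map_map, Function.comp_def]
theorem app_eq (f : ℕ → ℕ → ℕ → Z) : ∃ h, app (mp (mp ofZ) einv) (MP f) = MP h ∧
    ∀ a i j, v (h a i j) = ∑ k ∈ range 17, Ei a k * v (f i j k) := by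
  rw [einv_shape, app_eq0]
  exact ⟨_, rfl, fun a i j => v_dotZ 17 _ _⟩
theorem app3_eq : ∃ h, app3 (mp (mp ofZ) einv) (tTab (aTab cols)) = MP h ∧ ∀ i j k, v (h i j k) = ce i j k := by
  obtain ⟨f, hf, hv⟩ := tTab_eq
  obtain ⟨h1, e1, f1⟩ := app_eq f
  obtain ⟨h2, e2, f2⟩ := app_eq h1
  obtain ⟨h3, e3, f3⟩ := app_eq h2
  refine ⟨h3, ?_, ?_⟩
  · unfold app3; rw [hf, e1, e2, e3]
  · intro i j k
    rw [f3, ce]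
    refine Finset.sum_congr rfl fun p hp => ?_
    rw [f2]; congr 1
    refine Finset.sum_congr rfl fun q hq => ?_
    rw [f1]; congr 1
    refine Finset.sum_congr rfl fun r hr => ?_
    rw [hv p q r (Finset.mem_range.1 hp) (Finset.mem_range.1 hq) (Finset.mem_range.1 hr)]
theorem y_bound0 (t0 : ok0 cols einv 371 61 ytab = true) (i j k : ℕ) (hi : i ≤ j) (hj : j ≤ k) (hk : k < 17) :
    ∀ n ∈ [yf i j k, yf i k j, yf j i k, yf j k i, yf k i j, yf k j i],
    ce i j k + (n : ℝ) * 2 ^ 371 ≤ 2 ^ 432 := by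
  obtain ⟨h, eh, hv⟩ := app3_eq
  unfold ok0 cmp at t0
  rw [eh] at t0
  have hm : ∀ i, i < 17 → i ∈ rg17 := fun i hi => by rw [rg17_eq]; simpa using hi
  have t1 := (allB_iff _ _).1 t0 i (hm i (by omega))
  have t2 := (allB_iff _ _).1 t1 j (hm j (by omega))
  rw [Nat.ble_eq_true_of_le hi] at t2
  have t3 := (allB_iff _ _).1 t2 k (hm k (by omega))
  rw [Nat.ble_eq_true_of_le hj] at t3
  have t4 := (allB_iff _ _).1 t3
  intro n hn
  have t5 := leZ_iff _ _ (t4 n hn)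
  unfold MP at t5
  rw [lk_map _ _ _ _ _ (by omega) (by omega) hk, v_addZ, hv] at t5
  exact le_of_eq_of_le (by simp; norm_num) (le_of_le_of_eq t5 (by simp; norm_num))
theorem y_bound (t0 : ok0 cols einv 371 61 ytab = true) (i j k : ℕ) (hi : i < 17) (hj : j < 17) (hk : k < 17) :
    ce i j k + (yf i j k : ℝ) * 2 ^ 371 ≤ 2 ^ 432 := by
  rcases le_total i j with h1 | h1 <;> rcases le_total j k with h2 | h2 <;> rcases le_total i k with h3 | h3
  · exact y_bound0 t0 i j k h1 h2 hk _ (by simp)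
  · exact y_bound0 t0 i j k h1 h2 hk _ (by simp)
  · rw [ce_swap23]; exact y_bound0 t0 i k j h3 h2 hj _ (by simp)
  · rw [ce_swap23, ce_swap12]; exact y_bound0 t0 k i j h3 h1 hj _ (by simp)
  · rw [ce_swap12]; exact y_bound0 t0 j i k h1 h3 hk _ (by simp)
  · rw [ce_swap12, ce_swap23]; exact y_bound0 t0 j k i h2 h3 hi _ (by simp)
  · rw [ce_swap23, ce_swap12, ce_swap23]; exact y_bound0 t0 k j i h2 h1 hi _ (by simp)
  · rw [ce_swap23, ce_swap12, ce_swap23]; exact y_bound0 t0 k j i h2 h1 hi _ (by simp)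
end Kiss

namespace Kiss
open Finset

/-! ### de Casteljau subdivision -/
def Lf (f : ℕ → ℕ) : ℕ → ℕ
  | 0 => f 0
  | i + 1 => Lf (fun j => f j + f (j + 1)) i
def LF (n : ℕ) (f : ℕ → ℕ) (i : ℕ) : ℕ := Lf f i * 2 ^ (n - i)
def RF (n : ℕ) (f : ℕ → ℕ) (i : ℕ) : ℕ := LF n (fun j => f (n - j)) (n - i)
theorem map_range_succ {α : Type} (f : ℕ → α) (n : ℕ) :
    (List.range (n + 1)).map f = f 0 :: (List.range n).map (fun i => f (i + 1)) := by
  rw [List.range_succ_eq_map]; simp [Function.comp_def]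
theorem adj_map (n : ℕ) (f : ℕ → ℕ) :
    adj ((List.range n).map fun i => f (i + 1)) (f 0) = (List.range n).map fun i => f i + f (i + 1) := by
  induction n generalizing f with
  | zero => rfl
  | succ n ih =>
    rw [map_range_succ, map_range_succ]
    change (f 0 + f 1) :: adj ((List.range n).map fun i => f (i + 1 + 1)) (f 1) = _
    rw [ih (fun i => f (i + 1))]
theorem lft_map (n : ℕ) (f : ℕ → ℕ) : lft (n + 1) ((List.range (n + 1)).map f) = (List.range (n + 1)).map (LF n f) := by
  induction n generalizing f with
  | zero => simp [lft, LF, Lf]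
  | succ n ih =>
    rw [map_range_succ f, map_range_succ (LF (n + 1) f)]
    change f 0 * 2 ^ (n + 1) :: lft (n + 1) (adj ((List.range (n + 1)).map fun i => f (i + 1)) (f 0)) = _
    rw [adj_map, ih]
    congr 1
    apply List.map_congr_left
    intro i _
    simp [LF, Lf]
theorem revA_eq (l a : List ℕ) : revA l a = l.reverse ++ a := by
  induction l generalizing a with
  | nil => rfl
  | cons h t ih =>
    change revA t (h :: a) = _
    rw [ih]; simp
theorem rev_map (n : ℕ) (f : ℕ → ℕ) :
    ((List.range (n + 1)).map f).reverse = (List.range (n + 1)).map fun i => f (n - i) := by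
  apply List.ext_getElem
  · simp
  · intro i h1 h2
    simp
theorem rgt_map (n : ℕ) (f : ℕ → ℕ) : rgt (n + 1) ((List.range (n + 1)).map f) = (List.range (n + 1)).map (RF n f) := by
  unfold rgt
  rw [revA_eq, revA_eq, List.append_nil, List.append_nil, rev_map, lft_map, rev_map]
  rfl
theorem Lf_sum {ι : Type} (s : Finset ι) (c : ι → ℕ) (f : ι → ℕ → ℕ) (i : ℕ) :
    Lf (fun j => ∑ t ∈ s, f t j * c t) i = ∑ t ∈ s, Lf (f t) i * c t := by
  induction i generalizing f with
  | zero => rfl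
  | succ i ih =>
    simp only [Lf]
    rw [← ih]
    congr 1
    funext j
    rw [← Finset.sum_add_distrib]
    exact Finset.sum_congr rfl fun t _ => by ring
theorem LF_sum {ι : Type} (s : Finset ι) (c : ι → ℕ) (n : ℕ) (f : ι → ℕ → ℕ) (i : ℕ) :
    LF n (fun j => ∑ t ∈ s, f t j * c t) i = ∑ t ∈ s, LF n (f t) i * c t := by
  unfold LF
  rw [Lf_sum, Finset.sum_mul]
  exact Finset.sum_congr rfl fun t _ => by ring
theorem RF_sum {ι : Type} (s : Finset ι) (c : ι → ℕ) (n : ℕ) (f : ι → ℕ → ℕ) (i : ℕ) :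
    RF n (fun j => ∑ t ∈ s, f t j * c t) i = ∑ t ∈ s, RF n (f t) i * c t := LF_sum _ _ _ _ _
theorem Lf_le (f : ℕ → ℕ) (B i : ℕ) (h : ∀ j ≤ i, f j ≤ B) : Lf f i ≤ 2 ^ i * B := by
  induction i generalizing f B with
  | zero => simpa [Lf] using h 0 le_rfl
  | succ i ih =>
    refine (ih _ (2 * B) fun j hj => ?_).trans (by rw [pow_succ]; ring_nf; rfl)
    have := h j (by omega)
    have := h (j + 1) (by omega)
    omega
theorem LF_lt (n : ℕ) (f : ℕ → ℕ) (e i : ℕ) (h : ∀ j ≤ n, f j < 2 ^ e) (hi : i ≤ n) : LF n f i < 2 ^ (e + n) := by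
  have h1 := Lf_le f (2 ^ e - 1) i fun j hj => by have := h j (by omega); omega
  have h2 : LF n f i ≤ 2 ^ n * (2 ^ e - 1) := by
    unfold LF
    calc _ ≤ 2 ^ i * (2 ^ e - 1) * 2 ^ (n - i) := Nat.mul_le_mul_right _ h1
      _ = 2 ^ (i + (n - i)) * (2 ^ e - 1) := by rw [pow_add]; ring
      _ = _ := by congr 2; omega
  refine h2.trans_lt ?_
  rw [pow_add, mul_comm]
  exact Nat.mul_lt_mul_of_pos_right (by have := Nat.two_pow_pos e; omega) (Nat.two_pow_pos n)
theorem RF_lt (n : ℕ) (f : ℕ → ℕ) (e i : ℕ) (h : ∀ j ≤ n, f j < 2 ^ e) (_hi : i ≤ n) : RF n f i < 2 ^ (e + n) :=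
  LF_lt n _ e _ (fun j _ => h _ (by omega)) (by omega)
theorem hb_succ (d : ℕ) (f : ℕ → ℝ) (a b : ℝ) :
    hb (d + 1) f a b = a * hb d f a b + b * hb d (fun i => f (i + 1)) a b := by
  have e1 : hb d f a b = ∑ i ∈ range (d + 2), (d.choose i : ℝ) * (a ^ (d - i) * b ^ i) * f i := by
    rw [Finset.sum_range_succ, Nat.choose_succ_self]; simp [hb]
  rw [e1]
  simp only [hb]
  rw [Finset.sum_range_succ', Finset.sum_range_succ' _ (d + 1), mul_add, Finset.mul_sum, Finset.mul_sum,
    add_right_comm, ← Finset.sum_add_distrib]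
  congr 1
  · refine Finset.sum_congr rfl fun i hi => ?_
    rw [Nat.choose_succ_succ]
    have : i < d + 1 := Finset.mem_range.1 hi
    rcases Nat.lt_or_ge i d with h | h
    · have e : d - i = (d - (i + 1)) + 1 := by omega
      have e' : d + 1 - (i + 1) = (d - (i + 1)) + 1 := by omega
      rw [e, e', pow_succ b]; push_cast; ring
    · have e : i = d := by omega
      subst e
      simp; ring
  · simp; ring
theorem hb_Lf (d : ℕ) (f : ℕ → ℕ) (a b : ℝ) :
    hb d (fun i => (Lf f i : ℝ)) a b = hb d (fun i => (f i : ℝ)) (a + b) b := by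
  induction d generalizing f with
  | zero => simp [hb, Lf]
  | succ d ih =>
    rw [hb_succ, hb_succ, ih]
    simp only [Lf]
    rw [ih]
    push_cast
    rw [hb_add]; ring
theorem hb_LF (d : ℕ) (f : ℕ → ℕ) (a b : ℝ) :
    hb d (fun i => (LF d f i : ℝ)) a b = hb d (fun i => (f i : ℝ)) (2 * a + b) b := by
  rw [← hb_Lf]
  refine Finset.sum_congr rfl fun i _ => ?_
  simp only [LF]; push_cast; rw [mul_pow]; ring
theorem hb_rev (d : ℕ) (f : ℕ → ℝ) (a b : ℝ) : hb d (fun i => f (d - i)) a b = hb d f b a := by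
  unfold hb
  rw [← Finset.sum_range_reflect]
  refine Finset.sum_congr rfl fun i hi => ?_
  have : i < d + 1 := Finset.mem_range.1 hi
  have e1 : d + 1 - 1 - i = d - i := by omega
  have e2 : d - (d - i) = i := by omega
  simp only [e1, e2]
  rw [Nat.choose_symm (by omega)]; ring
theorem hb_RF (d : ℕ) (f : ℕ → ℕ) (a b : ℝ) :
    hb d (fun i => (RF d f i : ℝ)) a b = hb d (fun i => (f i : ℝ)) a (2 * b + a) := by
  unfold RF
  rw [hb_rev d (fun i => (LF d (fun j => f (d - j)) i : ℝ)), hb_LF, hb_rev d (fun i => (f i : ℝ))]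
/-- in local coordinates -/
theorem hb_LF' (d : ℕ) (f : ℕ → ℕ) (n q z : ℝ) :
    hb d (fun i => (LF d f i : ℝ)) (2 * n + 1 - 2 * q * z) (2 * q * z - 2 * n) =
      2 ^ d * hb d (fun i => (f i : ℝ)) (n + 1 - q * z) (q * z - n) := by
  rw [hb_LF, ← hb_smul]; congr 1 <;> ring
theorem hb_RF' (d : ℕ) (f : ℕ → ℕ) (n q z : ℝ) :
    hb d (fun i => (RF d f i : ℝ)) (2 * n + 1 + 1 - 2 * q * z) (2 * q * z - (2 * n + 1)) =
      2 ^ d * hb d (fun i => (f i : ℝ)) (n + 1 - q * z) (q * z - n) := by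
  rw [hb_RF, ← hb_smul]; congr 1 <;> ring

/-! ### univariate verifier -/
theorem run1_sound (t : Tr) (e : ℕ) (f : ℕ → ℕ) (n q z : ℝ) (h : run1 t e ((List.range 33).map f) = true)
    (h1 : n ≤ q * z) (h2 : q * z ≤ n + 1) : 2 ^ e ≤ hb 32 (fun i => (f i : ℝ)) (n + 1 - q * z) (q * z - n) := by
  induction t generalizing e f n q with
  | L =>
    have h' := (allB_iff (fun h => Nat.ble (Nat.pow 2 e) h) ((List.range 33).map f)).1 h
    have h3 := hb_mono 32 (fun _ => (2 : ℝ) ^ e) (fun i => (f i : ℝ)) (n + 1 - q * z) (q * z - n)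
      (by linarith) (by linarith) (fun i hi => by
        have := Nat.le_of_ble_eq_true (h' (f i) (List.mem_map.2 ⟨i, List.mem_range.2 (by omega), rfl⟩))
        exact_mod_cast this)
    rw [hb_const] at h3
    refine le_trans (le_of_eq ?_) h3
    ring
  | O => exact absurd h Bool.false_ne_true
  | X t _ => exact absurd h Bool.false_ne_true
  | S l r ihl ihr =>
    have hh : (Bool.rec false (run1 r (e + 32) (rgt 33 ((List.range 33).map f)))
      (run1 l (e + 32) (lft 33 ((List.range 33).map f))) : Bool) = true := h
    rw [lft_map, rgt_map] at hh
    cases hl : run1 l (e + 32) ((List.range 33).map (LF 32 f)) with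
    | false => rw [hl] at hh; exact absurd hh Bool.false_ne_true
    | true =>
      rw [hl] at hh
      have hr : run1 r (e + 32) ((List.range 33).map (RF 32 f)) = true := hh
      have c : (2 : ℝ) ^ (e + 32) = 2 ^ 32 * 2 ^ e := by rw [pow_add]; ring
      rcases le_total (2 * q * z) (2 * n + 1) with h3 | h3
      · have := ihl (e + 32) (LF 32 f) (2 * n) (2 * q) hl (by linarith) h3
        rw [hb_LF', c] at this
        exact le_of_mul_le_mul_left this (by positivity)
      · have := ihr (e + 32) (RF 32 f) (2 * n + 1) (2 * q) hr h3 (by linarith)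
        rw [hb_RF', c] at this
        exact le_of_mul_le_mul_left this (by positivity)
end Kiss

namespace Kiss
open Finset

/-! ### packing -/
theorem pk_cons (s h : ℕ) (t : List ℕ) : pk s (h :: t) = 2 ^ s * pk s t + h := by
  change h + (pk s t) <<< s = _
  rw [Nat.shiftLeft_eq]; ring
theorem pk_sum (s n : ℕ) (f : ℕ → ℕ) : pk s ((List.range n).map f) = ∑ i ∈ range n, f i * 2 ^ (s * i) := by
  induction n generalizing f with
  | zero => rfl
  | succ n ih =>
    rw [map_range_succ, pk_cons, ih, Finset.sum_range_succ', Finset.mul_sum]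
    congr 1
    · exact Finset.sum_congr rfl fun i _ => by rw [Nat.mul_succ, pow_add]; ring
    · simp
theorem pk_lt (s n : ℕ) (f : ℕ → ℕ) (h : ∀ i < n, f i < 2 ^ s) : pk s ((List.range n).map f) < 2 ^ (s * n) := by
  induction n generalizing f with
  | zero => simp [pk]
  | succ n ih =>
    rw [map_range_succ, pk_cons, Nat.mul_succ, pow_add]
    have h1 := ih (fun i => f (i + 1)) fun i hi => h _ (by omega)
    have h2 := h 0 (by omega)
    have h3 : 2 ^ s * (pk s ((List.range n).map fun i => f (i + 1)) + 1) ≤ 2 ^ s * 2 ^ (s * n) :=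
      Nat.mul_le_mul_left _ h1
    rw [mul_add, mul_one] at h3
    rw [mul_comm (2 ^ (s * n))]
    omega
theorem pk_testBit (s n : ℕ) (f : ℕ → ℕ) (h : ∀ i < n, f i < 2 ^ s) (j r : ℕ) (hj : j < n) (hr : r < s) :
    (pk s ((List.range n).map f)).testBit (s * j + r) = (f j).testBit r := by
  induction n generalizing f j with
  | zero => omega
  | succ n ih =>
    rw [map_range_succ, pk_cons, Nat.testBit_two_pow_mul_add _ (h 0 (by omega))]
    cases j with
    | zero => simp [hr]
    | succ j =>
      rw [if_neg (by rw [Nat.mul_succ]; omega), ← ih (fun i => f (i + 1)) (fun i hi => h _ (by omega)) j (by omega)]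
      congr 1
      rw [Nat.mul_succ]; omega
theorem chunk_pk (s n : ℕ) (f : ℕ → ℕ) (h : ∀ i < n, f i < 2 ^ s) (j : ℕ) (hj : j < n) :
    chunk s (pk s ((List.range n).map f)) j = f j := by
  apply Nat.eq_of_testBit_eq
  intro r
  change ((pk s ((List.range n).map f) >>> (s * j)) % 2 ^ s).testBit r = _
  rw [Nat.testBit_mod_two_pow, Nat.testBit_shiftRight]
  rcases Nat.lt_or_ge r s with hr | hr
  · rw [pk_testBit s n f h j r hj hr]; simp [hr]
  · rw [Nat.testBit_lt_two_pow ((h j hj).trans_le (Nat.pow_le_pow_right (by norm_num) hr))]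
    simp [hr]
theorem swp_map (s : ℕ) (f : ℕ → ℕ → ℕ) (h : ∀ i < 17, ∀ j < 17, f i j < 2 ^ s) :
    swp s ((List.range 17).map fun i => pk s ((List.range 17).map (f i))) =
      (List.range 17).map fun j => pk s ((List.range 17).map fun i => f i j) := by
  unfold swp
  rw [rg17_eq, mp_eq]
  apply List.map_congr_left
  intro j hj
  rw [mp_eq, List.map_map]
  congr 1
  apply List.map_congr_left
  intro i hi
  exact chunk_pk s 17 (f i) (h i (List.mem_range.1 hi)) j (List.mem_range.1 hj)

/-! ### the packed state -/
def P2 (W : ℕ) (f : ℕ → ℕ → ℕ) : ℕ :=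
  pk (W * 17) ((List.range 17).map fun j => pk W ((List.range 17).map (f j)))
def ST (W : ℕ) (f : ℕ → ℕ → ℕ → ℕ) : List ℕ := (List.range 17).map fun i => P2 W (f i)
theorem P2_sum (W : ℕ) (f : ℕ → ℕ → ℕ) : P2 W f =
    ∑ t ∈ range 17 ×ˢ range 17, f t.1 t.2 * (2 ^ (W * t.2) * 2 ^ (W * 17 * t.1)) := by
  rw [P2, pk_sum, Finset.sum_product]
  refine Finset.sum_congr rfl fun i _ => ?_
  rw [pk_sum, Finset.sum_mul]
  exact Finset.sum_congr rfl fun j _ => by ring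
theorem lft_ST (W : ℕ) (f : ℕ → ℕ → ℕ → ℕ) :
    lft 17 (ST W f) = ST W fun i j k => LF 16 (fun i => f i j k) i := by
  unfold ST
  rw [lft_map]
  apply List.map_congr_left
  intro i _
  simp only [P2_sum]
  exact LF_sum _ (fun t : ℕ × ℕ => 2 ^ (W * t.2) * 2 ^ (W * 17 * t.1)) 16 (fun t i => f i t.1 t.2) i
theorem rgt_ST (W : ℕ) (f : ℕ → ℕ → ℕ → ℕ) :
    rgt 17 (ST W f) = ST W fun i j k => RF 16 (fun i => f i j k) i := by
  unfold ST
  rw [rgt_map]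
  apply List.map_congr_left
  intro i _
  simp only [P2_sum]
  exact RF_sum _ (fun t : ℕ × ℕ => 2 ^ (W * t.2) * 2 ^ (W * 17 * t.1)) 16 (fun t i => f i t.1 t.2) i
def Bd (f : ℕ → ℕ → ℕ → ℕ) (e : ℕ) : Prop := ∀ i < 17, ∀ j < 17, ∀ k < 17, f i j k < 2 ^ e
theorem swp_ST (W : ℕ) (f : ℕ → ℕ → ℕ → ℕ) (h : Bd f W) :
    swp (Nat.mul W 17) (ST W f) = ST W fun i j k => f j i k :=
  swp_map (W * 17) (fun i j => pk W ((List.range 17).map (f i j))) fun i hi j hj => pk_lt _ _ _ (h i hi j hj)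
theorem swI_P2 (W : ℕ) (f : ℕ → ℕ → ℕ) (h : ∀ i < 17, ∀ j < 17, f i j < 2 ^ W) :
    swI W (P2 W f) = P2 W fun i j => f j i := by
  unfold swI P2
  rw [rg17_eq, mp_eq]
  have : (List.range 17).map (chunk (Nat.mul W 17) (pk (W * 17) ((List.range 17).map fun j => pk W ((List.range 17).map (f j)))))
      = (List.range 17).map fun j => pk W ((List.range 17).map (f j)) := by
    apply List.map_congr_left
    intro j hj
    exact chunk_pk (W * 17) 17 (fun j => pk W ((List.range 17).map (f j))) (fun i hi => pk_lt _ _ _ (h i hi)) j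
      (List.mem_range.1 hj)
  rw [this, swp_map W f h]
  rfl
theorem swI_ST (W : ℕ) (f : ℕ → ℕ → ℕ → ℕ) (h : Bd f W) :
    mp (swI W) (ST W f) = ST W fun i j k => f i k j := by
  unfold ST
  rw [mp_eq, List.map_map]
  apply List.map_congr_left
  intro i hi
  exact swI_P2 W (f i) (h i (List.mem_range.1 hi))
theorem P2_testBit (W : ℕ) (f : ℕ → ℕ → ℕ) (h : ∀ i < 17, ∀ j < 17, f i j < 2 ^ W) (j k r : ℕ) (hj : j < 17)
    (hk : k < 17) (hr : r < W) : (P2 W f).testBit (W * 17 * j + (W * k + r)) = (f j k).testBit r := by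
  unfold P2
  rw [pk_testBit (W * 17) 17 (fun j => pk W ((List.range 17).map (f j))) (fun i hi => pk_lt _ _ _ (h i hi)) j _ hj]
  · exact pk_testBit W 17 (f j) (h j hj) k r hk hr
  · nlinarith
theorem chk_ST (W e : ℕ) (f : ℕ → ℕ → ℕ → ℕ) (h : Bd f W) (he : e < W)
    (hc : chk (Nat.shiftLeft (pk (Nat.mul W 17) (mp (fun _ => pk W (mp (fun _ => 1) rg17)) rg17)) e) (ST W f) = true)
    (i j k : ℕ) (hi : i < 17) (hj : j < 17) (hk : k < 17) : 2 ^ e ≤ f i j k := by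
  have h1 := (allB_iff _ _).1 hc (P2 W (f i)) (List.mem_map.2 ⟨i, List.mem_range.2 hi, rfl⟩)
  have h2 := Nat.eq_of_beq_eq_true h1
  have h3 : pk (Nat.mul W 17) (mp (fun _ => pk W (mp (fun _ => 1) rg17)) rg17) = P2 W fun _ _ => 1 := by
    rw [rg17_eq, mp_eq, mp_eq]; rfl
  rw [h3] at h2
  have h4 : (P2 W (f i) &&& ((P2 W fun _ _ => 1) <<< e)).testBit (W * 17 * j + (W * k + e)) =
    ((P2 W fun _ _ => 1) <<< e).testBit (W * 17 * j + (W * k + e)) := congrArg (fun n : ℕ => n.testBit (W * 17 * j + (W * k + e))) h2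
  have h5 : ((P2 W fun _ _ => 1) <<< e).testBit (W * 17 * j + (W * k + e)) = true := by
    rw [Nat.testBit_shiftLeft]
    have e1 : W * 17 * j + (W * k + e) - e = W * 17 * j + (W * k + 0) := by omega
    rw [e1, P2_testBit W (fun _ _ => 1) (fun _ _ _ _ => Nat.one_lt_two_pow (by omega)) j k 0 hj hk (by omega)]
    simp
    omega
  rw [Nat.testBit_land, h5, P2_testBit W (f i) (h i hi) j k e hj hk he, Bool.and_true] at h4
  exact Nat.ge_two_pow_of_testBit h4
end Kiss

namespace Kiss
open Finset

/-! ### boxes -/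
def InB (n q : ℕ) (z : ℝ) : Prop := n < q ∧ (n : ℝ) ≤ q * z ∧ q * z ≤ n + 1 ∧ (q * z < n + 1 ∨ n + 1 = q)
theorem InB_split {n q : ℕ} {z : ℝ} (h : InB n q z) : InB (2 * n) (2 * q) z ∨ InB (2 * n + 1) (2 * q) z := by
  obtain ⟨h0, h1, h2, h3⟩ := h
  rcases lt_or_ge (2 * (q * z)) (2 * n + 1) with h | h
  · left
    refine ⟨by omega, ?_, ?_, Or.inl ?_⟩ <;> push_cast <;> linarith
  · right
    refine ⟨by omega, ?_, ?_, ?_⟩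
    · push_cast; linarith
    · push_cast; linarith
    · rcases h3 with h3 | h3
      · left; push_cast; linarith
      · right; omega
theorem InB_geB {n1 q1 n2 q2 : ℕ} {z1 z2 : ℝ} (h1 : InB n1 q1 z1) (h2 : InB n2 q2 z2) (hg : geB n1 q1 n2 q2 = true) :
    z2 < z1 := by
  have hg : (n2 + 1) * q1 ≤ n1 * q2 := Nat.le_of_ble_eq_true hg
  obtain ⟨a0, a1, a2, a3⟩ := h1
  obtain ⟨b0, b1, b2, b3⟩ := h2
  rcases b3 with b3 | b3
  · have hg' : ((n2 : ℝ) + 1) * q1 ≤ n1 * q2 := by exact_mod_cast hg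
    have p1 : (0 : ℝ) < q1 := by exact_mod_cast (by omega : 0 < q1)
    have p2 : (0 : ℝ) < q2 := by exact_mod_cast (by omega : 0 < q2)
    have c1 : (q2 * z2) * q1 < (n2 + 1) * q1 := mul_lt_mul_of_pos_right b3 p1
    have c2 : n1 * q2 ≤ (q1 * z1) * q2 := mul_le_mul_of_nonneg_right a1 p2.le
    have c3 : (q1 * q2 : ℝ) * z2 < (q1 * q2) * z1 := by linarith
    exact lt_of_mul_lt_mul_left c3 (by positivity)
  · rw [b3, mul_comm] at hg
    have := Nat.le_of_mul_le_mul_right hg (by omega)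
    omega
theorem aff (p q a b x : ℝ) (h1 : a ≤ x) (h2 : x ≤ b) (ha : p + q * a ≤ 0) (hb' : p + q * b ≤ 0) : p + q * x ≤ 0 := by
  rcases le_total q 0 with h | h
  · nlinarith
  · nlinarith
theorem corners (c D k1 k2 k3 a1 b1 a2 b2 a3 b3 x y z : ℝ) (hx : a1 ≤ x) (hx' : x ≤ b1) (hy : a2 ≤ y) (hy' : y ≤ b2)
    (hz : a3 ≤ z) (hz' : z ≤ b3)
    (h : ∀ p ∈ [a1, b1], ∀ q ∈ [a2, b2], ∀ r ∈ [a3, b3], c + D * (p * (q * r)) ≤ k1 * p + (k2 * q + k3 * r)) :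
    c + D * (x * (y * z)) ≤ k1 * x + (k2 * y + k3 * z) := by
  have s1 : ∀ q ∈ [a2, b2], ∀ r ∈ [a3, b3], c + D * (x * (q * r)) ≤ k1 * x + (k2 * q + k3 * r) := by
    intro q hq r hr
    have := aff (c - k2 * q - k3 * r) (D * (q * r) - k1) a1 b1 x hx hx' (by linarith [h a1 (by simp) q hq r hr])
      (by linarith [h b1 (by simp) q hq r hr])
    linarith
  have s2 : ∀ r ∈ [a3, b3], c + D * (x * (y * r)) ≤ k1 * x + (k2 * y + k3 * r) := by
    intro r hr
    have := aff (c - k1 * x - k3 * r) (D * (x * r) - k2) a2 b2 y hy hy' (by linarith [s1 a2 (by simp) r hr])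
      (by linarith [s1 b2 (by simp) r hr])
    linarith
  have := aff (c - k1 * x - k2 * y) (D * (x * y) - k3) a3 b3 z hz hz' (by linarith [s2 a3 (by simp)])
      (by linarith [s2 b3 (by simp)])
  linarith
/-- the determinant condition, in terms of `u = 3z/2-1` -/
def dt (u v t : ℝ) : ℝ := 1 + 2 * u * v * t - u ^ 2 - v ^ 2 - t ^ 2
theorem detB_sound {n1 q1 n2 q2 n3 q3 : ℕ} {z1 z2 z3 : ℝ} (h1 : InB n1 q1 z1) (h2 : InB n2 q2 z2) (h3 : InB n3 q3 z3)
    (h : detB n1 q1 n2 q2 n3 q3 = true) : dt (3 * z1 / 2 - 1) (3 * z2 / 2 - 1) (3 * z3 / 2 - 1) < 0 := by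
  obtain ⟨a0, a1, a2, -⟩ := h1
  obtain ⟨b0, b1, b2, -⟩ := h2
  obtain ⟨c0, c1, c2, -⟩ := h3
  have p1 : (0 : ℝ) < q1 := by exact_mod_cast (by omega : 0 < q1)
  have p2 : (0 : ℝ) < q2 := by exact_mod_cast (by omega : 0 < q2)
  have p3 : (0 : ℝ) < q3 := by exact_mod_cast (by omega : 0 < q3)
  unfold detB at h
  simp only [Bool.and_eq_true] at h
  obtain ⟨⟨⟨⟨⟨⟨⟨e1, e2⟩, e3⟩, e4⟩, e5⟩, e6⟩, e7⟩, e8⟩ := h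
  replace e1 := leZ_iff _ _ e1
  replace e2 := leZ_iff _ _ e2
  replace e3 := leZ_iff _ _ e3
  replace e4 := leZ_iff _ _ e4
  replace e5 := leZ_iff _ _ e5
  replace e6 := leZ_iff _ _ e6
  replace e7 := leZ_iff _ _ e7
  replace e8 := leZ_iff _ _ e8
  simp only [v_addZ, v_mulZ, v_sm, v_ps, v_nz] at e1 e2 e3 e4 e5 e6 e7 e8
  push_cast at e1 e2 e3 e4 e5 e6 e7 e8
  set A1 : ℝ := 3 * n1 - 2 * q1 with hA1
  set B1 : ℝ := 3 * n1 + 3 - 2 * q1 with hB1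
  set A2 : ℝ := 3 * n2 - 2 * q2 with hA2
  set B2 : ℝ := 3 * n2 + 3 - 2 * q2 with hB2
  set A3 : ℝ := 3 * n3 - 2 * q3 with hA3
  set B3 : ℝ := 3 * n3 + 3 - 2 * q3 with hB3
  have key := corners _ _ _ _ _ A1 B1 A2 B2 A3 B3 (3 * (q1 * z1) - 2 * q1) (3 * (q2 * z2) - 2 * q2)
    (3 * (q3 * z3) - 2 * q3) (by linarith) (by linarith) (by linarith) (by linarith) (by linarith) (by linarith)
    (h := by
      intro p hp q hq r hr
      simp only [List.mem_cons, List.not_mem_nil, or_false] at hp hq hr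
      rcases hp with rfl | rfl <;> rcases hq with rfl | rfl <;> rcases hr with rfl | rfl
      · exact e1
      · exact e2
      · exact e3
      · exact e4
      · exact e5
      · exact e6
      · exact e7
      · exact e8)
  have t1 := mul_nonneg (sq_nonneg ((q2 : ℝ) * q3)) (sq_nonneg (2 * (3 * (q1 * z1) - 2 * q1) - (A1 + B1)))
  have t2 := mul_nonneg (sq_nonneg ((q1 : ℝ) * q3)) (sq_nonneg (2 * (3 * (q2 * z2) - 2 * q2) - (A2 + B2)))
  have t3 := mul_nonneg (sq_nonneg ((q1 : ℝ) * q2)) (sq_nonneg (2 * (3 * (q3 * z3) - 2 * q3) - (A3 + B3)))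
  have fin : 4 * (8 * q1 * q2 * q3 : ℝ) ^ 2 * dt (3 * z1 / 2 - 1) (3 * z2 / 2 - 1) (3 * z3 / 2 - 1) ≤ -1 := by
    unfold dt
    clear_value A1 A2 A3 B1 B2 B3
    linarith [key, t1, t2, t3]
  by_contra hcon
  push Not at hcon
  have : 0 ≤ 4 * (8 * q1 * q2 * q3 : ℝ) ^ 2 * dt (3 * z1 / 2 - 1) (3 * z2 / 2 - 1) (3 * z3 / 2 - 1) := by positivity
  linarith
def DD (z1 z2 z3 : ℝ) : Prop := z1 ≤ z2 ∧ z2 ≤ z3 ∧ 0 ≤ dt (3 * z1 / 2 - 1) (3 * z2 / 2 - 1) (3 * z3 / 2 - 1)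
theorem outB_sound {n1 q1 n2 q2 n3 q3 : ℕ} {z1 z2 z3 : ℝ} (h1 : InB n1 q1 z1) (h2 : InB n2 q2 z2) (h3 : InB n3 q3 z3)
    (h : outB n1 q1 n2 q2 n3 q3 = true) : ¬ DD z1 z2 z3 := by
  rintro ⟨c1, c2, c3⟩
  unfold outB at h
  simp only [Bool.or_eq_true] at h
  rcases h with h | h | h | h
  · have := InB_geB h1 h2 h; linarith
  · have := InB_geB h2 h3 h; linarith
  · have := InB_geB h1 h3 h; linarith
  · have := detB_sound h1 h2 h3 h; linarith

/-! ### soundness of the trivariate verifier -/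
noncomputable def ev (f : ℕ → ℕ → ℕ → ℕ) (n1 q1 n2 q2 n3 q3 : ℕ) (z1 z2 z3 : ℝ) : ℝ :=
  hb3 (fun i j k => (f i j k : ℝ)) (n1 + 1 - q1 * z1) (q1 * z1 - n1) (n2 + 1 - q2 * z2) (q2 * z2 - n2)
    (n3 + 1 - q3 * z3) (q3 * z3 - n3)
theorem ev_swap12 (f : ℕ → ℕ → ℕ → ℕ) (n1 q1 n2 q2 n3 q3 : ℕ) (z1 z2 z3 : ℝ) :
    ev (fun i j k => f j i k) n2 q2 n1 q1 n3 q3 z2 z1 z3 = ev f n1 q1 n2 q2 n3 q3 z1 z2 z3 := by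
  unfold ev hb3
  congr 1
  funext k
  exact hb_comm _ _ _ _ _ _
theorem ev_swap23 (f : ℕ → ℕ → ℕ → ℕ) (n1 q1 n2 q2 n3 q3 : ℕ) (z1 z2 z3 : ℝ) :
    ev (fun i j k => f i k j) n1 q1 n3 q3 n2 q2 z1 z3 z2 = ev f n1 q1 n2 q2 n3 q3 z1 z2 z3 := by
  unfold ev hb3
  exact hb_comm _ _ _ _ _ _
theorem ev_L (f : ℕ → ℕ → ℕ → ℕ) (n1 q1 n2 q2 n3 q3 : ℕ) (z1 z2 z3 : ℝ) :
    ev (fun i j k => LF 16 (fun i => f i j k) i) (2 * n1) (2 * q1) n2 q2 n3 q3 z1 z2 z3 =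
      2 ^ 16 * ev f n1 q1 n2 q2 n3 q3 z1 z2 z3 := by
  unfold ev hb3
  push_cast
  simp only [hb_LF', hb_cmul]
theorem ev_R (f : ℕ → ℕ → ℕ → ℕ) (n1 q1 n2 q2 n3 q3 : ℕ) (z1 z2 z3 : ℝ) :
    ev (fun i j k => RF 16 (fun i => f i j k) i) (2 * n1 + 1) (2 * q1) n2 q2 n3 q3 z1 z2 z3 =
      2 ^ 16 * ev f n1 q1 n2 q2 n3 q3 z1 z2 z3 := by
  unfold ev hb3
  push_cast
  simp only [hb_RF', hb_cmul]
theorem ev_leaf (f : ℕ → ℕ → ℕ → ℕ) (n1 q1 n2 q2 n3 q3 : ℕ) (z1 z2 z3 : ℝ) (e : ℕ) (h1 : InB n1 q1 z1)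
    (h2 : InB n2 q2 z2) (h3 : InB n3 q3 z3) (h : ∀ i j k, i < 17 → j < 17 → k < 17 → 2 ^ e ≤ f i j k) :
    2 ^ e ≤ ev f n1 q1 n2 q2 n3 q3 z1 z2 z3 := by
  obtain ⟨a0, a1, a2, -⟩ := h1
  obtain ⟨b0, b1, b2, -⟩ := h2
  obtain ⟨c0, c1, c2, -⟩ := h3
  have key : hb3 (fun _ _ _ => (2 : ℝ) ^ e) (n1 + 1 - q1 * z1) (q1 * z1 - n1) (n2 + 1 - q2 * z2) (q2 * z2 - n2)
    (n3 + 1 - q3 * z3) (q3 * z3 - n3) ≤ ev f n1 q1 n2 q2 n3 q3 z1 z2 z3 := by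
    have r1 : 0 ≤ (n1 : ℝ) + 1 - q1 * z1 := by linarith
    have r2 : 0 ≤ (q1 : ℝ) * z1 - n1 := by linarith
    have r3 : 0 ≤ (n2 : ℝ) + 1 - q2 * z2 := by linarith
    have r4 : 0 ≤ (q2 : ℝ) * z2 - n2 := by linarith
    have r5 : 0 ≤ (n3 : ℝ) + 1 - q3 * z3 := by linarith
    have r6 : 0 ≤ (q3 : ℝ) * z3 - n3 := by linarith
    unfold ev hb3
    refine hb_mono _ _ _ _ _ r5 r6 fun k hk => ?_
    refine hb_mono _ _ _ _ _ r3 r4 fun j hj => ?_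
    refine hb_mono _ _ _ _ _ r1 r2 fun i hi => ?_
    have := h i j k (by omega) (by omega) (by omega)
    change (2 : ℝ) ^ e ≤ (f i j k : ℝ)
    exact_mod_cast this
  refine le_trans (le_of_eq ?_) key
  simp only [hb3, hb_const]
  ring
theorem Bd.mono {f : ℕ → ℕ → ℕ → ℕ} {e e' : ℕ} (h : Bd f e) (he : e ≤ e') : Bd f e' := fun i hi j hj k hk =>
  (h i hi j hj k hk).trans_le (Nat.pow_le_pow_right (by norm_num) he)
theorem Bd_L {f : ℕ → ℕ → ℕ → ℕ} {e : ℕ} (h : Bd f e) : Bd (fun i j k => LF 16 (fun i => f i j k) i) (e + 16) :=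
  fun i hi j hj k hk => LF_lt 16 _ e i (fun i' hi' => h i' (by omega) j hj k hk) (by omega)
theorem Bd_R {f : ℕ → ℕ → ℕ → ℕ} {e : ℕ} (h : Bd f e) : Bd (fun i j k => RF 16 (fun i => f i j k) i) (e + 16) :=
  fun i hi j hj k hk => RF_lt 16 _ e i (fun i' hi' => h i' (by omega) j hj k hk) (by omega)
theorem brec {a b : Bool} (h : (Bool.rec false b a : Bool) = true) : a = true ∧ b = true := by
  cases a with
  | false => exact absurd h Bool.false_ne_true
  | true => exact ⟨rfl, h⟩
theorem run_sound (W n3 q3 : ℕ) (z3 : ℝ) (h3 : InB n3 q3 z3) (t : Tr) (o : Bool) (e n1 q1 n2 q2 : ℕ)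
    (f : ℕ → ℕ → ℕ → ℕ) (z1 z2 : ℝ) (he : e < W) (hf : Bd f (e + 1)) (h1 : InB n1 q1 z1) (h2 : InB n2 q2 z2)
    (hD : DD (Bool.rec z2 z1 o) (Bool.rec z1 z2 o) z3)
    (h : run W (pk (Nat.mul W 17) (mp (fun _ => pk W (mp (fun _ => 1) rg17)) rg17)) n3 q3 t o e n1 q1 n2 q2 (ST W f)
      = true) : 2 ^ e ≤ ev f n1 q1 n2 q2 n3 q3 z1 z2 z3 := by
  induction t generalizing o e n1 q1 n2 q2 f z1 z2 with
  | L => exact ev_leaf _ _ _ _ _ _ _ _ _ _ _ h1 h2 h3 fun i j k hi hj hk =>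
      chk_ST W e f (hf.mono he) he h i j k hi hj hk
  | O =>
    exfalso
    cases o with
    | true => exact outB_sound h1 h2 h3 h hD
    | false => exact outB_sound h2 h1 h3 h hD
  | X t ih =>
    rw [← ev_swap12]
    have hh : run W (pk (Nat.mul W 17) (mp (fun _ => pk W (mp (fun _ => 1) rg17)) rg17)) n3 q3 t (Bool.rec true false o) e
      n2 q2 n1 q1 (swp (Nat.mul W 17) (ST W f)) = true := h
    rw [swp_ST W f (hf.mono he)] at hh
    refine ih _ e n2 q2 n1 q1 _ z2 z1 he (fun i hi j hj k hk => hf j hj i hi k hk) h2 h1 ?_ hh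
    cases o <;> exact hD
  | S l r ihl ihr =>
    obtain ⟨hW, hh⟩ := brec h
    obtain ⟨hl, hr⟩ := brec hh
    have hW : e + 17 ≤ W := Nat.le_of_ble_eq_true hW
    rw [lft_ST] at hl
    rw [rgt_ST] at hr
    have c : (2 : ℝ) ^ (e + 16) = 2 ^ 16 * 2 ^ e := by rw [pow_add]; ring
    rcases InB_split h1 with h1 | h1
    · have := ihl o (e + 16) (2 * n1) (2 * q1) n2 q2 _ z1 z2 (by omega) (Bd_L hf) h1 h2 hD hl
      rw [ev_L, c] at this
      exact le_of_mul_le_mul_left this (by positivity)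
    · have := ihr o (e + 16) (2 * n1 + 1) (2 * q1) n2 q2 _ z1 z2 (by omega) (Bd_R hf) h1 h2 hD hr
      rw [ev_R, c] at this
      exact le_of_mul_le_mul_left this (by positivity)
def onP : List Bool → ℕ → ℕ → ℝ → Prop
  | [], n, q, z => InB n q z
  | false :: p, n, q, z => onP p (2 * n) (2 * q) z
  | true :: p, n, q, z => onP p (2 * n + 1) (2 * q) z
theorem slab_sound (W : ℕ) (t : Tr) (p : List Bool) (e n q : ℕ) (f : ℕ → ℕ → ℕ → ℕ) (z1 z2 z3 : ℝ) (he : e < W)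
    (hf : Bd f (e + 1)) (h1 : InB 0 1 z1) (h2 : InB 0 1 z2) (h3 : onP p n q z3) (hD : DD z1 z2 z3)
    (h : slab W t p e n q (ST W f) = true) : 2 ^ e ≤ ev f n q 0 1 0 1 z3 z1 z2 := by
  induction p generalizing e n q f with
  | nil =>
    have hh : run W (pk (Nat.mul W 17) (mp (fun _ => pk W (mp (fun _ => 1) rg17)) rg17)) n q t true e 0 1 0 1
      (mp (swI W) (swp (Nat.mul W 17) (ST W f))) = true := h
    rw [swp_ST W f (hf.mono he), swI_ST] at hh
    · rw [← ev_swap12, ← ev_swap23]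
      exact run_sound W n q z3 h3 t true e 0 1 0 1 _ z1 z2 he (fun i hi j hj k hk => hf k hk i hi j hj) h1 h2 hD hh
    · exact fun i hi j hj k hk => (hf.mono he) j hj i hi k hk
  | cons b p ih =>
    obtain ⟨hW, hh⟩ := brec h
    have hW : e + 17 ≤ W := Nat.le_of_ble_eq_true hW
    have c : (2 : ℝ) ^ (e + 16) = 2 ^ 16 * 2 ^ e := by rw [pow_add]; ring
    cases b with
    | false =>
      have hh : slab W t p (e + 16) (2 * n) (2 * q) (lft 17 (ST W f)) = true := hh
      rw [lft_ST] at hh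
      have := ih (e + 16) (2 * n) (2 * q) _ (by omega) (Bd_L hf) h3 hh
      rw [ev_L, c] at this
      exact le_of_mul_le_mul_left this (by positivity)
    | true =>
      have hh : slab W t p (e + 16) (2 * n + 1) (2 * q) (rgt 17 (ST W f)) = true := hh
      rw [rgt_ST] at hh
      have := ih (e + 16) (2 * n + 1) (2 * q) _ (by omega) (Bd_R hf) h3 hh
      rw [ev_R, c] at this
      exact le_of_mul_le_mul_left this (by positivity)
end Kiss

namespace Kiss
open Finset
set_option exponentiation.threshold 1000

theorem y_shape : allB (fun m : List (List ℕ) => Nat.beq m.length 17 && allB (fun r : List ℕ => Nat.beq r.length 17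
    && allB (fun y => Nat.ble (Nat.succ y) (2 ^ 62)) r) m) ytab = true := by decide +kernel
theorem y_len : ytab.length = 17 := by decide +kernel
theorem nth_mem {α : Type} (d : α) (l : List α) (i n : ℕ) (h : l.length = n) (hi : i < n) : nth d l i ∈ l := by
  rw [nth_eq, List.getD_eq_getElem _ _ (by omega)]
  exact List.getElem_mem _
theorem y_shape1 (i : ℕ) (hi : i < 17) : (nth [] ytab i).length = 17 ∧ ∀ j < 17, (nth [] (nth [] ytab i) j).length = 17 ∧
    ∀ k < 17, yf i j k < 2 ^ 62 := by
  have h1 := (allB_iff _ _).1 y_shape _ (nth_mem [] ytab i 17 y_len hi)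
  rw [Bool.and_eq_true] at h1
  have l1 : (nth [] ytab i).length = 17 := Nat.eq_of_beq_eq_true h1.1
  refine ⟨l1, fun j hj => ?_⟩
  have h2 := (allB_iff _ _).1 h1.2 _ (nth_mem [] _ j 17 l1 hj)
  rw [Bool.and_eq_true] at h2
  have l2 : (nth [] (nth [] ytab i) j).length = 17 := Nat.eq_of_beq_eq_true h2.1
  refine ⟨l2, fun k hk => ?_⟩
  exact Nat.le_of_ble_eq_true ((allB_iff _ _).1 h2.2 _ (nth_mem 0 _ k 17 l2 hk))
theorem Bd_y : Bd yf (61 + 1) := fun i hi j hj k hk => ((y_shape1 i hi).2 j hj).2 k hk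
theorem root_eq (W : ℕ) : root W ytab = ST W yf := by
  have e1 : ytab = (List.range 17).map fun i => (List.range 17).map fun j => (List.range 17).map fun k => yf i j k := by
    rw [list_eq_map [] ytab 17 y_len]
    apply List.map_congr_left
    intro i hi
    have hi := List.mem_range.1 hi
    rw [list_eq_map [] (nth [] ytab i) 17 (y_shape1 i hi).1]
    apply List.map_congr_left
    intro j hj
    have hj := List.mem_range.1 hj
    rw [list_eq_map 0 (nth [] (nth [] ytab i) j) 17 ((y_shape1 i hi).2 j hj).1]
    rfl
  rw [e1]
  unfold root
  simp only [mp_eq, List.map_map]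
  rfl
def Cv (p : List Bool) : Prop := ∀ z3, onP p 0 1 z3 → ∀ z1 z2, InB 0 1 z1 → InB 0 1 z2 → DD z1 z2 z3 →
  2 ^ 61 ≤ ev yf 0 1 0 1 0 1 z3 z1 z2
theorem Cv_of {W : ℕ} {t : Tr} {p : List Bool} (h : slab W t p 61 0 1 (root W ytab) = true) (hW : 61 < W) : Cv p := by
  intro z3 h3 z1 z2 h1 h2 hD
  rw [root_eq] at h
  exact slab_sound W t p 61 0 1 yf z1 z2 z3 hW Bd_y h1 h2 h3 hD h
theorem onP_split (p : List Bool) (n q : ℕ) (z : ℝ) (h : onP p n q z) : onP (p ++ [false]) n q z ∨ onP (p ++ [true]) n q z := by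
  induction p generalizing n q with
  | nil => exact InB_split h
  | cons b p ih => cases b <;> exact ih _ _ h
theorem Cv_join (p : List Bool) (h0 : Cv (p ++ [false])) (h1 : Cv (p ++ [true])) : Cv p := fun z h z1 z2 =>
  (onP_split p 0 1 z h).elim (fun h => h0 z h z1 z2) (fun h => h1 z h z1 z2)
theorem Cv_all : Cv [] := by
  have c (p : List Bool) (h0 : Cv (p ++ [false])) (h1 : Cv (p ++ [true])) : Cv p := Cv_join p h0 h1
  refine c _ (c _ (Cv_of s00 (by norm_num)) (c _ (Cv_of s010 (by norm_num)) (c _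
    (c _ (Cv_of s01100 (by norm_num)) (Cv_of s01101 (by norm_num)))
    (c _ (Cv_of s01110 (by norm_num)) (Cv_of s01111 (by norm_num)))))) (c _ (c _
    (c _ (Cv_of s1000 (by norm_num)) (c _ (Cv_of s10010 (by norm_num)) (Cv_of s10011 (by norm_num))))
    (c _ (c _ (Cv_of s10100 (by norm_num)) (Cv_of s10101 (by norm_num))) (Cv_of s1011 (by norm_num))))
    (c _ (c _ (c _ (Cv_of s11000 (by norm_num)) (c _
        (c _ (Cv_of s1100100 (by norm_num)) (Cv_of s1100101 (by norm_num)))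
        (c _ (Cv_of s1100110 (by norm_num)) (Cv_of s1100111 (by norm_num)))))
      (c _ (c _ (Cv_of s110100 (by norm_num)) (Cv_of s110101 (by norm_num))) (Cv_of s11011 (by norm_num))))
    (c _ (Cv_of s1110 (by norm_num)) (c _ (Cv_of s11110 (by norm_num))
      (c _ (Cv_of s111110 (by norm_num)) (Cv_of s111111 (by norm_num)))))))
theorem TT_sorted (x y z : ℝ) (hx : -8 ≤ x) (hxy : x ≤ y) (hyz : y ≤ z) (hz : z ≤ 8)
    (hd : 0 ≤ dt ((3 * x - 8) / 32) ((3 * y - 8) / 32) ((3 * z - 8) / 32)) : TT x y z ≤ 0 := by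
  have hI : ∀ w : ℝ, -8 ≤ w → w ≤ 8 → InB 0 1 ((w + 8) / 16) := fun w h1 h2 =>
    ⟨by norm_num, by push_cast; linarith, by push_cast; linarith, Or.inr (by norm_num)⟩
  have hu : ∀ w : ℝ, 3 * ((w + 8) / 16) / 2 - 1 = (3 * w - 8) / 32 := fun w => by ring
  have h1 := Cv_all ((z + 8) / 16) (hI z (by linarith) hz) ((x + 8) / 16) ((y + 8) / 16)
    (hI x hx (by linarith)) (hI y (by linarith) (by linarith))
    ⟨by linarith, by linarith, by rw [hu, hu, hu]; exact hd⟩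
  have h2 : dl ^ 3 * TT z x y = (16 ^ 16 * (16 ^ 16 * 16 ^ 16)) * hb3 ce (1 - (z + 8) / 16) ((z + 8) / 16)
      (1 - (x + 8) / 16) ((x + 8) / 16) (1 - (y + 8) / 16) ((y + 8) / 16) := by
    rw [← hb3_ce]
    have e1 : ∀ w : ℝ, 8 - w = 16 * (1 - (w + 8) / 16) := fun w => by ring
    have e2 : ∀ w : ℝ, 8 + w = 16 * ((w + 8) / 16) := fun w => by ring
    simp only [e1, e2]
    unfold hb3
    simp only [hb_smul, hb_cmul]
    ring
  have h3 : hb3 ce (1 - (z + 8) / 16) ((z + 8) / 16) (1 - (x + 8) / 16) ((x + 8) / 16) (1 - (y + 8) / 16) ((y + 8) / 16)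
      ≤ hb3 (fun i j k => 2 ^ 432 + -2 ^ 371 * (yf i j k : ℝ)) (1 - (z + 8) / 16) ((z + 8) / 16)
      (1 - (x + 8) / 16) ((x + 8) / 16) (1 - (y + 8) / 16) ((y + 8) / 16) := by
    have r1 : ∀ w : ℝ, w ≤ 8 → 0 ≤ 1 - (w + 8) / 16 := fun w h => by linarith
    have r2 : ∀ w : ℝ, -8 ≤ w → 0 ≤ (w + 8) / 16 := fun w h => by linarith
    unfold hb3
    refine hb_mono _ _ _ _ _ (r1 _ (by linarith)) (r2 _ (by linarith)) fun k hk => ?_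
    refine hb_mono _ _ _ _ _ (r1 _ (by linarith)) (r2 _ (by linarith)) fun j hj => ?_
    refine hb_mono _ _ _ _ _ (r1 _ (by linarith)) (r2 _ (by linarith)) fun i hi => ?_
    have := y_bound t0 i j k (by omega) (by omega) (by omega)
    change ce i j k ≤ 2 ^ 432 + -2 ^ 371 * (yf i j k : ℝ)
    linarith
  have h4 : hb3 (fun i j k => 2 ^ 432 + -2 ^ 371 * (yf i j k : ℝ)) (1 - (z + 8) / 16) ((z + 8) / 16)
      (1 - (x + 8) / 16) ((x + 8) / 16) (1 - (y + 8) / 16) ((y + 8) / 16) =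
      2 ^ 432 + -2 ^ 371 * ev yf 0 1 0 1 0 1 ((z + 8) / 16) ((x + 8) / 16) ((y + 8) / 16) := by
    unfold ev hb3
    simp only [hb_add, hb_cmul, hb_const]
    simp
  rw [h4] at h3
  have h5 : (2 : ℝ) ^ 432 + -2 ^ 371 * ev yf 0 1 0 1 0 1 ((z + 8) / 16) ((x + 8) / 16) ((y + 8) / 16) ≤ 0 := by
    have e : (2 : ℝ) ^ 432 = 2 ^ 371 * 2 ^ 61 := by rw [← pow_add]
    rw [e]
    have := mul_le_mul_of_nonneg_left h1 (by positivity : (0 : ℝ) ≤ 2 ^ 371)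
    linarith
  have h6 : dl ^ 3 * TT z x y ≤ 0 := by
    rw [h2]
    exact mul_nonpos_of_nonneg_of_nonpos (by positivity) (h3.trans h5)
  have hdl : (0 : ℝ) < (dl : ℝ) ^ 3 := by
    have : 0 < dl := by decide +kernel
    positivity
  rw [TT_swap12, TT_swap23] at h6
  by_contra hc
  push Not at hc
  have := mul_pos hdl hc
  linarith
theorem dt_swap12 (x y z : ℝ) : dt x y z = dt y x z := by unfold dt; ring
theorem dt_swap23 (x y z : ℝ) : dt x y z = dt x z y := by unfold dt; ring
theorem TT_le (x y z : ℝ) (hx : -8 ≤ x ∧ x ≤ 8) (hy : -8 ≤ y ∧ y ≤ 8) (hz : -8 ≤ z ∧ z ≤ 8)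
    (hd : 0 ≤ dt ((3 * x - 8) / 32) ((3 * y - 8) / 32) ((3 * z - 8) / 32)) : TT x y z ≤ 0 := by
  rcases le_total x y with h1 | h1 <;> rcases le_total y z with h2 | h2 <;> rcases le_total x z with h3 | h3
  · exact TT_sorted x y z hx.1 h1 h2 hz.2 hd
  · exact TT_sorted x y z hx.1 h1 h2 hz.2 hd
  · rw [TT_swap23]; rw [dt_swap23] at hd; exact TT_sorted x z y hx.1 h3 h2 hy.2 hd
  · rw [TT_swap23, TT_swap12]; rw [dt_swap23, dt_swap12] at hd; exact TT_sorted z x y hz.1 h3 h1 hy.2 hd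
  · rw [TT_swap12]; rw [dt_swap12] at hd; exact TT_sorted y x z hy.1 h1 h3 hz.2 hd
  · rw [TT_swap12, TT_swap23]; rw [dt_swap12, dt_swap23] at hd; exact TT_sorted y z x hy.1 h2 h3 hx.2 hd
  · rw [TT_swap23, TT_swap12, TT_swap23]; rw [dt_swap23, dt_swap12, dt_swap23] at hd
    exact TT_sorted z y x hz.1 h2 h1 hx.2 hd
  · rw [TT_swap23, TT_swap12, TT_swap23]; rw [dt_swap23, dt_swap12, dt_swap23] at hd
    exact TT_sorted z y x hz.1 h2 h1 hx.2 hd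
end Kiss

namespace Kiss
open Finset
set_option exponentiation.threshold 1000

/-! ### the univariate polynomial -/
noncomputable def akR : List ℝ := List.map (fun n : ℕ => (n : ℝ)) ak
noncomputable def PP (x : ℝ) : ℝ := sumG 17 (32 * (3 * x - 8)) (2 ^ 20) akR 0 +
  (((c0 * 2 ^ 129 : ℕ) : ℝ) * g l00 16 x + AA cols x x 32)
theorem PD_sumG (m N : ℕ) (s w : ℝ → ℝ) (hs : PD 1 s) (hw : PD 2 w) (l : List ℝ) (k : ℕ) (h : l.length + k ≤ N + 1) :
    PD N (fun t => sumG m (s t) (w t) l k) := by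
  induction l generalizing k with
  | nil => exact PD.const _ 0
  | cons a l ih =>
    rw [List.length_cons] at h
    exact (((PD_G m 1 s w hs hw k).mono (by omega)).cmul a).add (ih (k + 1) (by omega))
theorem ak_len : ak.length ≤ 33 := by decide +kernel
theorem yP_len : yP.length = 33 := by decide +kernel
theorem l00_len : l00.length ≤ 17 := by decide +kernel
theorem PD_PP : PD 32 PP := by
  have hU2 : PD 2 (fun x : ℝ => (3 * x - 8) ^ 2) := PD_U.pow (by norm_num)
  refine PD.add ?_ (PD.add ?_ ?_)
  · exact PD_sumG 17 32 _ (fun _ => 2 ^ 20) (PD_U.cmul 32) (PD.const _ _) akR 0 (by simpa [akR] using ak_len)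
  · refine PD.cmul _ ((PD_g l00 16 1 0 (fun x => x) (PD.id le_rfl) (by simpa using l00_len)).mono (by norm_num))
  · refine PD_AR 1 1 2 32 (fun x => x) (fun x => x) _ _ (PD.id le_rfl) (PD.id le_rfl) ?_ ?_ (by norm_num) (by norm_num)
      cols 0 okC_cols
    · exact (PD.const 2 _).sub (PD_U.mul PD_U (by norm_num))
    · exact ((PD.const 2 1024).sub hU2).mul ((PD.const 2 1024).sub hU2) (by norm_num)
noncomputable def yPf (i : ℕ) : ℕ := nth 0 yP i
theorem yP_eq : yP = (List.range 33).map yPf := list_eq_map 0 yP 33 yP_len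
theorem v_pZ (X : Z) : v (pZ cols l00 c0 ak X) = PP (v X) := by
  unfold pZ PP
  have hU : v (nmZ (subZ (sm 3 X) (ps 8))) = 3 * v X - 8 := by simp
  simp only [v_addZ]
  rw [v_agS 17 (by norm_num), v_aZ cols X X _ _ _ hU hU, v_sm, v_sm, v_geZ, hU, v_ps, v_ps, v_ps]
  congr 1
  · congr 1
    · norm_num
    · rw [mp_eq, akR, List.map_map]
      refine List.map_congr_left fun n _ => ?_
      simp
  · congr 1
    unfold g; norm_num
theorem P_id (x : ℝ) : hb 32 (fun i => (yPf i : ℝ)) (8 - x) (8 + x) + dP * (PP x + 2 ^ 256) = 2 ^ 418 := by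
  have hm : PD 1 (fun t : ℝ => 8 - t) := (PD.const 1 8).sub (PD.id le_rfl)
  have hp : PD 1 (fun t : ℝ => 8 + t) := (PD.const 1 8).add (PD.id le_rfl)
  refine PD.ext (n := 32) (f := fun x => hb 32 (fun i => (yPf i : ℝ)) (8 - x) (8 + x) + dP * (PP x + 2 ^ 256))
    (h := fun _ => 2 ^ 418) ?_ (PD.const _ _) 16 ?_ x
  · exact (PD_hb _ _ _ _ hm hp).add ((PD_PP.add (PD.const _ _)).cmul _)
  · intro i hi
    have h := tP
    rw [okP, allB_iff] at h
    have h := eqZ_iff _ _ (h i (by rw [rg33_eq]; simpa using hi))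
    rw [yP_eq, mp_eq, List.map_map, v_addZ, v_hrow33, v_sm, v_addZ, v_pZ, v_ps, v_ps, v_nz, v_nz, v_nz] at h
    have e1 : (8 : ℝ) - ((i : ℝ) - 16) = ((24 : ℕ) : ℝ) - i := by push_cast; ring
    have e2 : (8 : ℝ) + ((i : ℝ) - 16) = i - ((8 : ℕ) : ℝ) := by push_cast; ring
    have e3 : (i : ℝ) - 16 = i - ((16 : ℕ) : ℝ) := by push_cast; ring
    have e4 : (2 : ℝ) ^ 256 = ((Nat.pow 2 256 : ℕ) : ℝ) := by norm_num
    have e5 : (2 : ℝ) ^ 418 = ((Nat.pow 2 418 : ℕ) : ℝ) := by norm_num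
    simp only [e1, e2]
    rw [e3, e4, e5, ← h]
    congr 2
    funext j
    simp
theorem PP_le (x : ℝ) (h1 : -8 ≤ x) (h2 : x ≤ 8) : PP x + 2 ^ 256 ≤ 0 := by
  have h := P_id x
  have t := tP1
  rw [yP_eq] at t
  have hs := run1_sound _ 290 yPf 0 1 ((x + 8) / 16) t (by linarith) (by linarith)
  have e1 : (8 : ℝ) - x = 16 * (0 + 1 - 1 * ((x + 8) / 16)) := by ring
  have e2 : (8 : ℝ) + x = 16 * (1 * ((x + 8) / 16) - 0) := by ring
  rw [e1, e2, hb_smul] at h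
  have e3 : (2 : ℝ) ^ 418 = 16 ^ 32 * 2 ^ 290 := by norm_num
  have hs' := mul_le_mul_of_nonneg_left hs (by positivity : (0 : ℝ) ≤ 16 ^ 32)
  have hd : (0 : ℝ) < dP := by
    have : 0 < dP := by decide +kernel
    exact_mod_cast this
  by_contra hc
  push Not at hc
  have := mul_pos hd hc
  linarith
end Kiss

namespace Kiss
open Finset MvPolynomial

/-! ### zonal harmonics are positive definite -/
section zonal
variable {m : ℕ}
noncomputable def Lp (y : Fin m → ℝ) : MvPolynomial (Fin m) ℝ := ∑ i, C (y i) * X i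
noncomputable def Qp (m : ℕ) : MvPolynomial (Fin m) ℝ := ∑ i, X i ^ 2
noncomputable def Dp (y : Fin m → ℝ) (q : MvPolynomial (Fin m) ℝ) : MvPolynomial (Fin m) ℝ :=
  ∑ i, C (y i) * pderiv i q
noncomputable def Lap (q : MvPolynomial (Fin m) ℝ) : MvPolynomial (Fin m) ℝ := ∑ i, pderiv i (pderiv i q)
noncomputable def sqn (y : Fin m → ℝ) : ℝ := ∑ i, y i ^ 2
noncomputable def Hp (y : Fin m → ℝ) : ℕ → MvPolynomial (Fin m) ℝ
  | 0 => 1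
  | 1 => C ((m : ℝ) - 2) * Lp y
  | k + 2 => C (2 * (k : ℝ) + m) * (Lp y * Hp y (k + 1)) -
      C ((k + 1) * ((k : ℝ) + m - 2) * sqn y) * (Qp m * Hp y k)
theorem pderiv_Lp (y : Fin m → ℝ) (i : Fin m) : pderiv i (Lp y) = C (y i) := by
  simp only [Lp, map_sum, pderiv_C_mul, pderiv_X]
  rw [Finset.sum_eq_single i]
  · simp
  · intro b _ hb; simp [hb.symm]
  · simp
theorem pderiv_Qp (i : Fin m) : pderiv i (Qp m) = 2 * X i := by
  simp only [Qp, map_sum, pderiv_pow, pderiv_X]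
  rw [Finset.sum_eq_single i]
  · simp
  · intro b _ hb; simp [hb.symm]
  · simp
theorem Dp_mul (y : Fin m → ℝ) (p q : MvPolynomial (Fin m) ℝ) : Dp y (p * q) = Dp y p * q + p * Dp y q := by
  simp only [Dp, pderiv_mul, Finset.mul_sum, Finset.sum_mul, ← Finset.sum_add_distrib]
  exact Finset.sum_congr rfl fun i _ => by ring
theorem Dp_C_mul (y : Fin m → ℝ) (a : ℝ) (q : MvPolynomial (Fin m) ℝ) : Dp y (C a * q) = C a * Dp y q := by
  simp only [Dp, pderiv_C_mul, Finset.mul_sum]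
  exact Finset.sum_congr rfl fun i _ => by ring
theorem Dp_sub (y : Fin m → ℝ) (p q : MvPolynomial (Fin m) ℝ) : Dp y (p - q) = Dp y p - Dp y q := by
  simp only [Dp, map_sub, mul_sub, Finset.sum_sub_distrib]
theorem Dp_Lp (y : Fin m → ℝ) : Dp y (Lp y) = C (sqn y) := by
  simp only [Dp, pderiv_Lp, sqn, map_sum, ← C_mul, sq]
theorem Dp_Qp (y : Fin m → ℝ) : Dp y (Qp m) = 2 * Lp y := by
  simp only [Dp, pderiv_Qp, Lp, Finset.mul_sum]
  exact Finset.sum_congr rfl fun i _ => by ring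
theorem Lap_C_mul (a : ℝ) (q : MvPolynomial (Fin m) ℝ) : Lap (C a * q) = C a * Lap q := by
  simp only [Lap, pderiv_C_mul, Finset.mul_sum]
theorem Lap_sub (p q : MvPolynomial (Fin m) ℝ) : Lap (p - q) = Lap p - Lap q := by
  simp only [Lap, map_sub, Finset.sum_sub_distrib]
theorem Lap_Lp (y : Fin m → ℝ) (q : MvPolynomial (Fin m) ℝ) : Lap (Lp y * q) = 2 * Dp y q + Lp y * Lap q := by
  simp only [Lap, Dp, pderiv_mul, pderiv_Lp, map_add, pderiv_C, Finset.mul_sum, ← Finset.sum_add_distrib]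
  exact Finset.sum_congr rfl fun i _ => by ring
theorem Lap_Qp (q : MvPolynomial (Fin m) ℝ) :
    Lap (Qp m * q) = 2 * m * q + 4 * ∑ i, X i * pderiv i q + Qp m * Lap q := by
  have h2 : ∀ i : Fin m, pderiv i (2 : MvPolynomial (Fin m) ℝ) = 0 := fun i => by
    rw [show (2 : MvPolynomial (Fin m) ℝ) = C 2 from (map_ofNat C 2).symm, pderiv_C]
  have h : 2 * (m : MvPolynomial (Fin m) ℝ) * q = ∑ i : Fin m, 2 * q := by
    simp; ring
  rw [h]
  simp only [Lap, pderiv_mul, pderiv_Qp, map_add, pderiv_X_self, h2, Finset.mul_sum, ← Finset.sum_add_distrib]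
  exact Finset.sum_congr rfl fun i _ => by ring
theorem Lp_hom (y : Fin m → ℝ) : (Lp y).IsHomogeneous 1 :=
  IsHomogeneous.sum _ _ _ fun i _ => by simpa using (isHomogeneous_C _ (y i)).mul (isHomogeneous_X ℝ i)
theorem Qp_hom : (Qp m).IsHomogeneous 2 :=
  IsHomogeneous.sum _ _ _ fun i _ => by simpa using (isHomogeneous_X ℝ i).pow 2
theorem C_hom (a : ℝ) {q : MvPolynomial (Fin m) ℝ} {k : ℕ} (h : q.IsHomogeneous k) : (C a * q).IsHomogeneous k := by
  simpa using (isHomogeneous_C _ a).mul h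
theorem Hp_hom (y : Fin m → ℝ) (k : ℕ) : (Hp y k).IsHomogeneous k ∧ (Hp y (k + 1)).IsHomogeneous (k + 1) := by
  induction k with
  | zero => exact ⟨isHomogeneous_one _ _, C_hom _ (Lp_hom y)⟩
  | succ k ih =>
    refine ⟨ih.2, ?_⟩
    rw [Hp]
    refine (C_hom _ ?_).sub (C_hom _ ?_)
    · have := (Lp_hom y).mul ih.2
      rwa [show 1 + (k + 1) = k + 1 + 1 by ring] at this
    · have := (Qp_hom (m := m)).mul ih.1
      rwa [show 2 + k = k + 1 + 1 by ring] at this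
theorem Dp_Hp (y : Fin m → ℝ) (k : ℕ) : Dp y (Hp y (k + 1)) = C ((k + 1) * ((k : ℝ) + m - 2) * sqn y) * Hp y k ∧
    Dp y (Hp y (k + 2)) = C ((k + 2) * ((k : ℝ) + m - 1) * sqn y) * Hp y (k + 1) := by
  have h0 : Dp y (Hp y 1) = C (((m : ℝ) - 2) * sqn y) * Hp y 0 := by
    rw [Hp, Hp, Dp_C_mul, Dp_Lp, C_mul, mul_one]
  have hD1 : Dp y (1 : MvPolynomial (Fin m) ℝ) = 0 := by simp [Dp]
  induction k with
  | zero =>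
    refine ⟨by rw [h0]; simp, ?_⟩
    rw [show Hp y (0 + 2) = _ from Hp.eq_3 y 0, Dp_sub, Dp_C_mul, Dp_C_mul, Dp_mul, Dp_mul, h0, Dp_Lp, Dp_Qp]
    simp only [Hp, hD1, map_mul, map_add, map_sub, map_natCast, map_ofNat, map_one, map_zero, Nat.cast_zero]
    ring
  | succ k ih =>
    refine ⟨by rw [ih.2]; congr 2; push_cast; ring, ?_⟩
    rw [Hp, Dp_sub, Dp_C_mul, Dp_C_mul, Dp_mul, Dp_mul, ih.2, ih.1, Dp_Lp, Dp_Qp]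
    rw [Hp]
    simp only [map_mul, map_add, map_sub, map_natCast, map_ofNat, map_one, map_zero]
    push_cast
    ring
theorem Lap_Hp (y : Fin m → ℝ) (k : ℕ) : Lap (Hp y k) = 0 ∧ Lap (Hp y (k + 1)) = 0 := by
  induction k with
  | zero =>
    have h1 : Lap (1 : MvPolynomial (Fin m) ℝ) = 0 := by simp [Lap]
    have h2 := Lap_Lp y 1
    rw [h1, mul_one] at h2
    refine ⟨h1, ?_⟩
    rw [Hp, Lap_C_mul, h2]
    simp [Dp]
  | succ k ih =>
    refine ⟨ih.2, ?_⟩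
    rw [Hp, Lap_sub, Lap_C_mul, Lap_C_mul, Lap_Lp, Lap_Qp, ih.1, ih.2, (Dp_Hp y k).1,
      (Hp_hom y k).1.sum_X_mul_pderiv, nsmul_eq_mul]
    simp only [map_mul, map_add, map_sub, map_natCast, map_ofNat, map_one, map_zero]
    ring
theorem eval_Hp (x y : Fin m → ℝ) (k : ℕ) : eval x (Hp y k) = G m (∑ i, y i * x i) (sqn y * sqn x) k ∧
    eval x (Hp y (k + 1)) = G m (∑ i, y i * x i) (sqn y * sqn x) (k + 1) := by
  have hL : eval x (Lp y) = ∑ i, y i * x i := by simp [Lp]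
  have hQ : eval x (Qp m) = sqn x := by simp [Qp, sqn]
  induction k with
  | zero => simp [Hp, G, hL]
  | succ k ih =>
    refine ⟨ih.2, ?_⟩
    rw [Hp, G]
    simp only [map_sub, map_mul, eval_C, hL, hQ, ih.1, ih.2]
    ring

/-! the Fischer form -/
noncomputable def fac (a : Fin m →₀ ℕ) : ℝ := ∏ i, ((a i).factorial : ℝ)
theorem fac_succ (a : Fin m →₀ ℕ) (i : Fin m) : fac (a + Finsupp.single i 1) = fac a * (a i + 1) := by
  unfold fac
  rw [← Finset.mul_prod_erase _ _ (Finset.mem_univ i), ← Finset.mul_prod_erase univ (fun j => ((a j).factorial : ℝ)) (Finset.mem_univ i)]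
  have : ∏ j ∈ univ.erase i, (((a + Finsupp.single i 1 : Fin m →₀ ℕ) j).factorial : ℝ) = ∏ j ∈ univ.erase i, ((a j).factorial : ℝ) := by
    refine Finset.prod_congr rfl fun j hj => ?_
    simp [Finsupp.single_apply, (Finset.ne_of_mem_erase hj).symm]
  rw [this]
  simp [Nat.factorial_succ]
  ring
noncomputable def B (q : MvPolynomial (Fin m) ℝ) : MvPolynomial (Fin m) ℝ →ₗ[ℝ] ℝ :=
  (basisMonomials (Fin m) ℝ).constr ℝ (fun a => fac a * coeff a q)
theorem B_mono (q : MvPolynomial (Fin m) ℝ) (a : Fin m →₀ ℕ) : B q (monomial a 1) = fac a * coeff a q := by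
  have := (basisMonomials (Fin m) ℝ).constr_basis ℝ (fun a => fac a * coeff a q) a
  rwa [coe_basisMonomials] at this
theorem B_smul (q p : MvPolynomial (Fin m) ℝ) (c : ℝ) : B q (C c * p) = c * B q p := by
  rw [C_mul', map_smul, smul_eq_mul]
theorem B_mono' (q : MvPolynomial (Fin m) ℝ) (a : Fin m →₀ ℕ) (c : ℝ) : B q (monomial a c) = c * (fac a * coeff a q) := by
  rw [← mul_one c, ← C_mul_monomial, B_smul, B_mono, mul_one]
theorem B_nonneg (q : MvPolynomial (Fin m) ℝ) : 0 ≤ B q q := by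
  have h : B q q = ∑ a ∈ q.support, coeff a q * (fac a * coeff a q) := by
    conv_lhs => rw [q.as_sum]
    rw [map_sum]
    refine Finset.sum_congr rfl fun a _ => ?_
    rw [← q.as_sum, B_mono']
  rw [h]
  refine Finset.sum_nonneg fun a _ => ?_
  have : 0 ≤ fac a := Finset.prod_nonneg fun i _ => by positivity
  nlinarith [mul_nonneg this (sq_nonneg (coeff a q))]
theorem B_X (q p : MvPolynomial (Fin m) ℝ) (i : Fin m) : B q (X i * p) = B (pderiv i q) p := by
  induction p using MvPolynomial.induction_on' with
  | monomial a c =>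
    rw [X, monomial_mul, B_mono', B_mono', coeff_pderiv, add_comm, fac_succ]
    ring
  | add p q h1 h2 => rw [mul_add, map_add, map_add, h1, h2]
theorem B_add (q q' p : MvPolynomial (Fin m) ℝ) : B (q + q') p = B q p + B q' p := by
  induction p using MvPolynomial.induction_on' with
  | monomial a c => simp only [B_mono', coeff_add]; ring
  | add p q h1 h2 => rw [map_add, map_add, map_add, h1, h2]; ring
theorem B_C_mul (q p : MvPolynomial (Fin m) ℝ) (d : ℝ) : B (C d * q) p = d * B q p := by
  induction p using MvPolynomial.induction_on' with
  | monomial a c => simp only [B_mono', coeff_C_mul]; ring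
  | add p q h1 h2 => rw [map_add, map_add, h1, h2]; ring
theorem B_zero (p : MvPolynomial (Fin m) ℝ) : B 0 p = 0 := by
  have := B_C_mul 0 p 0
  simpa using this
theorem B_sum {ι : Type*} (s : Finset ι) (f : ι → MvPolynomial (Fin m) ℝ) (p : MvPolynomial (Fin m) ℝ) :
    B (∑ i ∈ s, f i) p = ∑ i ∈ s, B (f i) p := by
  classical
  induction s using Finset.induction_on with
  | empty => simp [B_zero]
  | insert a s h ih => rw [Finset.sum_insert h, Finset.sum_insert h, B_add, ih]
theorem B_Lp (y : Fin m → ℝ) (q p : MvPolynomial (Fin m) ℝ) : B q (Lp y * p) = B (Dp y q) p := by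
  rw [Dp, B_sum, Lp, Finset.sum_mul, map_sum]
  refine Finset.sum_congr rfl fun i _ => ?_
  rw [mul_assoc, B_smul, B_X, B_C_mul]
theorem B_Qp (q p : MvPolynomial (Fin m) ℝ) : B q (Qp m * p) = B (Lap q) p := by
  rw [Lap, B_sum, Qp, Finset.sum_mul, map_sum]
  refine Finset.sum_congr rfl fun i _ => ?_
  rw [sq, mul_assoc, B_X, B_X]
noncomputable def Ac (m : ℕ) : ℕ → ℝ
  | 0 => 1
  | 1 => (m : ℝ) - 2
  | k + 2 => (2 * (k : ℝ) + m) * (k + 2) * Ac m (k + 1)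
theorem Ac_pos (hm : 3 ≤ m) (k : ℕ) : 0 < Ac m k ∧ 0 < Ac m (k + 1) := by
  have hm' : (3 : ℝ) ≤ m := by exact_mod_cast hm
  induction k with
  | zero => exact ⟨one_pos, by rw [Ac]; linarith⟩
  | succ k ih =>
    refine ⟨ih.2, ?_⟩
    rw [Ac]
    have := ih.2
    positivity
theorem Dp_hom (y : Fin m → ℝ) (q : MvPolynomial (Fin m) ℝ) (k : ℕ) (h : q.IsHomogeneous (k + 1)) :
    (Dp y q).IsHomogeneous k :=
  IsHomogeneous.sum _ _ _ fun i _ => C_hom _ (by simpa using h.pderiv (i := i))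
theorem Lap_Dp (y : Fin m → ℝ) (q : MvPolynomial (Fin m) ℝ) (h : Lap q = 0) : Lap (Dp y q) = 0 := by
  have : Lap (Dp y q) = ∑ i, C (y i) * pderiv i (Lap q) := by
    simp only [Lap, Dp, map_sum, pderiv_C_mul, Finset.mul_sum]
    rw [Finset.sum_comm]
    refine Finset.sum_congr rfl fun i _ => Finset.sum_congr rfl fun j _ => ?_
    congr 1
    have hc : ∀ p : MvPolynomial (Fin m) ℝ, pderiv j (pderiv i p) = pderiv i (pderiv j p) := fun p => by
      ext a
      simp only [coeff_pderiv]
      rw [add_right_comm]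
      by_cases hij : i = j
      · subst hij; ring
      · simp [hij, Ne.symm hij]; ring
    rw [hc, hc]
  rw [this, h]
  simp
theorem eval_Dp (y : Fin m → ℝ) (q : MvPolynomial (Fin m) ℝ) (k : ℕ) (h : q.IsHomogeneous k) :
    eval y (Dp y q) = k * eval y q := by
  have := congrArg (eval y) h.sum_X_mul_pderiv
  rw [nsmul_eq_mul, map_mul, map_natCast] at this
  rw [← this]
  simp [Dp]
theorem B_Hp (y : Fin m → ℝ) (k : ℕ) :
    (∀ q : MvPolynomial (Fin m) ℝ, q.IsHomogeneous k → Lap q = 0 → B q (Hp y k) = Ac m k * eval y q) ∧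
    (∀ q : MvPolynomial (Fin m) ℝ, q.IsHomogeneous (k + 1) → Lap q = 0 → B q (Hp y (k + 1)) = Ac m (k + 1) * eval y q) := by
  have h0 : ∀ q : MvPolynomial (Fin m) ℝ, q.IsHomogeneous 0 → B q 1 = eval y q := by
    intro q hq
    rw [← totalDegree_zero_iff_isHomogeneous, totalDegree_eq_zero_iff_eq_C] at hq
    rw [hq]
    have := B_mono' (C (coeff 0 q)) (0 : Fin m →₀ ℕ) 1
    rw [monomial_zero', C_1] at this
    rw [this]
    simp [fac]
  induction k with
  | zero =>
    refine ⟨fun q hq _ => by rw [Hp, Ac, one_mul, h0 q hq], fun q hq hl => ?_⟩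
    have e : Lp y = Lp y * 1 := (mul_one _).symm
    rw [Hp, Ac, B_smul, e, B_Lp, h0 _ (Dp_hom y q 0 hq), eval_Dp y q 1 hq]
    simp
  | succ k ih =>
    refine ⟨ih.2, fun q hq hl => ?_⟩
    rw [Hp, Ac, map_sub, B_smul, B_smul, B_Lp, B_Qp, hl, B_zero, ih.2 _ (Dp_hom y q _ hq) (Lap_Dp y q hl),
      eval_Dp y q _ hq]
    push_cast
    ring
theorem G_psd (hm : 3 ≤ m) {ι : Type*} (s : Finset ι) (y : ι → Fin m → ℝ) (c : ι → ℝ) (k : ℕ) :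
    0 ≤ ∑ i ∈ s, ∑ j ∈ s, c i * c j * G m (∑ l, y i l * y j l) (sqn (y i) * sqn (y j)) k := by
  have hl : ∀ f : ι → MvPolynomial (Fin m) ℝ, Lap (∑ i ∈ s, f i) = ∑ i ∈ s, Lap (f i) := fun f => by
    simp only [Lap, map_sum]; rw [Finset.sum_comm]
  set q : MvPolynomial (Fin m) ℝ := ∑ i ∈ s, C (c i) * Hp (y i) k with hq
  have h1 : q.IsHomogeneous k := IsHomogeneous.sum _ _ _ fun i _ => C_hom _ (Hp_hom _ k).1
  have h2 : Lap q = 0 := by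
    rw [hq, hl]
    exact Finset.sum_eq_zero fun i _ => by rw [Lap_C_mul, (Lap_Hp _ k).1, mul_zero]
  have h3 : B q q = Ac m k * ∑ i ∈ s, ∑ j ∈ s, c i * c j * G m (∑ l, y i l * y j l) (sqn (y i) * sqn (y j)) k := by
    conv_lhs => rw [hq]
    rw [map_sum, Finset.sum_comm, Finset.mul_sum]
    refine Finset.sum_congr rfl fun j _ => ?_
    rw [← hq, B_smul, (B_Hp (y j) k).1 q h1 h2, hq, map_sum, Finset.mul_sum, Finset.mul_sum, Finset.mul_sum]
    refine Finset.sum_congr rfl fun i _ => ?_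
    rw [map_mul, eval_C, (eval_Hp _ _ k).1]
    ring
  have h4 := B_nonneg q
  rw [h3] at h4
  exact nonneg_of_mul_nonneg_right h4 (Ac_pos hm k).1
end zonal
end Kiss

namespace Kiss
open Finset
set_option exponentiation.threshold 1000

/-! ### the two- and three-point inequalities -/
abbrev E17 := EuclideanSpace ℝ (Fin 17)
noncomputable def ip (x y : E17) : ℝ := inner ℝ x y
theorem ip_comm (x y : E17) : ip x y = ip y x := real_inner_comm y x
theorem ip_sum (x y : E17) : ip x y = ∑ i, x i * y i := by
  unfold ip
  rw [PiLp.inner_apply]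
  refine Finset.sum_congr rfl fun i _ => ?_
  simp [mul_comm]
theorem psd17 (S : Finset E17) (hS : ∀ x ∈ S, ip x x = 1) (k : ℕ) :
    0 ≤ ∑ x ∈ S, ∑ y ∈ S, G 17 (1024 * ip x y) (2 ^ 20) k := by
  have h := G_psd (m := 17) (by norm_num) S (fun x l => 32 * x l) (fun _ => 1) k
  refine h.trans_eq (Finset.sum_congr rfl fun x hx => Finset.sum_congr rfl fun y hy => ?_)
  have e1 : ∀ x y : E17, ∑ l, (32 * x l) * (32 * y l) = 1024 * ip x y := fun x y => by
    rw [ip_sum, Finset.mul_sum]; exact Finset.sum_congr rfl fun i _ => by ring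
  have e2 : ∀ x ∈ S, sqn (fun l => 32 * x l) = 1024 := fun x hx => by
    have := e1 x x
    rw [hS x hx] at this
    simp only [sqn, sq, this]; norm_num
  simp only [e1, e2 x hx, e2 y hy]
  norm_num
theorem psd17_sum (S : Finset E17) (hS : ∀ x ∈ S, ip x x = 1) (l : List ℝ) (hl : ∀ a ∈ l, 0 ≤ a) (k : ℕ) :
    0 ≤ ∑ x ∈ S, ∑ y ∈ S, sumG 17 (1024 * ip x y) (2 ^ 20) l k := by
  induction l generalizing k with
  | nil => simp [sumG]
  | cons a l ih =>
    have h1 : ∀ s, sumG 17 s (2 ^ 20) (a :: l) k = a * G 17 s (2 ^ 20) k + sumG 17 s (2 ^ 20) l (k + 1) := fun _ => rfl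
    simp only [h1, Finset.sum_add_distrib, ← Finset.mul_sum]
    exact add_nonneg (mul_nonneg (hl a (by simp)) (psd17 S hS k)) (ih (fun b hb => hl b (by simp [hb])) _)
theorem exists_frame (z : E17) (hz : ip z z = 1) : ∃ f : E17 → Fin 16 → ℝ,
    ∀ x y, ∑ l, f x l * f y l = ip x y - ip x z * ip y z := by
  have hz' : ‖z‖ = 1 := by
    have h : ‖z‖ ^ 2 = 1 := by rw [← real_inner_self_eq_norm_sq]; exact hz
    nlinarith [norm_nonneg z]
  have ho : Orthonormal ℝ (({0} : Set (Fin 17)).domRestrict (fun _ => z)) := by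
    refine ⟨fun i => hz', fun i j hij => (hij ?_).elim⟩
    exact Subtype.ext ((Set.mem_singleton_iff.mp i.2).trans (Set.mem_singleton_iff.mp j.2).symm)
  obtain ⟨b, hb⟩ := ho.exists_orthonormalBasis_extension_of_card_eq (by simp)
  have hb0 : b 0 = z := hb 0 rfl
  refine ⟨fun x l => ip x (b l.succ), fun x y => ?_⟩
  have h := b.sum_inner_mul_inner x y
  rw [Fin.sum_univ_succ, hb0] at h
  have h2 : ∑ l : Fin 16, ip x (b l.succ) * ip y (b l.succ) = ∑ l : Fin 16, inner ℝ x (b l.succ) * inner ℝ (b l.succ) y := by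
    refine Finset.sum_congr rfl fun l _ => ?_
    rw [ip_comm y]; rfl
  rw [h2, ip_comm y z]
  unfold ip
  linarith
noncomputable def XX (x y : E17) : ℝ := (32 * ip x y + 8) / 3
theorem XX_comm (x y : E17) : XX x y = XX y x := by rw [XX, ip_comm, XX]
theorem XX_U (x y : E17) : 3 * XX x y - 8 = 32 * ip x y := by unfold XX; ring
noncomputable def s3 (z x y : E17) : ℝ := 32 * (32 * ip x y) - (32 * ip x z) * (32 * ip y z)
noncomputable def w3 (z x y : E17) : ℝ := (1024 - (32 * ip x z) ^ 2) * (1024 - (32 * ip y z) ^ 2)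
theorem psd16 (z : E17) (hz : ip z z = 1) (T : Finset E17) (hT : ∀ x ∈ T, ip x x = 1) (c : E17 → ℝ) (k : ℕ) :
    0 ≤ ∑ x ∈ T, ∑ y ∈ T, c x * c y * G 16 (s3 z x y) (w3 z x y) k := by
  obtain ⟨f, hf⟩ := exists_frame z hz
  have h := G_psd (m := 16) (by norm_num) T (fun x l => 32 * f x l) c k
  refine h.trans_eq (Finset.sum_congr rfl fun x hx => Finset.sum_congr rfl fun y hy => ?_)
  have e1 : ∀ x y : E17, ∑ l, (32 * f x l) * (32 * f y l) = 1024 * (ip x y - ip x z * ip y z) := fun x y => by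
    rw [← hf, Finset.mul_sum]; exact Finset.sum_congr rfl fun i _ => by ring
  have e2 : ∀ x ∈ T, sqn (fun l => 32 * f x l) = 1024 - (32 * ip x z) ^ 2 := fun x hx => by
    have := e1 x x
    rw [hT x hx] at this
    simp only [sqn, sq, this]; ring
  simp only [e1, e2 x hx, e2 y hy]
  congr 2
  unfold s3; ring
theorem psdAR (z : E17) (hz : ip z z = 1) (T : Finset E17) (hT : ∀ x ∈ T, ip x x = 1) (C : List (List (List ℤ))) (k : ℕ) :
    0 ≤ ∑ x ∈ T, ∑ y ∈ T, AR (XX x z) (XX y z) (s3 z x y) (w3 z x y) C k := by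
  induction C generalizing k with
  | nil => simp [AR]
  | cons c C ih =>
    simp only [AR_cons, Finset.sum_add_distrib]
    refine add_nonneg ?_ (ih _)
    have h : ∀ c : List (List ℤ), 0 ≤ ∑ x ∈ T, ∑ y ∈ T,
        (c.map (fun l => g l (16 - k) (XX x z) * g l (16 - k) (XX y z))).sum * G 16 (s3 z x y) (w3 z x y) k := by
      intro c
      induction c with
      | nil => simp
      | cons l c ih =>
        simp only [List.map_cons, List.sum_cons, add_mul, Finset.sum_add_distrib]
        exact add_nonneg (psd16 z hz T hT (fun x => g l (16 - k) (XX x z)) k) ih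
    simp only [mul_assoc, ← Finset.mul_sum]
    exact mul_nonneg (by positivity) (h c)
theorem AA_eq (C : List (List (List ℤ))) (z x y : E17) :
    AA C (XX x z) (XX y z) (32 * ip x y) = AR (XX x z) (XX y z) (s3 z x y) (w3 z x y) C 0 := by
  rw [AA, XX_U, XX_U]; rfl
noncomputable def Lam : ℝ := 2 ^ 80 * (c0 * 8 ^ 16) ^ 2
theorem three_pt (z : E17) (hz : ip z z = 1) (T : Finset E17) (hT : ∀ x ∈ T, ip x x = 1) :
    0 ≤ Lam + (∑ x ∈ T, ((c0 * 2 ^ 129 : ℕ) : ℝ) * g l00 16 (XX x z) +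
      ∑ x ∈ T, ∑ y ∈ T, AA cols (XX x z) (XX y z) (32 * ip x y)) := by
  have hc : cols = (l00 :: (cols.headD []).tail) :: cols.tail := rfl
  have h1 := psdAR z hz T hT ((cols.headD []).tail :: cols.tail) 0
  have h2 : ∀ x y, AA cols (XX x z) (XX y z) (32 * ip x y) = 2 ^ 80 * (g l00 16 (XX x z) * g l00 16 (XX y z)) +
      AR (XX x z) (XX y z) (s3 z x y) (w3 z x y) ((cols.headD []).tail :: cols.tail) 0 := by
    intro x y
    rw [AA_eq, hc, AR_cons, ← hc, AR_cons, List.map_cons, List.sum_cons, G]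
    simp only [Nat.mul_zero, Nat.sub_zero]
    ring
  simp only [h2, Finset.sum_add_distrib, ← Finset.mul_sum, ← Finset.sum_mul]
  unfold Lam
  push_cast
  nlinarith [sq_nonneg ((c0 : ℝ) * 8 ^ 16 + ∑ x ∈ T, g l00 16 (XX x z))]
theorem sum_er [DecidableEq E17] (S : Finset E17) (z : E17) (f : E17 → ℝ) :
    ∑ x ∈ S.erase z, f x = ∑ x ∈ S, if x ≠ z then f x else 0 := by
  rw [← Finset.filter_ne', Finset.sum_filter]
theorem triples [DecidableEq E17] (S : Finset E17) (F : E17 → E17 → E17 → ℝ)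
    (h : ∀ x ∈ S, ∀ y ∈ S, ∀ z ∈ S, x ≠ y → x ≠ z → y ≠ z → F x y z + F z y x + F z x y ≤ 0) :
    ∑ z ∈ S, ∑ x ∈ S.erase z, ∑ y ∈ (S.erase z).erase x, F x y z ≤ 0 := by
  obtain ⟨W, hW⟩ : ∃ W : E17 → E17 → E17 → ℝ, ∀ x y z, W x y z = if x ≠ y ∧ x ≠ z ∧ y ≠ z then F x y z else 0 :=
    ⟨_, fun _ _ _ => rfl⟩
  have h1 : ∑ z ∈ S, ∑ x ∈ S.erase z, ∑ y ∈ (S.erase z).erase x, F x y z = ∑ z ∈ S, ∑ x ∈ S, ∑ y ∈ S, W x y z := by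
    refine Finset.sum_congr rfl fun z hz => ?_
    rw [sum_er]
    refine Finset.sum_congr rfl fun x hx => ?_
    by_cases hxz : x = z
    · rw [if_neg (by simpa using hxz)]
      exact (Finset.sum_eq_zero fun y _ => by rw [hW, if_neg (by tauto)]).symm
    · rw [if_pos hxz, Finset.erase_right_comm, sum_er, sum_er]
      refine Finset.sum_congr rfl fun y hy => ?_
      rw [hW]
      by_cases hyz : y = z <;> by_cases hxy : x = y <;> simp_all [eq_comm]
  have h2 : ∑ z ∈ S, ∑ x ∈ S, ∑ y ∈ S, W z y x = ∑ z ∈ S, ∑ x ∈ S, ∑ y ∈ S, W x y z := Finset.sum_comm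
  have h3 : ∑ z ∈ S, ∑ x ∈ S, ∑ y ∈ S, W z x y = ∑ z ∈ S, ∑ x ∈ S, ∑ y ∈ S, W x y z := by
    rw [← h2]
    exact Finset.sum_congr rfl fun z _ => Finset.sum_comm
  have h4 : ∑ z ∈ S, ∑ x ∈ S, ∑ y ∈ S, (W x y z + W z y x + W z x y) ≤ 0 := by
    refine Finset.sum_nonpos fun z hz => Finset.sum_nonpos fun x hx => Finset.sum_nonpos fun y hy => ?_
    rw [hW, hW, hW]
    by_cases hd : x ≠ y ∧ x ≠ z ∧ y ≠ z
    · rw [if_pos hd, if_pos (by tauto), if_pos (by tauto)]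
      exact h x hx y hy z hz hd.1 hd.2.1 hd.2.2
    · rw [if_neg hd, if_neg (by tauto), if_neg (by tauto)]
      norm_num
  simp only [Finset.sum_add_distrib] at h4
  rw [h2, h3, ← h1] at h4
  linarith
theorem numeric : Lam + sumG 17 1024 (2 ^ 20) akR 0 < 2 ^ 256 * 11072 := by
  have h : leZ (addZ (ps (Nat.add 1 (Nat.mul (Nat.pow 2 80) (Nat.pow (Nat.mul c0 (Nat.pow 8 16)) 2))))
      (agS 17 (ps 1024) (ps (Nat.pow 2 20)) (mp ps ak))) (ps (Nat.mul (Nat.pow 2 256) 11072)) = true := by decide +kernel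
  have h := leZ_iff _ _ h
  rw [v_addZ, v_agS 17 (by norm_num), v_ps, v_ps, v_ps, v_ps] at h
  have e : (mp ps ak).map v = akR := by
    rw [mp_eq, akR, List.map_map]
    exact List.map_congr_left fun n _ => by simp
  rw [e] at h
  simp only [Nat.add_eq, Nat.mul_eq, Nat.pow_eq] at h
  push_cast at h
  unfold Lam
  norm_num at h ⊢
  linarith
theorem dt_nonneg (x y z : E17) (hx : ip x x = 1) (hy : ip y y = 1) (hz : ip z z = 1) :
    0 ≤ dt (ip x z) (ip y z) (ip x y) := by
  have h := real_inner_mul_inner_self_le (x - ip x z • z) (y - ip y z • z)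
  have e : ∀ x y : E17, inner ℝ (x - ip x z • z) (y - ip y z • z) = ip x y - ip x z * ip y z := fun x y => by
    simp only [inner_sub_left, inner_sub_right, real_inner_smul_left, real_inner_smul_right]
    have e1 : (inner ℝ z z : ℝ) = 1 := hz
    have e2 : (inner ℝ z y : ℝ) = ip y z := ip_comm z y
    rw [e1, e2]
    unfold ip
    ring
  rw [e, e, e, hx, hy] at h
  unfold dt
  nlinarith
theorem main (S : Finset E17) (hnorm : ∀ x ∈ S, ‖x‖ = 1) (hdist : ∀ x ∈ S, ∀ y ∈ S, x ≠ y → 1 ≤ dist x y) :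
    S.card ≤ 11072 := by
  classical
  have h11 : ∀ x ∈ S, ip x x = 1 := fun x hx => by
    have := real_inner_self_eq_norm_sq x
    rw [hnorm x hx] at this
    unfold ip; rw [this]; norm_num
  have hle : ∀ x ∈ S, ∀ y ∈ S, x ≠ y → -8 ≤ XX x y ∧ XX x y ≤ 8 := fun x hx y hy hxy => by
    have h1 := hdist x hx y hy hxy
    have h2 : ‖x - y‖ ^ 2 = 2 - 2 * ip x y := by
      rw [norm_sub_sq_real, hnorm x hx, hnorm y hy]; unfold ip; ring
    have h3 : ‖x + y‖ ^ 2 = 2 + 2 * ip x y := by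
      rw [norm_add_sq_real, hnorm x hx, hnorm y hy]; unfold ip; ring
    rw [dist_eq_norm] at h1
    have h4 : 1 ≤ ‖x - y‖ ^ 2 := one_le_pow₀ h1
    have h5 : 0 ≤ ‖x + y‖ ^ 2 := by positivity
    unfold XX
    constructor <;> linarith
  have hak : ∀ a ∈ akR, 0 ≤ a := by
    intro a ha
    rw [akR, List.mem_map] at ha
    obtain ⟨n, _, rfl⟩ := ha
    exact Nat.cast_nonneg n
  have two := psd17_sum S h11 akR hak 0
  have e2 : ∑ x ∈ S, ∑ y ∈ S, sumG 17 (1024 * ip x y) (2 ^ 20) akR 0 =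
      ∑ z ∈ S, (sumG 17 1024 (2 ^ 20) akR 0 + ∑ x ∈ S.erase z, sumG 17 (32 * (3 * XX x z - 8)) (2 ^ 20) akR 0) := by
    refine Finset.sum_congr rfl fun z hz => ?_
    rw [← Finset.add_sum_erase S _ hz, h11 z hz, mul_one]
    congr 1
    refine Finset.sum_congr rfl fun x _ => ?_
    rw [XX_U, ip_comm z x]
    congr 1
    ring
  have three : 0 ≤ ∑ z ∈ S, (Lam + (∑ x ∈ S.erase z, ((c0 * 2 ^ 129 : ℕ) : ℝ) * g l00 16 (XX x z) +
      ∑ x ∈ S.erase z, (AA cols (XX x z) (XX x z) 32 +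
        ∑ y ∈ (S.erase z).erase x, AA cols (XX x z) (XX y z) (32 * ip x y)))) := by
    refine Finset.sum_nonneg fun z hz => ?_
    refine (three_pt z (h11 z hz) (S.erase z) fun x hx => h11 x (Finset.mem_of_mem_erase hx)).trans_eq ?_
    congr 2
    refine Finset.sum_congr rfl fun x hx => ?_
    rw [← Finset.add_sum_erase (S.erase z) _ hx, h11 x (Finset.mem_of_mem_erase hx), mul_one]
  have trip := triples S (fun x y z => AA cols (XX x z) (XX y z) (32 * ip x y)) (by
    intro x hx y hy z hz hxy hxz hyz
    have h := TT_le (XX x z) (XX y z) (XX x y) (hle x hx z hz hxz) (hle y hy z hz hyz) (hle x hx y hy hxy) (by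
      rw [XX_U, XX_U, XX_U]
      simpa using dt_nonneg x y z (h11 x hx) (h11 y hy) (h11 z hz))
    rw [TT, XX_U, XX_U, XX_U] at h
    change AA cols (XX x z) (XX y z) (32 * ip x y) + AA cols (XX z x) (XX y x) (32 * ip z y) +
      AA cols (XX z y) (XX x y) (32 * ip z x) ≤ 0
    rw [XX_comm z x, XX_comm y x, ip_comm z y, XX_comm z y, ip_comm z x]
    linarith)
  have pp : ∑ z ∈ S, ∑ x ∈ S.erase z, (PP (XX x z) + 2 ^ 256) ≤ 0 := by
    refine Finset.sum_nonpos fun z hz => Finset.sum_nonpos fun x hx => ?_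
    have := hle x (Finset.mem_of_mem_erase hx) z hz (Finset.ne_of_mem_erase hx)
    exact PP_le _ this.1 this.2
  rw [e2] at two
  have e3 : ∑ z ∈ S, ∑ x ∈ S.erase z, (2 : ℝ) ^ 256 = S.card * ((S.card - 1) * 2 ^ 256) := by
    rw [← nsmul_eq_mul, ← Finset.sum_const]
    refine Finset.sum_congr rfl fun z hz => ?_
    rw [Finset.sum_const, nsmul_eq_mul, Finset.card_erase_of_mem hz,
      Nat.cast_sub (Finset.card_pos.mpr ⟨z, hz⟩), Nat.cast_one]
  unfold PP at pp
  simp only [Finset.sum_add_distrib, Finset.sum_const, nsmul_eq_mul] at two three trip pp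
  simp only [Finset.sum_const, nsmul_eq_mul] at e3
  rw [e3] at pp
  by_contra hc
  have hN : (11073 : ℝ) ≤ S.card := by exact_mod_cast (by omega : 11073 ≤ S.card)
  have hn := numeric
  have key : (S.card : ℝ) * ((S.card - 1) * 2 ^ 256) ≤ S.card * (Lam + sumG 17 1024 (2 ^ 20) akR 0) := by
    rw [mul_add]; linarith
  have key2 := le_of_mul_le_mul_left key (by linarith)
  have : (11072 : ℝ) * 2 ^ 256 ≤ (S.card - 1) * 2 ^ 256 :=
    mul_le_mul_of_nonneg_right (by linarith) (by positivity)
  linarith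
end Kiss

theorem kissing_number_dim17_le_11072
    (S : Finset (EuclideanSpace ℝ (Fin 17)))
    (hnorm : ∀ x ∈ S, ‖x‖ = 1)
    (hdist : ∀ x ∈ S, ∀ y ∈ S, x ≠ y → 1 ≤ dist x y) :
    S.card ≤ 11072 := by
  exact Kiss.main S hnorm hdist
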